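/- Let X be a very general hypersurface of bi-degree (d,2) in ℙ^{n−1} × ℙ² over ℂ, i.e. defined by a very general bihomogeneous polynomial of degree d in the ℙ^{n−1}-coordinates and degree 2 in the ℙ²-coordinates. If d ≥ n ≥ 3, then X is not stably rational. -/

import Mathlib

/-!
Formalization framework for "Stable rationality of higher dimensional conic bundles"
(Ahmadinezhad–Okada).

We model a weighted-projective-space bundle `P` over `ℙ^{n-1}` (in particular the
`ℙ²`-bundle `P_n(k,l,m) = ℙ(𝒪(-k) ⊕ 𝒪(-l) ⊕ 𝒪(-m))`, and the `ℙ(1,1,2)`-bundle `R`)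
through its Cox ring `K[u_0,…,u_{n-1}, x_0,…,x_{m-1}]`, bigraded by
`deg u_i = (1,0)`, `deg x_j = (w j, a j)`, together with the action of the
two-dimensional torus on the affine cone.  A member `X` of the complete linear
system `|𝒪_P(α,β)| = |α F + β D|` (`F` the pullback of the hyperplane class of
`ℙ^{n-1}`, `D` the tautological class) is recorded by a bihomogeneous polynomial
`g` of bidegree `(α,β)`, and the projection `π : X → ℙ^{n-1}` is induced by the
coordinates `u_0,…,u_{n-1}`.

Geometric notions are rendered as follows (all are genuine definitions):

* a *general* (resp. *very general*) member of a linear system: the property holds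
  on a nonempty principal Zariski-open subset of the parameter space (resp. away
  from countably many proper closed subsets);
* smoothness of `X`: the Jacobian criterion on the punctured affine cone (where the
  torus acts freely the quotient map is a torsor, so this is smoothness of `X`);
* the function field `K(X)`: the degree-`(0,0)` part of the fraction field of the
  homogeneous coordinate ring `Cox/(g)`, i.e. the subalgebra generated by ratios of
  bihomogeneous elements of equal bidegree;
* rationality: `K(X)` is `K`-isomorphic to a purely transcendental extension of
  `K` (i.e. `X` is birational to a projective space);
* stable rationality: `K(X)(x_1,…,x_r) ≅_K K(y_1,…,y_s)` for some `r,s`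
  (i.e. `X × ℙ^r` is birational to a projective space);
* normality: the local rings of the relevant locus of the affine cone are
  integrally closed (the punctured cone is a smooth torsor over `X`);
* terminal singularities: rendered as `X` normal with singular locus of
  codimension at least 3, which is the form terminality takes for the general
  members appearing in the paper;
* ℚ-factoriality together with `ρ(X) = 2` (i.e. the divisor class group of `X` is
  spanned up to torsion by the fibre class `F` and the tautological class `D`):
  rendered by requiring every relevant bihomogeneous height-one prime `P` of the
  coordinate ring of `X` to contain a bihomogeneous element lying in no other such
  prime (so that `div(f) = k·P` and `[P] ∈ ℚ⟨F, D⟩`);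
* ampleness of `𝒪_X(α,β)`: some multiple is very ample, rendered by requiring the
  bihomogeneous sections of that multiple to be base point free, to separate
  points, and to separate tangent vectors (modulo the torus directions) on the
  cone over `X`;
* `π`-ampleness of `-K_X`: by adjunction `-K_X = 𝒪_X(e,1)` with
  `e = n + Σ w - deg g`, and relative ampleness over the projective base means
  some twist `𝒪_X(e+N,1)` by pullback classes from `ℙ^{n-1}` is ample;
* connectedness of the fibres of `π : X → ℙ^{n-1}`: no fibre admits a disjoint
  covering by two zero sets of families of weighted-homogeneous polynomials, each
  meeting the fibre (i.e. Zariski-connectedness of the fibres), and all fibres are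
  nonempty;
* a conic bundle (Mori fibre space of relative dimension one, Definition 2.5 of
  the paper): `X` is irreducible (the ideal of `g` is prime), normal, has only
  terminal singularities, `π` has connected fibres, `-K_X` is `π`-ample, and
  `ρ(X) = 2`; all in the above renderings.
-/

open MvPolynomial

set_option maxHeartbeats 1600000
set_option synthInstance.maxHeartbeats 400000

namespace ConicBundleFormalization

noncomputable section

variable (K : Type) [Field K]

/-! ### The Cox ring and bihomogeneity -/

/-- The Cox ring of an `(m-1)`-dimensional weighted-projective-space bundle over
`ℙ^{n-1}`: variables `u_i` (`i : Fin n`) of bidegree `(1,0)` and fibre variables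
`x_j` (`j : Fin m`) of bidegree `(w j, a j)`. -/
abbrev Cox (n m : ℕ) : Type := MvPolynomial (Fin n ⊕ Fin m) K

/-- `p` is bihomogeneous of bidegree `(α, β)` for the grading `deg u_i = (1,0)`,
`deg x_j = (w j, a j)`. -/
def IsBihom (n m : ℕ) (w : Fin m → ℤ) (a : Fin m → ℕ) (α : ℤ) (β : ℕ)
    (p : Cox K n m) : Prop :=
  ∀ e ∈ p.support,
    ((∑ i : Fin n, (e (Sum.inl i) : ℤ)) + ∑ j : Fin m, (e (Sum.inr j) : ℤ) * w j = α) ∧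
    ((∑ j : Fin m, e (Sum.inr j) * a j) = β)

/-- A polynomial in `u_0, …, u_{n-1}` is homogeneous of degree `d ∈ ℤ`
(for `d < 0` this forces `p = 0`). -/
def IsHomogZ (n : ℕ) (d : ℤ) (p : MvPolynomial (Fin n) K) : Prop :=
  ∀ e ∈ p.support, (∑ i : Fin n, (e i : ℤ)) = d

/-- A polynomial in the fibre variables is weighted-homogeneous of degree `e` for
the weights `a`. -/
def IsWHom (m : ℕ) (a : Fin m → ℕ) (e : ℕ) (q : MvPolynomial (Fin m) K) : Prop :=
  ∀ ex ∈ q.support, (∑ j : Fin m, ex j * a j) = e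

/-! ### Genericity: general and very general members of a linear system -/

/-- Evaluation of a polynomial `D` in the coefficients of `p`; such `D` are the
polynomial functions on the parameter space of the linear system. -/
def evalCoeff {n m : ℕ} (p : Cox K n m)
    (D : MvPolynomial ((Fin n ⊕ Fin m) →₀ ℕ) K) : K :=
  MvPolynomial.eval (fun e => p.coeff e) D

/-- `Pred` holds for a *general* member of the complete linear system of
bihomogeneous polynomials of bidegree `(α,β)`: it holds on a nonempty principal
Zariski-open subset of the parameter space. -/
def GenerallyHolds (n m : ℕ) (w : Fin m → ℤ) (a : Fin m → ℕ) (α : ℤ) (β : ℕ)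
    (Pred : Cox K n m → Prop) : Prop :=
  ∃ D : MvPolynomial ((Fin n ⊕ Fin m) →₀ ℕ) K,
    (∃ p₀, IsBihom K n m w a α β p₀ ∧ evalCoeff K p₀ D ≠ 0) ∧
    ∀ p, IsBihom K n m w a α β p → evalCoeff K p D ≠ 0 → Pred p

/-- `Pred` holds for a *very general* member of the complete linear system of
bihomogeneous polynomials of bidegree `(α,β)`: it holds away from countably many
proper Zariski-closed subsets of the parameter space. -/
def VeryGenerallyHolds (n m : ℕ) (w : Fin m → ℤ) (a : Fin m → ℕ) (α : ℤ) (β : ℕ)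
    (Pred : Cox K n m → Prop) : Prop :=
  ∃ D : ℕ → MvPolynomial ((Fin n ⊕ Fin m) →₀ ℕ) K,
    (∀ i, ∃ p₀, IsBihom K n m w a α β p₀ ∧ evalCoeff K p₀ (D i) ≠ 0) ∧
    ∀ p, IsBihom K n m w a α β p → (∀ i, evalCoeff K p (D i) ≠ 0) → Pred p

/-- Evaluation of a polynomial `D` in the coefficients of a quadruple
`(a,b,c,f)` of polynomials in `u_0,…,u_{n-1}`. -/
def evalCoeff4 {n : ℕ} (abcf : Fin 4 → MvPolynomial (Fin n) K)
    (D : MvPolynomial (Fin 4 × (Fin n →₀ ℕ)) K) : K :=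
  MvPolynomial.eval (fun q => (abcf q.1).coeff q.2) D

/-- `Pred` holds for a *general* quadruple `(a,b,c,f)` of homogeneous polynomials
in `u_0,…,u_{n-1}` of respective degrees `degs 0, …, degs 3`. -/
def GenerallyHolds4 (n : ℕ) (degs : Fin 4 → ℤ)
    (Pred : (Fin 4 → MvPolynomial (Fin n) K) → Prop) : Prop :=
  ∃ D : MvPolynomial (Fin 4 × (Fin n →₀ ℕ)) K,
    (∃ abcf : Fin 4 → MvPolynomial (Fin n) K,
      (∀ i, IsHomogZ K n (degs i) (abcf i)) ∧ evalCoeff4 K abcf D ≠ 0) ∧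
    ∀ abcf : Fin 4 → MvPolynomial (Fin n) K,
      (∀ i, IsHomogZ K n (degs i) (abcf i)) → evalCoeff4 K abcf D ≠ 0 → Pred abcf

/-! ### Points of the bundle: the punctured affine cone and the torus action -/

/-- A point of the affine cone `𝔸^n × 𝔸^m` over the bundle. -/
abbrev Pt (n m : ℕ) : Type := (Fin n → K) × (Fin m → K)

/-- Evaluation of a Cox ring element at a point of the affine cone. -/
def evalPt {n m : ℕ} (p : Pt K n m) (f : Cox K n m) : K :=
  MvPolynomial.eval (Sum.elim p.1 p.2) f

/-- Membership in the complement of the irrelevant locus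
`V(u_0,…,u_{n-1}) ∪ V(x_0,…,x_{m-1})`. -/
def InCone {n m : ℕ} (p : Pt K n m) : Prop := p.1 ≠ 0 ∧ p.2 ≠ 0

/-- Equivalence of two cone points under the action of the torus `𝔾_m²`:
`(s,t)·(u,x) = (s·u_i, s^{w j} t^{a j}·x_j)`.  The points of the bundle are the
equivalence classes of points of the punctured cone. -/
def ToricEq {n m : ℕ} (w : Fin m → ℤ) (a : Fin m → ℕ) (p q : Pt K n m) : Prop :=
  ∃ s t : Kˣ, (∀ i, q.1 i = (s : K) * p.1 i) ∧
    (∀ j, q.2 j = ((s ^ (w j) : Kˣ) : K) * (t : K) ^ (a j) * p.2 j)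

/-- The punctured affine cone over the member `X = {g = 0}`. -/
def XCone {n m : ℕ} (g : Cox K n m) : Set (Pt K n m) :=
  {p | InCone K p ∧ evalPt K p g = 0}

/-! ### Smoothness via the Jacobian criterion on the cone -/

/-- The hypersurface `{g = 0}` is smooth along (the image of) `S ⊆ 𝔸^n × 𝔸^m`: at
every point of `S` lying on the cone over `X` some partial derivative of `g` is
nonzero.  On loci where the torus acts freely this is the Jacobian criterion for
smoothness of `X` itself. -/
def JacobiSmoothOn {n m : ℕ} (g : Cox K n m) (S : Set (Pt K n m)) : Prop :=
  ∀ p ∈ S, evalPt K p g = 0 → ∃ v : Fin n ⊕ Fin m, evalPt K p (pderiv v g) ≠ 0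

/-- The member `X = {g = 0}` of the linear system is smooth (nonsingular). -/
def IsSmoothModel {n m : ℕ} (g : Cox K n m) : Prop :=
  JacobiSmoothOn K g {p | InCone K p}

/-! ### The function field, rationality, and stable rationality -/

/-- The homogeneous coordinate ring `Cox/(g)` of the member `X = {g = 0}`,
i.e. the coordinate ring of the affine cone over `X`. -/
abbrev coneRing {n m : ℕ} (g : Cox K n m) : Type :=
  Cox K n m ⧸ Ideal.span {g}

/-- The total fraction ring of the affine cone over `X`; the function field of the
cone when `g` is prime. -/
def FracCone {n m : ℕ} (g : Cox K n m) : Type := FractionRing (coneRing K g)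

instance {n m : ℕ} (g : Cox K n m) : CommRing (FracCone K g) :=
  inferInstanceAs (CommRing (FractionRing (coneRing K g)))

instance {n m : ℕ} (g : Cox K n m) : Algebra K (FracCone K g) :=
  inferInstanceAs (Algebra K (FractionRing (coneRing K g)))

instance {n m : ℕ} (g : Cox K n m) : Algebra (coneRing K g) (FracCone K g) :=
  inferInstanceAs (Algebra (coneRing K g) (FractionRing (coneRing K g)))

/-- The canonical map from the Cox ring to the fraction ring of the cone over `X`. -/
def toFrac {n m : ℕ} (g : Cox K n m) : Cox K n m →+* FracCone K g :=
  (algebraMap (coneRing K g) (FracCone K g)).comp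
    (Ideal.Quotient.mk (Ideal.span {g}))

/-- The set of degree-`(0,0)` fractions on the cone over `X`: ratios `p/q` of
bihomogeneous elements of equal bidegree (phrased multiplicatively, avoiding
inverses). -/
def ratioSet {n m : ℕ} (w : Fin m → ℤ) (a : Fin m → ℕ) (g : Cox K n m) :
    Set (FracCone K g) :=
  {φ | ∃ (α : ℤ) (β : ℕ) (p q : Cox K n m),
    IsBihom K n m w a α β p ∧ IsBihom K n m w a α β q ∧
    toFrac K g q ≠ 0 ∧ φ * toFrac K g q = toFrac K g p}

/-- The `K`-algebra of rational functions on `X = {g = 0}`: the fractions of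
degree `(0,0)`.  When `g` is prime this is the function field `K(X)`. -/
def functionFieldModel {n m : ℕ} (w : Fin m → ℤ) (a : Fin m → ℕ) (g : Cox K n m) :
    Subalgebra K (FracCone K g) :=
  Algebra.adjoin K (ratioSet K w a g)

/-- `X = {g = 0}` is rational: its function field is `K`-isomorphic to a purely
transcendental extension `K(y_1,…,y_N)` of `K`, i.e. `X` is birational to a
projective space. -/
def IsRationalModel {n m : ℕ} (w : Fin m → ℤ) (a : Fin m → ℕ) (g : Cox K n m) :
    Prop :=
  ∃ N : ℕ, Nonempty
    (functionFieldModel K w a g ≃ₐ[K] FractionRing (MvPolynomial (Fin N) K))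

/-- `X = {g = 0}` is stably rational: `X × ℙ^r` is birational to a projective
space for some `r`, i.e. `K(X)(x_1,…,x_r) ≅_K K(y_1,…,y_s)` for some `r, s`. -/
def IsStablyRationalModel {n m : ℕ} (w : Fin m → ℤ) (a : Fin m → ℕ)
    (g : Cox K n m) : Prop :=
  ∃ r s : ℕ, Nonempty
    ((FractionRing (MvPolynomial (Fin r) (functionFieldModel K w a g)))
      ≃ₐ[K] FractionRing (MvPolynomial (Fin s) K))

/-! ### Normality, terminal singularities, class group, ampleness, fibres -/

/-- A prime of the Cox ring is *relevant* if it does not contain either component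
of the irrelevant ideal `(u_0,…,u_{n-1}) ∩ (x_0,…,x_{m-1})`. -/
def RelevantPrime {n m : ℕ} (P : Ideal (Cox K n m)) : Prop :=
  (∃ i, X (Sum.inl i) ∉ P) ∧ (∃ j, X (Sum.inr j) ∉ P)

/-- `X = {g = 0}` is normal: the local rings of the relevant locus of its affine
cone are integrally closed (the punctured cone is a smooth torsor over `X`, so
this is normality of `X`). -/
def IsNormalModel {n m : ℕ} (g : Cox K n m) : Prop :=
  ∀ P : PrimeSpectrum (coneRing K g),
    ((∃ i, Ideal.Quotient.mk (Ideal.span {g}) (X (Sum.inl i)) ∉ P.asIdeal) ∧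
     (∃ j, Ideal.Quotient.mk (Ideal.span {g}) (X (Sum.inr j)) ∉ P.asIdeal)) →
    IsIntegrallyClosed (Localization.AtPrime P.asIdeal)

/-- The singular locus of `X = {g = 0}` has codimension at least `c`: every
relevant prime of the Cox ring containing `g` and all its partial derivatives has
height at least `c + 1` (the height in the cone exceeds the codimension in `X`
by one). -/
def SingularLocusCodimAtLeast {n m : ℕ} (g : Cox K n m) (c : ℕ) : Prop :=
  ∀ P : PrimeSpectrum (Cox K n m), RelevantPrime K P.asIdeal →
    g ∈ P.asIdeal → (∀ v : Fin n ⊕ Fin m, pderiv v g ∈ P.asIdeal) →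
    ((c + 1 : ℕ) : WithBot (WithTop ℕ)) ≤ ringKrullDim (Localization.AtPrime P.asIdeal)

/-- Rendering of "`X` has only terminal singularities" for the members considered
in the paper: `X` is normal and its singular locus has codimension at least 3
(cf. the proof of Lemma 2.8, where the general members with `2m > d > l+m` have
ordinary double points along a nonsingular center of codimension 3). -/
def HasOnlyTerminalSingularitiesModel {n m : ℕ} (g : Cox K n m) : Prop :=
  IsNormalModel K g ∧ SingularLocusCodimAtLeast K g 3

/-- An ideal of the Cox ring is bihomogeneous if it is generated by its
bihomogeneous elements. -/
def IsBihomIdeal {n m : ℕ} (w : Fin m → ℤ) (a : Fin m → ℕ)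
    (P : Ideal (Cox K n m)) : Prop :=
  P ≤ Ideal.span {f | f ∈ P ∧ ∃ α β, IsBihom K n m w a α β f}

/-- A prime divisor of `X = {g = 0}`: a relevant bihomogeneous prime of the Cox
ring containing `g` of height 2 (height 1 over `(g)`). -/
def IsPrimeDivisorOn {n m : ℕ} (w : Fin m → ℤ) (a : Fin m → ℕ) (g : Cox K n m)
    (P : PrimeSpectrum (Cox K n m)) : Prop :=
  g ∈ P.asIdeal ∧ RelevantPrime K P.asIdeal ∧ IsBihomIdeal K w a P.asIdeal ∧
    ringKrullDim (Localization.AtPrime P.asIdeal) = (2 : WithBot (WithTop ℕ))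

/-- Rendering of "`X` is ℚ-factorial with `ρ(X) = 2`", i.e. the divisor class
group of `X` is spanned up to torsion by the pullback `F` of the hyperplane class
and the tautological class `D`: every prime divisor `P` of `X` carries a
bihomogeneous form `f` vanishing on `P` and on no other prime divisor, so that
`div(f) = k·P` for some `k ≥ 1` and hence `[P] ∈ ℚ⟨F,D⟩` in `Cl(X) ⊗ ℚ`. -/
def ClassGroupSpannedByFD {n m : ℕ} (w : Fin m → ℤ) (a : Fin m → ℕ)
    (g : Cox K n m) : Prop :=
  ∀ P : PrimeSpectrum (Cox K n m), IsPrimeDivisorOn K w a g P →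
    ∃ (α : ℤ) (β : ℕ) (f : Cox K n m),
      f ∉ Ideal.span {g} ∧ IsBihom K n m w a α β f ∧ f ∈ P.asIdeal ∧
      ∀ Q : PrimeSpectrum (Cox K n m), IsPrimeDivisorOn K w a g Q → Q ≠ P →
        f ∉ Q.asIdeal

/-- Rendering of "`ρ(X) ≥ 3`": the divisor class group of `X` is not spanned up to
torsion by the fibre class `F` and the tautological class `D`. -/
def PicardRankAtLeastThree {n m : ℕ} (w : Fin m → ℤ) (a : Fin m → ℕ)
    (g : Cox K n m) : Prop :=
  ¬ ClassGroupSpannedByFD K w a g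

/-- The cone over the fibre of `π : X → ℙ^{n-1}` over the point `[u] ∈ ℙ^{n-1}`. -/
def fibreCone {n m : ℕ} (g : Cox K n m) (u : Fin n → K) : Set (Fin m → K) :=
  {v | v ≠ 0 ∧ evalPt K (u, v) g = 0}

/-- The fibres of `π : X → ℙ^{n-1}` are nonempty and connected: no fibre can be
covered by two disjoint nonempty closed subsets, closed subsets of the fibre
being cut out by weighted-homogeneous polynomials in the fibre variables. -/
def FibresNonemptyAndConnected {n m : ℕ} (a : Fin m → ℕ) (g : Cox K n m) : Prop :=
  ∀ u : Fin n → K, u ≠ 0 →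
    (fibreCone K g u).Nonempty ∧
    ∀ A B : Set (MvPolynomial (Fin m) K),
      (∀ q ∈ A ∪ B, ∃ e, IsWHom K m a e q) →
      (∀ v ∈ fibreCone K g u,
        (∀ q ∈ A, MvPolynomial.eval v q = 0) ∨ (∀ q ∈ B, MvPolynomial.eval v q = 0)) →
      (∀ v ∈ fibreCone K g u,
        ¬ ((∀ q ∈ A, MvPolynomial.eval v q = 0) ∧ (∀ q ∈ B, MvPolynomial.eval v q = 0))) →
      ¬ ((∃ v ∈ fibreCone K g u, ∀ q ∈ A, MvPolynomial.eval v q = 0) ∧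
         (∃ v ∈ fibreCone K g u, ∀ q ∈ B, MvPolynomial.eval v q = 0))

/-- The infinitesimal generator of the first torus factor at a cone point. -/
def orbitVec₁ {n m : ℕ} (w : Fin m → ℤ) (p : Pt K n m) : (Fin n ⊕ Fin m) → K :=
  Sum.elim (fun i => p.1 i) (fun j => (w j : K) * p.2 j)

/-- The infinitesimal generator of the second torus factor at a cone point. -/
def orbitVec₂ {n m : ℕ} (a : Fin m → ℕ) (p : Pt K n m) : (Fin n ⊕ Fin m) → K :=
  Sum.elim (fun _ => 0) (fun j => (a j : K) * p.2 j)

/-- The bihomogeneous forms of bidegree `(α,β)` have no base point on `X`. -/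
def BasePointFreeOnX {n m : ℕ} (w : Fin m → ℤ) (a : Fin m → ℕ) (g : Cox K n m)
    (α : ℤ) (β : ℕ) : Prop :=
  ∀ p ∈ XCone K g, ∃ s, IsBihom K n m w a α β s ∧ evalPt K p s ≠ 0

/-- The bihomogeneous forms of bidegree `(α,β)` separate the points of `X`. -/
def SeparatesPointsOnX {n m : ℕ} (w : Fin m → ℤ) (a : Fin m → ℕ) (g : Cox K n m)
    (α : ℤ) (β : ℕ) : Prop :=
  ∀ p ∈ XCone K g, ∀ q ∈ XCone K g, ¬ ToricEq K w a p q →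
    ∃ s₁ s₂, IsBihom K n m w a α β s₁ ∧ IsBihom K n m w a α β s₂ ∧
      evalPt K p s₁ * evalPt K q s₂ ≠ evalPt K q s₁ * evalPt K p s₂

/-- The bihomogeneous forms of bidegree `(α,β)` separate the tangent vectors of
`X`: for every cone point `p` of `X` and every tangent vector `t` of the cone over
`X` at `p` not tangent to the torus orbit, some form vanishing at `p` has nonzero
derivative along `t`. -/
def SeparatesTangentsOnX {n m : ℕ} (w : Fin m → ℤ) (a : Fin m → ℕ) (g : Cox K n m)
    (α : ℤ) (β : ℕ) : Prop :=
  ∀ p ∈ XCone K g, ∀ t : (Fin n ⊕ Fin m) → K,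
    (∑ v : Fin n ⊕ Fin m, t v * evalPt K p (pderiv v g)) = 0 →
    t ∉ Submodule.span K {orbitVec₁ K w p, orbitVec₂ K a p} →
    ∃ s, IsBihom K n m w a α β s ∧ evalPt K p s = 0 ∧
      (∑ v : Fin n ⊕ Fin m, t v * evalPt K p (pderiv v s)) ≠ 0

/-- The class `𝒪_X(α,β)` is ample on `X = {g = 0}`: some positive multiple is very
ample, i.e. its forms are base point free on `X` and separate points and tangent
vectors. -/
def IsAmpleClassOnX {n m : ℕ} (w : Fin m → ℤ) (a : Fin m → ℕ) (g : Cox K n m)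
    (α : ℤ) (β : ℕ) : Prop :=
  ∃ t : ℕ, 0 < t ∧
    BasePointFreeOnX K w a g (t * α) (t * β) ∧
    SeparatesPointsOnX K w a g (t * α) (t * β) ∧
    SeparatesTangentsOnX K w a g (t * α) (t * β)

/-- The canonical class of the ambient bundle `P`, by the toric formula
`K_P = -Σ deg(variables)`. -/
def ambientCanonicalClass (n m : ℕ) (w : Fin m → ℤ) : ℤ × ℤ :=
  (-(n : ℤ) - ∑ j : Fin m, w j, -(m : ℤ))

/-- The anticanonical class `-K_X = -(K_P + X)|_X` of a member `X ∈ |𝒪_P(α,β)|`,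
by adjunction. -/
def memberAntiCanonicalClass (n m : ℕ) (w : Fin m → ℤ) (α : ℤ) (β : ℕ) : ℤ × ℤ :=
  (-((ambientCanonicalClass n m w).1 + α), -((ambientCanonicalClass n m w).2 + β))

/-- `-K_X` is `π`-ample for the projection `π : X → ℙ^{n-1}`: some twist of `-K_X`
by the pullback of a (sufficiently ample) divisor on the base is ample. -/
def AntiCanonicalIsRelativelyAmple {n m : ℕ} (w : Fin m → ℤ) (a : Fin m → ℕ)
    (g : Cox K n m) (α : ℤ) (β : ℕ) : Prop :=
  ∃ N : ℤ,
    IsAmpleClassOnX K w a g ((memberAntiCanonicalClass n m w α β).1 + N)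
      (memberAntiCanonicalClass n m w α β).2.toNat

/-- Rendering of Definition 2.5 of the paper: the projection
`π : X → ℙ^{n-1}` of the member `X = {g = 0} ∈ |𝒪_P(d,2)|` of the `ℙ²`-bundle
`P = P_n(w 0, w 1, w 2)` over `ℙ^{n-1}` is a *conic bundle*, i.e. a Mori fibre
space of relative dimension one: `X` is an (irreducible, normal, projective)
variety with only terminal singularities, `π` has connected fibres, `-K_X` is
`π`-ample, and `X` is ℚ-factorial of Picard rank `ρ(X) = 2`.  (Being embedded in
`|𝒪_P(d,2)|` of a projectivized split rank-3 bundle, this is an *embedded* conic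
bundle in the sense of Definition 2.6.) -/
structure IsConicBundleModel (n : ℕ) (w : Fin 3 → ℤ) (d : ℤ) (g : Cox K n 3) :
    Prop where
  bihom : IsBihom K n 3 w (fun _ => 1) d 2 g
  integral : (Ideal.span {g} : Ideal (Cox K n 3)).IsPrime
  normal : IsNormalModel K g
  terminal : HasOnlyTerminalSingularitiesModel K g
  connectedFibres : FibresNonemptyAndConnected K (fun _ => 1) g
  antiCanonicalRelAmple :
    AntiCanonicalIsRelativelyAmple K w (fun _ => 1) g d 2
  picardRankTwo : ClassGroupSpannedByFD K w (fun _ => 1) g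

/-! ### The discriminant of a conic bundle -/

/-- The coefficient of the monomial `x^e` (in the fibre variables) of `g`, as a
polynomial on the base. -/
def fibreCoeff {n m : ℕ} (g : Cox K n m) (e : Fin m →₀ ℕ) :
    MvPolynomial (Fin n) K :=
  ((MvPolynomial.sumAlgEquiv K (Fin m) (Fin n))
    (MvPolynomial.rename Sum.swap g)).coeff e

/-- The symmetric matrix of the fibrewise quadratic form of a member
`X = {g = 0} ∈ |𝒪_P(d,2)|` (over a field of characteristic zero). -/
def quadraticMatrix {n : ℕ} (g : Cox K n 3) :
    Matrix (Fin 3) (Fin 3) (MvPolynomial (Fin n) K) :=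
  fun i j =>
    if i = j then fibreCoeff K g (Finsupp.single i 2)
    else MvPolynomial.C ((2 : K)⁻¹) *
      fibreCoeff K g (Finsupp.single i 1 + Finsupp.single j 1)

/-- The equation of the discriminant divisor `Δ ⊂ ℙ^{n-1}` of the conic bundle
`π : X → ℙ^{n-1}`, `X = {g = 0}`: the determinant of the associated symmetric
matrix. -/
def discriminantPoly {n : ℕ} (g : Cox K n 3) : MvPolynomial (Fin n) K :=
  (quadraticMatrix K g).det

/-- The complete linear system `|k·K_{ℙ^{n-1}} + Δ|` is nonempty, where `Δ` is the
discriminant divisor of the conic bundle `X = {g = 0}`: the divisor class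
`𝒪(deg Δ - k·n)` on `ℙ^{n-1}` contains an effective divisor. -/
def KMultipleplusDiscriminantEffective {n : ℕ} (g : Cox K n 3) (k : ℕ) : Prop :=
  discriminantPoly K g ≠ 0 ∧
    ∃ h : MvPolynomial (Fin n) K, h ≠ 0 ∧
      IsHomogZ K n (((discriminantPoly K g).totalDegree : ℤ) - k * n) h

/-- `π : X → ℙ^{n-1}` is flat, i.e. no fibre is two-dimensional: `g` does not
vanish identically on any fibre of the ambient bundle.  Together with smoothness
of `X` this renders a *standard* conic bundle. -/
def ProjectionIsFlat {n m : ℕ} (g : Cox K n m) : Prop :=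
  ∀ u : Fin n → K, u ≠ 0 → ∃ v : Fin m → K, evalPt K (u, v) g ≠ 0

end

end ConicBundleFormalization

namespace ConicBundleFormalization

noncomputable section

variable (K : Type) [Field K]

/-! ### The special members `a x² + b y² + c z² + f x y` and the associated double
cover data in characteristic 2 -/

/-- The special member `X = {a x² + b y² + c z² + f x y = 0}` of
`|𝒪_P(λ+μ+ν, 2)|`, `P = P_n(λ,μ,ν)`, built from a quadruple `(a,b,c,f)` of
polynomials on the base (equation (3.1) of the paper). -/
def specialMemberX {n : ℕ} (abcf : Fin 4 → MvPolynomial (Fin n) K) : Cox K n 3 :=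
  rename Sum.inl (abcf 0) * X (Sum.inr 0) ^ 2 +
  rename Sum.inl (abcf 1) * X (Sum.inr 1) ^ 2 +
  rename Sum.inl (abcf 2) * X (Sum.inr 2) ^ 2 +
  rename Sum.inl (abcf 3) * X (Sum.inr 0) * X (Sum.inr 1)

/-- The hypersurface `Z = {a x² + b y² + c z̄ + f x y = 0}` in the
`ℙ(1,1,2)`-bundle `R` over `ℙ^{n-1}` (with `z̄` the third fibre variable, of
weight 2), the image of `X` under the purely inseparable double cover `P → R` in
characteristic 2. -/
def specialMemberZ {n : ℕ} (abcf : Fin 4 → MvPolynomial (Fin n) K) : Cox K n 3 :=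
  rename Sum.inl (abcf 0) * X (Sum.inr 0) ^ 2 +
  rename Sum.inl (abcf 1) * X (Sum.inr 1) ^ 2 +
  rename Sum.inl (abcf 2) * X (Sum.inr 2) +
  rename Sum.inl (abcf 3) * X (Sum.inr 0) * X (Sum.inr 1)

/-! ### Admissible critical points (Definition 3.5 of the paper) -/

/-- A polynomial `F` in `N` variables over a field of characteristic 2 is in
*admissible normal form* at the origin: its linear part vanishes (a critical
point) and, up to an additive constant and higher-order terms,
`F = α + x₀x₁ + x₂x₃ + ⋯ + x_{N-2}x_{N-1}` if `N` is even, and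
`F = α + βx₀² + x₁x₂ + ⋯ + x_{N-2}x_{N-1} + (nonzero)·x₀³ + ⋯` if `N` is odd. -/
def AdmissibleNormalForm {N : ℕ} (F : MvPolynomial (Fin N) K) : Prop :=
  (∀ i, F.coeff (Finsupp.single i 1) = 0) ∧
  (N % 2 = 0 →
    (∀ i, F.coeff (Finsupp.single i 2) = 0) ∧
    (∀ i j : Fin N, (i : ℕ) < (j : ℕ) →
      F.coeff (Finsupp.single i 1 + Finsupp.single j 1) =
        (if (i : ℕ) % 2 = 0 ∧ (j : ℕ) = (i : ℕ) + 1 then 1 else 0))) ∧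
  (N % 2 = 1 →
    (∀ i : Fin N, (i : ℕ) ≠ 0 → F.coeff (Finsupp.single i 2) = 0) ∧
    (∀ i j : Fin N, (i : ℕ) < (j : ℕ) →
      F.coeff (Finsupp.single i 1 + Finsupp.single j 1) =
        (if (i : ℕ) % 2 = 1 ∧ (j : ℕ) = (i : ℕ) + 1 then 1 else 0)) ∧
    (∀ h0 : 0 < N, F.coeff (Finsupp.single (⟨0, h0⟩ : Fin N) 3) ≠ 0))

/-- A local function `F` (a polynomial in the local coordinates indexed by `ι`,
centred at the origin) has an *admissible critical point* at the origin: after a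
suitable (linear) change of coordinates it is in admissible normal form. -/
def AdmissibleLocalFunction {ι : Type} [Fintype ι] (F : MvPolynomial ι K) : Prop :=
  ∃ (N : ℕ) (e : ι ≃ Fin N) (T : Matrix (Fin N) (Fin N) K), IsUnit T.det ∧
    AdmissibleNormalForm K
      ((aeval (fun i : ι => ∑ j : Fin N, MvPolynomial.C (T (e i) j) * X j)) F)

/-- The local expression of the section `z̄` of `𝓛²` on the chart `x = 1` of `Z`
(multiplied by the square unit `c̃²`, i.e. computed with respect to the local
generator `c̃·ξ` of `𝓛`): the polynomial `c·(a + b·y² + f·y)` in the base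
variables and the remaining fibre variable `y`. -/
def chartPolyX {n : ℕ} (abcf : Fin 4 → MvPolynomial (Fin n) K) :
    MvPolynomial (Fin n ⊕ Fin 1) K :=
  rename Sum.inl (abcf 2) *
    (rename Sum.inl (abcf 0) + rename Sum.inl (abcf 1) * X (Sum.inr 0) ^ 2 +
      rename Sum.inl (abcf 3) * X (Sum.inr 0))

/-- The local expression of the section `z̄` on the chart `y = 1` of `Z`:
the polynomial `c·(a·x² + b + f·x)`. -/
def chartPolyY {n : ℕ} (abcf : Fin 4 → MvPolynomial (Fin n) K) :
    MvPolynomial (Fin n ⊕ Fin 1) K :=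
  rename Sum.inl (abcf 2) *
    (rename Sum.inl (abcf 0) * X (Sum.inr 0) ^ 2 + rename Sum.inl (abcf 1) +
      rename Sum.inl (abcf 3) * X (Sum.inr 0))

/-- Translation of a chart polynomial to local coordinates centred at the point
with base coordinates `u0` (normalized by `u0 i0 = 1`) and fibre coordinate `y0`:
substitute `u_{i0} ↦ 1`, `u_j ↦ u_j + u0 j` and `y ↦ y + y0`.  The variables are
the genuine local coordinates `{u_j : j ≠ i0} ∪ {y}` of `Z` at that point. -/
def localAt {n : ℕ} (i0 : Fin n) (u0 : Fin n → K) (y0 : K)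
    (G : MvPolynomial (Fin n ⊕ Fin 1) K) :
    MvPolynomial ({ j : Fin n // j ≠ i0 } ⊕ Fin 1) K :=
  aeval (Sum.elim
    (fun j => if h : j = i0 then 1 else X (Sum.inl ⟨j, h⟩) + MvPolynomial.C (u0 j))
    (fun _ => X (Sum.inr 0) + MvPolynomial.C y0)) G

/-- The section `z̄` of `𝓛²` on `Z = {gZ = 0}` has a *critical point* at the point
below the normalized cone point `p` (with `u_{i0} = 1` and the fibre coordinate
`jfix ∈ {x, y}` normalized to 1): the differential of `z̄` vanishes on the tangent
space of `Z` at that point, i.e. every chart tangent vector `t` of `Z` has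
vanishing `z̄`-component. -/
def CriticalPointOfZbar {n : ℕ} (gZ : Cox K n 3) (i0 : Fin n) (jfix : Fin 3)
    (p : Pt K n 3) : Prop :=
  ∀ t : (Fin n ⊕ Fin 3) → K, t (Sum.inl i0) = 0 → t (Sum.inr jfix) = 0 →
    (∑ v : Fin n ⊕ Fin 3, t v * evalPt K p (pderiv v gZ)) = 0 →
    t (Sum.inr 2) = 0

/-- `p` is a singular point of the cone over `X = {g = 0}`. -/
def SingularConePoint {n m : ℕ} (g : Cox K n m) (p : Pt K n m) : Prop :=
  p ∈ XCone K g ∧ ∀ v : Fin n ⊕ Fin m, evalPt K p (pderiv v g) = 0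

end

end ConicBundleFormalization

namespace ConicBundleFormalization
noncomputable section
open MvPolynomial
open scoped Matrix

theorem det_lt_one_of_rel {E Γ₀ ι : Type*} [Field E] [LinearOrderedCommGroupWithZero Γ₀]
    (v : Valuation E Γ₀) [Fintype ι] [DecidableEq ι] (M : Matrix ι ι E) (c : ι → E)
    (hM : ∀ a i, v (M a i) ≤ 1) (j : ι) (hj : v (c j) = 1)
    (hrel : ∀ a, v (∑ i, c i * M a i) < 1) : v M.det < 1 := by
  set M' : Matrix ι ι v.integer := fun a i => ⟨M a i, hM a i⟩ with hM'
  have e1 : M = M'.map (algebraMap v.integer E) := by ext a i; rfl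
  have hadj : M.adjugate = M'.adjugate.map (algebraMap v.integer E) := by
    rw [e1]; exact ((algebraMap v.integer E).map_adjugate M').symm
  have h1 : (M.adjugate *ᵥ (M *ᵥ c)) j = M.det * c j := by
    rw [Matrix.mulVec_mulVec, Matrix.adjugate_mul]; simp [Matrix.smul_mulVec]
  have h2 : v (M.det * c j) < 1 := by
    rw [← h1]
    simp only [Matrix.mulVec, dotProduct]
    refine v.map_sum_lt one_ne_zero fun a _ => ?_
    rw [map_mul]
    have h3 : v (M.adjugate j a) ≤ 1 := by rw [hadj]; exact (M'.adjugate j a).2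
    have h4 := hrel a
    simp only [mul_comm (c _)] at h4
    exact lt_of_le_of_lt (mul_le_of_le_one_left' h3) h4
  rwa [map_mul, hj, mul_one] at h2

theorem val_terms {Γ₀ ι : Type*} [LinearOrderedCommGroupWithZero Γ₀] [Fintype ι] [DecidableEq ι]
    (a : ι → Γ₀) (h0 : ∀ i, a i ≠ 0) (l : ι) (h1 : ∀ i, i ≠ l → a i ≤ 1)
    (h2 : 1 ≤ ∏ i, a i) (h3 : a l ^ 2 ≤ ∏ i, a i) : ∀ i, a i = 1 := by
  rw [← Finset.mul_prod_erase Finset.univ a (Finset.mem_univ l)] at h2 h3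
  set P := ∏ i ∈ Finset.univ.erase l, a i
  have hP : P ≤ 1 := Finset.prod_le_one' fun i hi => h1 i (Finset.ne_of_mem_erase hi)
  have hal : a l ≤ P := by
    rw [sq] at h3
    exact le_of_mul_le_mul_left h3 (zero_lt_iff.2 (h0 l))
  have hP1 : P = 1 := le_antisymm hP (h2.trans (mul_le_of_le_one_left' (hal.trans hP)))
  have hl1 : a l = 1 := le_antisymm (hal.trans hP) (by rwa [hP1, mul_one] at h2)
  have hall : ∀ i ∈ Finset.univ.erase l, a i = 1 :=
    (Finset.prod_eq_one_iff_of_le_one' fun i hi => h1 i (Finset.ne_of_mem_erase hi)).1 hP1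
  intro i
  by_cases h : i = l
  · rw [h, hl1]
  · exact hall i (by simp [h])

theorem deriv_prod {E ι : Type*} [Field E] [DecidableEq ι] (D : Derivation ℤ E E) (s : Finset ι)
    (w : ι → E) : D (∏ i ∈ s, w i) = ∑ i ∈ s, (∏ j ∈ s.erase i, w j) * D (w i) := by
  induction s using Finset.induction_on with
  | empty => simp
  | insert a s ha ih =>
    rw [Finset.prod_insert ha, Derivation.leibniz, ih, Finset.sum_insert ha,
      Finset.erase_insert ha, smul_eq_mul, smul_eq_mul, Finset.mul_sum, add_comm]
    congr 1
    refine Finset.sum_congr rfl fun i hi => ?_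
    have hne : a ≠ i := fun h => ha (h ▸ hi)
    rw [Finset.erase_insert_of_ne hne, Finset.prod_insert (by simp [ha])]; ring

theorem key_lemma {E Γ₀ ι : Type*} [Field E] [CharP E 2] [LinearOrderedCommGroupWithZero Γ₀]
    (v : Valuation E Γ₀) [Fintype ι] [DecidableEq ι] (D : ι → Derivation ℤ E E)
    (hD : ∀ a t, v (D a t) ≤ v t) (l i1 : ι) (hl : i1 ≠ l) (w : ι → E) (hw : ∀ i, w i ≠ 0)
    (x y z : E) (hxyz : x ≠ 0 ∨ y ≠ 0 ∨ z ≠ 0)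
    (heq : (∑ i ∈ Finset.univ.erase l, w i + (1 + w l ^ 2) / ∏ i, w i) * x ^ 2 + y ^ 2 + x * y
      + z ^ 2 / w l = 0) (hne : ∃ i, v (w i) ≠ 1) :
    v (Matrix.det (Matrix.of fun a i => D a (w i) / w i)) < 1 := by
  have c2 : (2 : E) = 0 := CharTwo.two_eq_zero
  have hsq : ∀ a t, D a (t ^ 2) = 0 := by
    intro a t
    rw [sq, Derivation.leibniz]; exact CharTwo.add_self_eq_zero _
  have hw' : ∀ i, v (w i) ≠ 0 := fun i => by simpa using hw i
  set L : ι → ι → E := fun a i => D a (w i) / w i with hLdef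
  have hDw : ∀ a i, D a (w i) = w i * L a i := fun a i => by
    simp only [hLdef]; field_simp [hw i]
  have hL : ∀ a i, v (L a i) ≤ 1 := fun a i => by
    rw [map_div₀]; exact div_le_one_of_le₀ (hD a _) zero_le
  set Pw := ∏ i, w i with hPw
  have hPw0 : Pw ≠ 0 := Finset.prod_ne_zero_iff.2 fun i _ => hw i
  have hDP : ∀ a, D a Pw = Pw * ∑ i, L a i := by
    intro a
    rw [hPw, deriv_prod, Finset.mul_sum]
    refine Finset.sum_congr rfl fun i _ => ?_
    rw [hDw, ← Finset.mul_prod_erase Finset.univ w (Finset.mem_univ i)]; ring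
  have hDinv : ∀ a t s, t ≠ 0 → D a t = t * s → D a t⁻¹ = t⁻¹ * s := by
    intro a t s ht h
    have := (D a).leibniz t t⁻¹
    rw [mul_inv_cancel₀ ht, Derivation.map_one_eq_zero, smul_eq_mul, smul_eq_mul, h] at this
    have h5 : t * (D a t⁻¹ + t⁻¹ * s) = 0 := by rw [this]; ring
    have h6 := (mul_eq_zero.1 h5).resolve_left ht
    exact CharTwo.add_eq_zero.1 h6
  set T : ι → E := fun i => w i * x ^ 2 with hT
  set TN := x ^ 2 / Pw with hTN
  set TN' := w l ^ 2 * x ^ 2 / Pw with hTN'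
  set Zt := z ^ 2 / w l with hZt
  set S := TN + TN' with hS
  have heq' : ∑ i ∈ Finset.univ.erase l, T i + S + y ^ 2 + x * y + Zt = 0 := by
    rw [← heq, hS, hTN, hTN']; simp only [hT, ← Finset.sum_mul]; ring
  have hDT : ∀ a i, D a (T i) = T i * L a i := by
    intro a i
    simp only [hT, Derivation.leibniz, hsq, hDw, smul_eq_mul]; ring
  have hDS : ∀ a, D a S = S * ∑ i, L a i := by
    intro a
    have : S = (x * (1 + w l)) ^ 2 * Pw⁻¹ := by
      rw [hS, hTN, hTN', div_eq_mul_inv, div_eq_mul_inv]; linear_combination -x^2 * w l * Pw⁻¹ * c2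
    rw [this, Derivation.leibniz, hsq, hDinv a _ _ hPw0 (hDP a), smul_eq_mul, smul_zero]; ring
  have hDZ : ∀ a, D a Zt = Zt * L a l := by
    intro a
    rw [hZt, div_eq_mul_inv, Derivation.leibniz, hsq, hDinv a _ _ (hw l) (hDw a l), smul_eq_mul,
      smul_zero]; ring
  set c : ι → E := fun i => if i = l then S + Zt else T i + S with hc
  have hrel : ∀ a, ∑ i, c i * L a i = D a (x * y) := by
    intro a
    have h := congrArg (D a) heq'
    rw [map_add, map_add, map_add, map_add, map_sum, hDS, hDZ, hsq, map_zero] at h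
    simp only [hDT] at h
    have h1 : ∑ i, c i * L a i = ∑ i ∈ Finset.univ.erase l, T i * L a i + S * ∑ i, L a i
        + Zt * L a l := by
      rw [← Finset.add_sum_erase Finset.univ _ (Finset.mem_univ l),
        ← Finset.add_sum_erase Finset.univ (L a) (Finset.mem_univ l)]
      have : ∑ i ∈ Finset.univ.erase l, c i * L a i = ∑ i ∈ Finset.univ.erase l, T i * L a i
        + S * ∑ i ∈ Finset.univ.erase l, L a i := by
        rw [Finset.mul_sum, ← Finset.sum_add_distrib]
        refine Finset.sum_congr rfl fun i hi => ?_
        simp only [hc, if_neg (Finset.ne_of_mem_erase hi)]; ring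
      rw [this]; simp only [hc, if_true]; ring
    rw [h1]
    refine CharTwo.add_eq_zero.1 ?_
    rw [← h]; ring
  -- the maximal term
  let tm : ι ⊕ Fin 3 → E := Sum.elim (fun i => if i = l then TN' else T i) ![TN, y ^ 2, Zt]
  have : Nonempty (ι ⊕ Fin 3) := ⟨Sum.inr 0⟩
  obtain ⟨k, hk⟩ := Finite.exists_max (fun j => v (tm j))
  set θ := tm k with hθ
  have bTN' : v TN' ≤ v θ := by simpa [tm] using hk (Sum.inl l)
  have bT : ∀ i, i ≠ l → v (T i) ≤ v θ := fun i hi => by simpa [tm, hi] using hk (Sum.inl i)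
  have bTN : v TN ≤ v θ := by simpa [tm] using hk (Sum.inr 0)
  have bY : v (y ^ 2) ≤ v θ := by simpa [tm] using hk (Sum.inr 1)
  have bZ : v Zt ≤ v θ := by simpa [tm] using hk (Sum.inr 2)
  have hθ0 : θ ≠ 0 := by
    intro h
    rw [h, map_zero] at bY bZ bTN
    have q1 : y = 0 := by simpa using bY
    have q2 : z = 0 := by simpa [hZt, hw l] using bZ
    have q3 : x = 0 := by simpa [hTN, hPw0] using bTN
    tauto
  have hvθ : v θ ≠ 0 := by simpa using hθ0
  have bS : v S ≤ v θ := v.map_add_le bTN bTN'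
  have bxy : v (x * y) < v θ := by
    by_cases hx : x = 0
    · simpa [hx] using zero_lt_iff.2 hvθ
    by_cases hy : y = 0
    · simpa [hy] using zero_lt_iff.2 hvθ
    have hx2 : v (x ^ 2) < v θ := by
      by_contra hcon
      rw [not_lt] at hcon
      have hvx : 0 < v (x ^ 2) := zero_lt_iff.2 (by simpa using hx)
      obtain ⟨i, hi⟩ := hne
      refine hi (val_terms (fun i => v (w i)) hw' l ?_ ?_ ?_ i)
      · intro i hi
        have := (bT i hi).trans hcon
        simp only [hT, map_mul] at this
        exact (mul_le_iff_le_one_left hvx).1 this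
      · have := bTN.trans hcon
        rw [hTN, map_div₀, div_le_iff₀ (zero_lt_iff.2 (by simpa using hPw0))] at this
        have := (le_mul_iff_one_le_right hvx).1 this
        rwa [hPw, map_prod] at this
      · have := bTN'.trans hcon
        rw [hTN', map_div₀, div_le_iff₀ (zero_lt_iff.2 (by simpa using hPw0)), map_mul, mul_comm]
          at this
        have := le_of_mul_le_mul_left this hvx
        rwa [hPw, map_prod, map_pow] at this
    have h7 : v (x * y) ^ 2 < v θ ^ 2 := by
      rw [← map_pow, mul_pow, map_mul, sq (v θ)]
      have hvy : 0 < v (y ^ 2) := zero_lt_iff.2 (by simpa using hy)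
      calc v (x ^ 2) * v (y ^ 2) < v θ * v (y ^ 2) := by gcongr
        _ ≤ v θ * v θ := by gcongr
    exact lt_of_pow_lt_pow_left₀ 2 zero_le h7
  have bc : ∀ i, v (c i) ≤ v θ := by
    intro i
    by_cases hi : i = l
    · simp only [hc, if_pos hi]; exact v.map_add_le bS bZ
    · simp only [hc, if_neg hi]; exact v.map_add_le (bT i hi) bS
  by_cases hA : ∃ j, v (c j) = v θ
  · obtain ⟨j, hj⟩ := hA
    refine det_lt_one_of_rel v _ (fun i => c i / θ) hL j ?_ ?_
    · simp only [map_div₀, hj]; exact div_self hvθ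
    · intro a
      have : ∑ i, c i / θ * (Matrix.of L) a i = D a (x * y) / θ := by
        rw [← hrel, Finset.sum_div]; refine Finset.sum_congr rfl fun i _ => ?_
        simp only [Matrix.of_apply]; ring
      rw [this, map_div₀, div_lt_one₀ (zero_lt_iff.2 hvθ)]
      exact (hD a _).trans_lt bxy
  · push Not at hA
    have bc' : ∀ j, v (c j) < v θ := fun j => lt_of_le_of_ne (bc j) (hA j)
    have b1 : ∀ i, i ≠ l → v (T i + S) < v θ := fun i hi => by simpa [hc, hi] using bc' i
    have b2 : v (S + Zt) < v θ := by simpa [hc] using bc' l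
    rcases bS.eq_or_lt with hSe | hSl
    · have b3 : v (T i1 + Zt) < v θ := by
        have : T i1 + Zt = (T i1 + S) + (S + Zt) := by linear_combination -S * c2
        rw [this]; exact v.map_add_lt (b1 _ hl) b2
      have hZe : v Zt = v θ := by
        have h : Zt = (S + Zt) + S := by linear_combination -S * c2
        rw [h, Valuation.map_add_eq_of_lt_right v (by rw [hSe]; exact b2), hSe]
      have hZ0 : Zt ≠ 0 := fun h => by rw [h, map_zero] at hZe; exact hvθ hZe.symm
      set q := T i1 / Zt with hq
      have hq1 : v (q + 1) < 1 := by
        have : q + 1 = (T i1 + Zt) / Zt := by rw [hq]; field_simp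
        rw [this, map_div₀, hZe, div_lt_one₀ (zero_lt_iff.2 hvθ)]; exact b3
      have hvq : v q = 1 := by
        have h : q = (q + 1) + 1 := by linear_combination -c2
        rw [h, Valuation.map_add_eq_of_lt_right v (by rw [map_one]; exact hq1), map_one]
      have hDq : ∀ a, D a q = q * (L a i1 + L a l) := by
        intro a
        rw [hq, div_eq_mul_inv, Derivation.leibniz, hDT, hDinv a _ _ hZ0 (hDZ a), smul_eq_mul,
          smul_eq_mul]; ring
      refine det_lt_one_of_rel v _ (fun i => if i = i1 ∨ i = l then 1 else 0) hL l (by simp) ?_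
      intro a
      have h8 : ∑ i, (if i = i1 ∨ i = l then (1 : E) else 0) * (Matrix.of L) a i
          = L a i1 + L a l := by
        simp only [ite_mul, one_mul, zero_mul, Matrix.of_apply]
        rw [← Finset.sum_filter]
        have : Finset.univ.filter (fun i => i = i1 ∨ i = l) = {i1, l} := by ext; simp
        rw [this, Finset.sum_pair hl]
      have h9 : v (D a q) < 1 := by
        have : D a q = D a (q + 1) := by simp
        rw [this]; exact (hD a _).trans_lt hq1
      rw [h8]
      rwa [hDq, map_mul, hvq, one_mul] at h9
    · have bTl : ∀ i, i ≠ l → v (T i) < v θ := fun i hi => by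
        have : T i = (T i + S) + S := by linear_combination -S * c2
        rw [this]; exact v.map_add_lt (b1 i hi) hSl
      have bZl : v Zt < v θ := by
        have h : Zt = (S + Zt) + S := by linear_combination -S * c2
        rw [h]; exact v.map_add_lt b2 hSl
      have bYl : v (y ^ 2) < v θ := by
        have : y ^ 2 = ∑ i ∈ Finset.univ.erase l, T i + S + x * y + Zt := by
          refine CharTwo.add_eq_zero.1 ?_
          rw [← heq']; ring
        rw [this]
        refine v.map_add_lt (v.map_add_lt (v.map_add_lt (v.map_sum_lt hvθ fun i hi => ?_) hSl) bxy) bZl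
        exact bTl i (Finset.ne_of_mem_erase hi)
      have hTNe : v TN = v θ := by
        by_contra hne'
        have hlt : v TN < v θ := lt_of_le_of_ne bTN hne'
        have hlt' : v TN' < v θ := by
          have h : TN' = S + TN := by rw [hS]; linear_combination -TN * c2
          rw [h]; exact v.map_add_lt hSl hlt
        have : v (tm k) < v θ := by
          rcases k with i | j
          · by_cases hi : i = l
            · simpa [tm, hi] using hlt'
            · simpa [tm, hi] using bTl i hi
          · fin_cases j
            · simpa [tm] using hlt
            · simpa [tm] using bYl
            · simpa [tm] using bZl
        exact lt_irrefl _ this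
      have hw1 : v (w l + 1) < 1 := by
        have h : S = TN * (w l + 1) ^ 2 := by
          rw [hS, hTN, hTN']; linear_combination -(x ^ 2 / Pw * w l) * c2
        rw [h, map_mul, hTNe, map_pow] at hSl
        have := (mul_lt_iff_lt_one_right (zero_lt_iff.2 hvθ)).1 hSl
        exact (pow_lt_one_iff_of_nonneg zero_le two_ne_zero).1 this
      have hvl : v (w l) = 1 := by
        have h : w l = (w l + 1) + 1 := by linear_combination -c2
        rw [h, Valuation.map_add_eq_of_lt_right v (by rw [map_one]; exact hw1), map_one]
      refine det_lt_one_of_rel v _ (Pi.single l 1) hL l (by simp) ?_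
      intro a
      have h8 : ∑ i, (Pi.single l (1:E) : ι → E) i * (Matrix.of L) a i = L a l := by
        simp [Pi.single_apply]
      have h9 : v (D a (w l)) < 1 := by
        have : D a (w l) = D a (w l + 1) := by simp
        rw [this]; exact (hD a _).trans_lt hw1
      rw [h8]
      rwa [hDw, map_mul, hvl, one_mul] at h9

end
end ConicBundleFormalization

namespace ConicBundleFormalization
noncomputable section
open MvPolynomial
open scoped Matrix

theorem ext_deriv {A B : Type*} [CommRing A] [CommRing B] [Algebra A B] [Algebra.FormallyEtale A B]
    (d : Derivation ℤ A A) :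
    ∃ d' : Derivation ℤ B B, ∀ a, d' (algebraMap A B a) = algebraMap A B (d a) := by
  let d1 : Derivation ℤ A B := (Algebra.linearMap A B).compDer d
  let f : TensorProduct A B (Ω[A⁄ℤ]) →ₗ[B] B := d1.liftKaehlerDifferential.liftBaseChange B
  let e := KaehlerDifferential.tensorKaehlerEquivOfFormallyEtale ℤ A B
  refine ⟨(f.comp e.symm.toLinearMap).compDer (KaehlerDifferential.D ℤ B), fun a => ?_⟩
  have h : e.symm (KaehlerDifferential.D ℤ B (algebraMap A B a)) = _ :=
    KaehlerDifferential.tensorKaehlerEquivOfFormallyEtale_symm_D_algebraMap ℤ A B a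
  change f (e.symm (KaehlerDifferential.D ℤ B (algebraMap A B a))) = _
  rw [h]
  simp [f, d1]

/-- determinant of logarithmic derivatives -/
def lgdet {E ι : Type*} [Field E] [Fintype ι] [DecidableEq ι] (D : ι → Derivation ℤ E E)
    (w : ι → E) : E := Matrix.det (Matrix.of fun a i => D a (w i) / w i)

def wv {E : Type*} [Field E] {N : ℕ} (u : Fin (N + 1) → E) : Fin N → E := fun i => u i.succ / u 0

open Classical in
def rho {E : Type*} [Field E] {N : ℕ} (D : Fin N → Derivation ℤ E E) (u : Fin (N + 1) → E) : E :=
  if ∀ i, u i ≠ 0 then lgdet D (wv u) else 0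

theorem rho_smul {E : Type*} [Field E] {N : ℕ} (D : Fin N → Derivation ℤ E E)
    (u : Fin (N + 1) → E) (c : E) (hc : c ≠ 0) : rho D (fun i => c * u i) = rho D u := by
  have h : wv (fun i => c * u i) = wv u := by
    funext i; simp only [wv]; exact mul_div_mul_left _ _ hc
  have h2 : (∀ i, c * u i ≠ 0) ↔ ∀ i, u i ≠ 0 := by simp [hc]
  rw [rho, rho, h]
  by_cases h3 : ∀ i, u i ≠ 0
  · rw [if_pos h3, if_pos (h2.2 h3)]
  · rw [if_neg h3, if_neg (fun h4 => h3 (h2.1 h4))]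

/-- special expression -/
def Gexp {A : Type*} [CommRing A] (N d : ℕ) (l : Fin N) (u : Fin (N + 1) → A) (x : Fin 3 → A) : A :=
  u 0 ^ d * x 0 ^ 2 + u 0 ^ (d - 2) * u l.succ ^ 2 * x 0 ^ 2
  + ∑ i ∈ Finset.univ.erase l, u 0 ^ (d - (N + 1)) * u (Fin.succ i)
      * (∏ j : Fin N, u j.succ) * x 0 ^ 2
  + u 0 ^ (d - N) * (∏ j : Fin N, u j.succ) * (x 1 ^ 2 + x 0 * x 1)
  + u 0 ^ (d - N + 1) * (∏ j ∈ Finset.univ.erase l, u (Fin.succ j)) * x 2 ^ 2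

theorem Gexp_map {A B : Type*} [CommRing A] [CommRing B] (f : A →+* B) (N d : ℕ) (l : Fin N)
    (u : Fin (N + 1) → A) (x : Fin 3 → A) :
    f (Gexp N d l u x) = Gexp N d l (fun i => f (u i)) (fun j => f (x j)) := by
  simp only [Gexp, map_add, map_mul, map_pow, map_sum, map_prod]

/-- special polynomial -/
def Gpoly (R : Type*) [CommRing R] (N d : ℕ) (l : Fin N) : MvPolynomial (Fin (N + 1) ⊕ Fin 3) R :=
  Gexp N d l (fun i => X (.inl i)) (fun j => X (.inr j))

theorem Gpoly_map {R S : Type*} [CommRing R] [CommRing S] (f : R →+* S) (N d : ℕ) (l : Fin N) :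
    MvPolynomial.map f (Gpoly R N d l) = Gpoly S N d l := by
  simp only [Gpoly, Gexp_map, map_X]

theorem Eq_of_Gpoly {F E : Type*} [Field F] [Field E] [Algebra F E] (N d : ℕ)
    (hd : N + 1 ≤ d) (hN : 2 ≤ N) (l : Fin N) (u : Fin (N + 1) → E) (x : Fin 3 → E)
    (hu : ∀ i, u i ≠ 0) (h : aeval (Sum.elim u x) (Gpoly F N d l) = 0) :
    (∑ i ∈ Finset.univ.erase l, wv u i + (1 + wv u l ^ 2) / ∏ i, wv u i) * x 0 ^ 2 + x 1 ^ 2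
      + x 0 * x 1 + x 2 ^ 2 / wv u l = 0 := by
  have hP : ∏ i, wv u i = (∏ j : Fin N, u j.succ) / u 0 ^ N := by
    simp only [wv, Finset.prod_div_distrib]; simp
  have hPe : ∏ j : Fin N, u j.succ = u l.succ * ∏ j ∈ Finset.univ.erase l, u j.succ :=
    (Finset.mul_prod_erase Finset.univ (fun j : Fin N => u j.succ) (Finset.mem_univ l)).symm
  have hQ0 : ∏ j ∈ Finset.univ.erase l, u j.succ ≠ 0 := Finset.prod_ne_zero_iff.2 fun i _ => hu _
  have hS : ∑ i ∈ Finset.univ.erase l, wv u i = (∑ i ∈ Finset.univ.erase l, u i.succ) / u 0 := by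
    simp only [wv, Finset.sum_div]
  rw [← AlgHom.coe_toRingHom, Gpoly, Gexp_map] at h
  simp only [AlgHom.coe_toRingHom, aeval_X, Sum.elim_inl, Sum.elim_inr, Gexp,
    ← Finset.sum_mul, ← Finset.mul_sum] at h
  rw [hP, hS]
  rw [hPe] at h ⊢
  simp only [wv]
  set Q := ∏ j ∈ Finset.univ.erase l, u j.succ
  set S := ∑ i ∈ Finset.univ.erase l, u i.succ
  have h0 := hu 0
  have hl := hu l.succ
  obtain ⟨k, rfl⟩ := Nat.exists_eq_add_of_le hd
  obtain ⟨m, rfl⟩ := Nat.exists_eq_add_of_le hN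
  have e1 : 2 + m + 1 + k - 2 = m + 1 + k := by omega
  have e2 : 2 + m + 1 + k - (2 + m + 1) = k := by omega
  have e3 : 2 + m + 1 + k - (2 + m) = k + 1 := by omega
  rw [e1, e2, e3] at h
  have key : (S / u 0 + (1 + (u l.succ / u 0) ^ 2) / (u l.succ * Q / u 0 ^ (2 + m))) * x 0 ^ 2
      + x 1 ^ 2 + x 0 * x 1 + x 2 ^ 2 / (u l.succ / u 0) =
      (u 0 ^ (2 + m + 1 + k) * x 0 ^ 2 + u 0 ^ (m + 1 + k) * u l.succ ^ 2 * x 0 ^ 2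
       + u 0 ^ k * S * (u l.succ * Q) * x 0 ^ 2 + u 0 ^ (k + 1) * (u l.succ * Q) * (x 1 ^ 2 + x 0 * x 1)
       + u 0 ^ (k + 1 + 1) * Q * x 2 ^ 2) / (u 0 ^ (k + 1) * (u l.succ * Q)) := by
    field_simp
    ring
  rw [key, h, zero_div]

theorem det_le_one {E Γ₀ ι : Type*} [Field E] [LinearOrderedCommGroupWithZero Γ₀]
    (v : Valuation E Γ₀) [Fintype ι] [DecidableEq ι] (M : Matrix ι ι E)
    (hM : ∀ a i, v (M a i) ≤ 1) : v M.det ≤ 1 := by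
  let M' : Matrix ι ι v.integer := fun a i => ⟨M a i, hM a i⟩
  have e1 : M = M'.map (algebraMap v.integer E) := by ext a i; rfl
  have : M.det = algebraMap v.integer E M'.det := by
    rw [e1]; exact ((algebraMap v.integer E).map_det M').symm
  rw [this]; exact M'.det.2

def ltOneIdeal {E Γ₀ : Type*} [Field E] [LinearOrderedCommGroupWithZero Γ₀]
    (v : Valuation E Γ₀) : Ideal v.integer where
  carrier := {t | v t < 1}
  add_mem' := fun ha hb => v.map_add_lt ha hb
  zero_mem' := by simp
  smul_mem' := fun c t ht => by
    change v (c * t) < 1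
    rw [map_mul]; exact lt_of_le_of_lt (mul_le_of_le_one_left' c.2) ht

theorem det_congr {E Γ₀ ι : Type*} [Field E] [LinearOrderedCommGroupWithZero Γ₀]
    (v : Valuation E Γ₀) [Fintype ι] [DecidableEq ι] (M M2 : Matrix ι ι E)
    (hM : ∀ a i, v (M a i) ≤ 1) (hM2 : ∀ a i, v (M2 a i) ≤ 1)
    (h : ∀ a i, v (M a i - M2 a i) < 1) : v (M.det - M2.det) < 1 := by
  let M' : Matrix ι ι v.integer := fun a i => ⟨M a i, hM a i⟩
  have e1 : M = M'.map (algebraMap v.integer E) := by ext a i; rfl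
  have d1 : M.det = algebraMap v.integer E M'.det := by
    rw [e1]; exact ((algebraMap v.integer E).map_det M').symm
  let M2' : Matrix ι ι v.integer := fun a i => ⟨M2 a i, hM2 a i⟩
  have e2 : M2 = M2'.map (algebraMap v.integer E) := by ext a i; rfl
  have d2 : M2.det = algebraMap v.integer E M2'.det := by
    rw [e2]; exact ((algebraMap v.integer E).map_det M2').symm
  have h3 : (Ideal.Quotient.mk (ltOneIdeal v)) M'.det = (Ideal.Quotient.mk (ltOneIdeal v)) M2'.det := by
    rw [RingHom.map_det, RingHom.map_det]
    congr 1
    ext a i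
    exact Ideal.Quotient.eq.2 (h a i)
  have h4 : v ((M'.det - M2'.det : v.integer) : E) < 1 := Ideal.Quotient.eq.1 h3
  rw [d1, d2]; exact h4

theorem val_eq_one_of_sub {E Γ₀ : Type*} [Field E] [LinearOrderedCommGroupWithZero Γ₀]
    (v : Valuation E Γ₀) (s t : E) (ht : v t = 1) (h : v (s - t) < 1) : v s = 1 := by
  have : s = (s - t) + t := by ring
  rw [this, Valuation.map_add_eq_of_lt_right v (by rw [ht]; exact h), ht]

theorem place_lemma {F E Γ₀ : Type*} [Field F] [Field E] [Algebra F E] [CharP E 2]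
    [LinearOrderedCommGroupWithZero Γ₀] (v : Valuation E Γ₀)
    (hv : ∀ c : F, c ≠ 0 → v (algebraMap F E c) = 1) (N d : ℕ) (hd : N + 1 ≤ d) (hN : 2 ≤ N)
    (l i1 : Fin N) (hl : i1 ≠ l)
    (D : Fin N → Derivation ℤ F F) (D' : Fin N → Derivation ℤ E E)
    (hDD : ∀ a t, D' a (algebraMap F E t) = algebraMap F E (D a t))
    (hlog : ∀ a t, v (D' a t) ≤ v t)
    (u : Fin (N + 1) → E) (x : Fin 3 → E) (hx : x ≠ 0)
    (hu : ∀ i, u i ≠ 0) (h : aeval (Sum.elim u x) (Gpoly F N d l) = 0)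
    (q : Fin (N + 1) → F) (hq : q ≠ 0) (μ : E) (hμ : μ ≠ 0)
    (hqu : ∀ i, v (u i / μ - algebraMap F E (q i)) < 1) (c : F)
    (hc : lgdet D' (wv u) = algebraMap F E c) : c = rho D q := by
  have hF1 : ∀ c : F, v (algebraMap F E c) < 1 → c = 0 := by
    intro c hc
    by_contra h0
    rw [hv c h0] at hc; exact lt_irrefl _ hc
  have hF2 : ∀ c : F, v (algebraMap F E c) ≤ 1 := by
    intro c
    by_cases h0 : c = 0
    · simp [h0]
    · exact (hv c h0).le
  have hwv : wv (fun i => u i / μ) = wv u := by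
    funext i; simp only [wv]; exact div_div_div_cancel_right₀ hμ _ _
  have hw0 : ∀ i, wv u i ≠ 0 := fun i => div_ne_zero (hu _) (hu _)
  rw [rho]
  split_ifs with hall
  · have h1 : ∀ i, v (u i / μ) = 1 := fun i => val_eq_one_of_sub v _ _ (hv _ (hall i)) (hqu i)
    refine sub_eq_zero.1 (hF1 _ ?_)
    have hmap : algebraMap F E (lgdet D (wv q)) = lgdet D' (fun i => algebraMap F E (wv q i)) := by
      rw [lgdet, RingHom.map_det, lgdet]
      congr 1; ext a i; simp [hDD]
    rw [map_sub, ← hc, hmap, lgdet, lgdet]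
    have hwu1 : ∀ i, v (wv u i) = 1 := by
      intro i; rw [← hwv]; simp only [wv, map_div₀ v (u _ / μ), h1]; simp
    have hwq0 : ∀ i, wv q i ≠ 0 := fun i => div_ne_zero (hall _) (hall _)
    have hwq1 : ∀ i, v (algebraMap F E (wv q i)) = 1 := fun i => hv _ (hwq0 i)
    have hdiff : ∀ i, v (wv u i - algebraMap F E (wv q i)) < 1 := by
      intro i
      rw [← hwv]
      set s := u i.succ / μ
      set t := u 0 / μ
      set s' := algebraMap F E (q i.succ) with hs'
      set t' := algebraMap F E (q 0) with ht'
      have ht0 : t ≠ 0 := div_ne_zero (hu _) hμ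
      have ht0' : t' ≠ 0 := by rw [ht']; simpa using hall 0
      have e : s / t - s' / t' = ((s - s') * t' - s' * (t - t')) / (t * t') := by
        field_simp; ring
      simp only [wv, map_div₀]
      change v (s / t - s' / t') < 1
      rw [e, map_div₀, map_mul, h1 0, hv _ (hall 0), one_mul, div_one]
      refine v.map_sub_lt ?_ ?_
      · rw [map_mul, hv _ (hall 0), mul_one]; exact hqu _
      · rw [map_mul, hv _ (hall _), one_mul]; exact hqu _
    refine det_congr v _ _ ?_ ?_ ?_
    · intro a i
      simp only [Matrix.of_apply, map_div₀, hwu1, div_one]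
      exact (hlog _ _).trans (hwu1 i).le
    · intro a i
      simp only [Matrix.of_apply]
      rw [map_div₀, hwq1, div_one]
      exact (hlog _ _).trans (hwq1 i).le
    · intro a i
      simp only [Matrix.of_apply]
      set s := wv u i with hs
      set t := algebraMap F E (wv q i) with ht
      have hs0 : s ≠ 0 := hw0 i
      have ht0 : t ≠ 0 := by rw [ht]; simpa using hwq0 i
      have e : D' a s / s - D' a t / t = (D' a (s - t) * t - D' a t * (s - t)) / (s * t) := by
        rw [map_sub]; field_simp; ring
      rw [e, map_div₀, map_mul v s t, hwu1, hwq1, one_mul, div_one]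
      refine v.map_sub_lt ?_ ?_
      · rw [map_mul, hwq1, mul_one]; exact (hlog _ _).trans_lt (hdiff i)
      · rw [map_mul]
        exact lt_of_le_of_lt (mul_le_of_le_one_left' ((hlog _ _).trans (hwq1 i).le)) (hdiff i)
  · refine hF1 _ ?_
    rw [← hc]
    have hx' : x 0 ≠ 0 ∨ x 1 ≠ 0 ∨ x 2 ≠ 0 := by
      by_contra hcon
      push Not at hcon
      refine hx ?_
      funext i; fin_cases i
      · exact hcon.1
      · exact hcon.2.1
      · exact hcon.2.2
    refine key_lemma v D' hlog l i1 hl (wv u) hw0 _ _ _ hx' (Eq_of_Gpoly N d hd hN l u x hu h) ?_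
    by_contra hcon
    push Not at hcon hall
    obtain ⟨i, hi⟩ := hall
    obtain ⟨j, hj⟩ := Function.ne_iff.1 hq
    have h0 : ∀ k, v (u k) = v (u 0) := by
      intro k
      refine Fin.cases rfl (fun k => ?_) k
      have := hcon k
      rw [wv, map_div₀, div_eq_one_iff_eq (by simpa using hu 0)] at this
      exact this
    have h1 : v (u j / μ) = 1 := val_eq_one_of_sub v _ _ (hv _ hj) (hqu j)
    have h2 : v (u i / μ) < 1 := by simpa [hi] using hqu i
    rw [map_div₀, h0] at h1 h2
    exact h2.ne h1

end
end ConicBundleFormalization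

namespace ConicBundleFormalization
noncomputable section
open scoped Matrix

theorem deriv_div_div {E : Type*} [Field E] (D : Derivation ℤ E E) (s t : E) (hs : s ≠ 0)
    (ht : t ≠ 0) : D (s / t) / (s / t) = D s / s - D t / t := by
  have h : D s = D (s / t * t) := by rw [div_mul_cancel₀ _ ht]
  rw [Derivation.leibniz, smul_eq_mul, smul_eq_mul] at h
  rw [h]; field_simp; ring

/-- log on a subring implies log on the fraction field -/
theorem log_of_frac {A E Γ₀ : Type*} [CommRing A] [IsDomain A] [Field E] [Algebra A E]
    [IsFractionRing A E]
    [LinearOrderedCommGroupWithZero Γ₀] (v : Valuation E Γ₀) (D : Derivation ℤ E E)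
    (h : ∀ a : A, v (D (algebraMap A E a)) ≤ v (algebraMap A E a)) (t : E) : v (D t) ≤ v t := by
  by_cases ht : t = 0
  · simp [ht]
  obtain ⟨a, b, hb, rfl⟩ := IsFractionRing.div_surjective (A := A) t
  have hb0 : algebraMap A E b ≠ 0 := by
    intro h0; rw [h0, div_zero] at ht; exact ht rfl
  have ha0 : algebraMap A E a ≠ 0 := by
    intro h0; rw [h0, zero_div] at ht; exact ht rfl
  have h1 := deriv_div_div D _ _ ha0 hb0
  have h2 : v (D (algebraMap A E a / algebraMap A E b) / (algebraMap A E a / algebraMap A E b)) ≤ 1 := by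
    rw [h1]
    refine v.map_sub_le ?_ ?_
    · rw [map_div₀]; exact div_le_one_of_le₀ (h _) zero_le
    · rw [map_div₀]; exact div_le_one_of_le₀ (h _) zero_le
  rw [map_div₀ v (D _), div_le_one₀ (zero_lt_iff.2 (by simpa using ht))] at h2
  exact h2

theorem log_of_unif {A E Γ₀ : Type*} [CommRing A] [IsDomain A] [Field E] [Algebra A E]
    [IsFractionRing A E]
    [LinearOrderedCommGroupWithZero Γ₀] (v : Valuation E Γ₀) (ϖ : A)
    (h1 : ∀ n : ℕ, v (n : E) ≤ 1)
    (h2 : ∀ a : A, a ≠ 0 → ∃ (k : ℕ) (s : A), a = ϖ ^ k * s ∧ v (algebraMap A E s) = 1)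
    (D : Derivation ℤ E E) (h4 : ∀ a : A, v (D (algebraMap A E a)) ≤ 1)
    (hϖ : v (D (algebraMap A E ϖ)) ≤ v (algebraMap A E ϖ)) (t : E) : v (D t) ≤ v t := by
  refine log_of_frac (A := A) v D (fun a => ?_) t
  by_cases ha : a = 0
  · simp [ha]
  obtain ⟨k, s, rfl, hs⟩ := h2 a ha
  rw [map_mul, map_pow, Derivation.leibniz, Derivation.leibniz_pow, map_mul v (_ ^ k), hs, mul_one]
  refine v.map_add_le ?_ ?_
  · rw [smul_eq_mul, map_mul]
    exact mul_le_of_le_one_right' (h4 s)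
  · rw [smul_eq_mul, map_mul, hs, one_mul, smul_eq_mul, nsmul_eq_mul, map_mul, map_mul]
    rcases k with _ | k
    · simp
    · rw [Nat.add_sub_cancel, map_pow, map_pow, pow_succ]
      calc _ ≤ 1 * (v (algebraMap A E ϖ) ^ k * v (D (algebraMap A E ϖ))) := by
              gcongr; exact h1 _
        _ ≤ _ := by rw [one_mul]; gcongr

theorem regular_lemma {A E Γ₀ : Type*} [CommRing A] [IsDomain A] [Field E] [Algebra A E]
    [IsFractionRing A E] [CharP E 2]
    [LinearOrderedCommGroupWithZero Γ₀] (v : Valuation E Γ₀) (ϖ : A)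
    (h1 : ∀ a : A, v (algebraMap A E a) ≤ 1)
    (h2 : ∀ a : A, a ≠ 0 → ∃ (k : ℕ) (s : A), a = ϖ ^ k * s ∧ v (algebraMap A E s) = 1)
    (h3 : v (algebraMap A E ϖ) < 1) (h30 : ϖ ≠ 0)
    {ι : Type*} [Fintype ι] [DecidableEq ι]
    (D : ι → Derivation ℤ E E) (h4 : ∀ i, ∀ a : A, ∃ b : A, D i (algebraMap A E a) = algebraMap A E b)
    (l i1 : ι) (hl : i1 ≠ l) (w : ι → E) (hw : ∀ i, w i ≠ 0)
    (x y z : E) (hxyz : x ≠ 0 ∨ y ≠ 0 ∨ z ≠ 0)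
    (heq : (∑ i ∈ Finset.univ.erase l, w i + (1 + w l ^ 2) / ∏ i, w i) * x ^ 2 + y ^ 2 + x * y
      + z ^ 2 / w l = 0) : v (lgdet D w) ≤ 1 := by
  have hn : ∀ n : ℕ, v (n : E) ≤ 1 := fun n => by simpa using h1 (n : A)
  have h4' : ∀ i, ∀ a : A, v (D i (algebraMap A E a)) ≤ 1 := fun i a => by
    obtain ⟨b, hb⟩ := h4 i a; rw [hb]; exact h1 b
  set p : E := algebraMap A E ϖ with hp
  have hp0 : p ≠ 0 := by
    rw [hp]; simpa using h30
  have hvp0 : v p ≠ 0 := by simpa using hp0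
  have frac : ∀ t : E, t ≠ 0 → ∃ (k m : ℕ) (s s' : A), v (algebraMap A E s) = 1 ∧
      v (algebraMap A E s') = 1 ∧ t = p ^ k * algebraMap A E s / (p ^ m * algebraMap A E s') := by
    intro t ht
    obtain ⟨a, b, hb, rfl⟩ := IsFractionRing.div_surjective (A := A) t
    have hb0 : b ≠ 0 := by
      rintro rfl; simp at ht
    have ha0 : a ≠ 0 := by
      rintro rfl; simp at ht
    obtain ⟨k, s, rfl, hs⟩ := h2 a ha0
    obtain ⟨m, s', rfl, hs'⟩ := h2 b hb0
    exact ⟨k, m, s, s', hs, hs', by simp [hp]⟩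
  have hpk : ∀ k m : ℕ, v p ^ k = v p ^ m → k = m := by
    intro k m h
    rcases lt_trichotomy k m with hkm | hkm | hkm
    · exact absurd h (pow_lt_pow_right_of_lt_one₀ (zero_lt_iff.2 hvp0) h3 hkm).ne'
    · exact hkm
    · exact absurd h (pow_lt_pow_right_of_lt_one₀ (zero_lt_iff.2 hvp0) h3 hkm).ne
  by_cases hall : ∀ i, v (w i) = 1
  · refine det_le_one v _ fun a i => ?_
    simp only [Matrix.of_apply]
    obtain ⟨k, m, s, s', hs, hs', hwi⟩ := frac (w i) (hw i)
    have hs0 : algebraMap A E s ≠ 0 := fun h => by simp [h] at hs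
    have hs0' : algebraMap A E s' ≠ 0 := fun h => by simp [h] at hs'
    have hkm : k = m := by
      have := hall i
      rw [hwi, map_div₀, map_mul, map_mul, hs, hs', mul_one, mul_one, map_pow, map_pow,
        div_eq_one_iff_eq (pow_ne_zero _ hvp0)] at this
      exact hpk _ _ this
    rw [hkm, mul_div_mul_left _ _ (pow_ne_zero _ hp0)] at hwi
    rw [hwi, deriv_div_div _ _ _ hs0 hs0']
    refine v.map_sub_le ?_ ?_
    · rw [map_div₀, hs, div_one]; exact h4' _ _
    · rw [map_div₀, hs', div_one]; exact h4' _ _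
  push Not at hall
  by_cases hlog : ∀ a, v (D a p) ≤ v p
  · exact (key_lemma v D (fun a t => log_of_unif (A := A) v ϖ hn h2 (D a) (h4' a) (hlog a) t) l i1 hl w hw
      x y z hxyz heq hall).le
  push Not at hlog
  obtain ⟨b, hb⟩ := hlog
  have hle : ∀ t : E, v t < 1 → v t ≤ v p := by
    intro t ht
    by_cases ht0 : t = 0
    · simp [ht0]
    obtain ⟨k, m, s, s', hs, hs', hwi⟩ := frac t ht0
    rw [hwi, map_div₀, map_mul, map_mul, hs, hs', mul_one, mul_one, map_pow, map_pow] at ht ⊢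
    have hkm : m + 1 ≤ k := by
      by_contra hcon
      have : k ≤ m := by omega
      rw [div_lt_one₀ (zero_lt_iff.2 (pow_ne_zero _ hvp0))] at ht
      exact absurd ht (not_lt.2 (pow_le_pow_of_le_one zero_le h3.le this))
    rw [div_le_iff₀ (zero_lt_iff.2 (pow_ne_zero _ hvp0)), ← pow_succ']
    exact pow_le_pow_of_le_one zero_le h3.le hkm
  have hb1 : v (D b p) = 1 := by
    refine le_antisymm (h4' b ϖ) ?_
    by_contra hcon
    exact absurd (hle _ (not_le.1 hcon)) (not_le.2 hb)
  have hbp0 : D b p ≠ 0 := fun h => by simp [h] at hb1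
  let cc : ι → E := fun a => if a = b then 0 else -(D a p / D b p)
  let D2 : ι → Derivation ℤ E E := fun a => if a = b then p • D b else D a + cc a • D b
  have hD2b : D2 b = p • D b := by simp [D2]
  have hD2a : ∀ a, a ≠ b → D2 a = D a + cc a • D b := fun a ha => by simp [D2, ha]
  have hcc : ∀ a, v (cc a) ≤ 1 := by
    intro a
    by_cases ha : a = b
    · simp [cc, ha]
    · simp only [cc, if_neg ha, Valuation.map_neg, map_div₀, hb1, div_one]; exact h4' a ϖ
  have hlog2 : ∀ a t, v (D2 a t) ≤ v t := by
    intro a t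
    refine log_of_unif (A := A) v ϖ hn h2 (D2 a) (fun c => ?_) ?_ t
    · by_cases ha : a = b
      · rw [ha, hD2b, Derivation.smul_apply, smul_eq_mul, map_mul]
        exact mul_le_one' h3.le (h4' _ _)
      · rw [hD2a a ha, Derivation.add_apply, Derivation.smul_apply, smul_eq_mul]
        refine v.map_add_le (h4' _ _) ?_
        rw [map_mul]
        exact mul_le_one' (hcc a) (h4' _ _)
    · by_cases ha : a = b
      · rw [ha, hD2b, Derivation.smul_apply, smul_eq_mul, map_mul]
        exact mul_le_of_le_one_right' (h4' _ _)
      · rw [hD2a a ha, Derivation.add_apply, Derivation.smul_apply, smul_eq_mul]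
        simp only [cc, if_neg ha]
        rw [neg_mul, div_mul_cancel₀ _ hbp0, add_neg_cancel, map_zero]
        exact zero_le
  have hkey := key_lemma v D2 hlog2 l i1 hl w hw x y z hxyz heq hall
  have hdet : Matrix.det (Matrix.of fun a i => D2 a (w i) / w i) = p * lgdet D w := by
    have e := Matrix.det_updateRow_smul (Matrix.of fun a i => D a (w i) / w i) b p
      ((Matrix.of fun a i => D a (w i) / w i) b)
    rw [Matrix.updateRow_eq_self] at e
    rw [lgdet, ← e]
    refine Matrix.det_eq_of_forall_row_eq_smul_add_const (fun a => cc a / p) b (by simp [cc]) ?_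
    intro a i
    by_cases ha : a = b
    · subst ha
      simp [hD2b, cc]; ring
    · simp [Matrix.updateRow_ne ha, hD2a a ha]
      field_simp
  rw [hdet] at hkey
  have := hle _ hkey
  rw [map_mul] at this
  exact (mul_le_iff_le_one_right (zero_lt_iff.2 hvp0)).1 this

end
end ConicBundleFormalization

namespace ConicBundleFormalization
noncomputable section
open scoped Matrix
open IsDedekindDomain

/-- derivations over the integers, with the generic instances -/
abbrev Der (E : Type*) [CommRing E] := Derivation ℤ E E

theorem poly_deriv {F : Type*} [Field F] (D : Derivation ℤ F F) :
    ∃ δ : Derivation ℤ (Polynomial F) (Polynomial F), ∀ p i, (δ p).coeff i = D (p.coeff i) := by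
  let _ : Differential F := ⟨D⟩
  exact ⟨Differential.mapCoeffs, fun p i => Differential.coeff_mapCoeffs p i⟩

theorem ratfunc_deriv {F : Type*} [Field F] (D : Derivation ℤ F F) :
    ∃ (D' : Der (RatFunc F)), ∀ p : Polynomial F, ∃ q : Polynomial F,
      (∀ i, q.coeff i = D (p.coeff i)) ∧
      D' (algebraMap _ (RatFunc F) p) = algebraMap _ (RatFunc F) q := by
  obtain ⟨δ, hδ⟩ := poly_deriv D
  have : Algebra.FormallyEtale (Polynomial F) (RatFunc F) :=
    Algebra.FormallyEtale.of_isLocalization (nonZeroDivisors (Polynomial F))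
  obtain ⟨D', hD'⟩ := ext_deriv (B := RatFunc F) δ
  exact ⟨D', fun p => ⟨δ p, hδ p, hD' p⟩⟩

open Classical in
theorem curve_lemma {F : Type*} [Field F] [CharP F 2] (N d : ℕ) (hd : N + 1 ≤ d) (hN : 2 ≤ N)
    (l i1 : Fin N) (hl : i1 ≠ l) (D : Fin N → Derivation ℤ F F)
    (p : Fin (N + 1) → Polynomial F) (e : Fin 3 → Polynomial F) (he : e ≠ 0)
    (hG : MvPolynomial.aeval (Sum.elim p e) (Gpoly F N d l) = 0) (J : ℕ)
    (hJ : ∀ i, (p i).natDegree ≤ J) (h0 : (fun i => (p i).coeff 0) ≠ 0)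
    (hJ0 : (fun i => (p i).coeff J) ≠ 0) :
    rho D (fun i => (p i).coeff 0) = rho D (fun i => (p i).coeff J) := by
  by_cases hp : ∀ i, p i ≠ 0
  swap
  · push Not at hp
    obtain ⟨i, hi⟩ := hp
    rw [rho, rho, if_neg (fun h => h i (by simp [hi])), if_neg (fun h => h i (by simp [hi]))]
  have : CharP (RatFunc F) 2 := charP_of_injective_algebraMap (algebraMap F (RatFunc F)).injective 2
  choose D' q hq hD' using fun a => ratfunc_deriv (D a)
  let am : Polynomial F →ₐ[F] RatFunc F := Algebra.algHom F _ _
  have ham : ∀ t, am t = algebraMap _ (RatFunc F) t := fun t => rfl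
  have amC : ∀ c : F, algebraMap F (RatFunc F) c = algebraMap (Polynomial F) (RatFunc F) (.C c) :=
    fun c => by rw [← ham, ← Polynomial.algebraMap_eq, AlgHom.commutes]
  have aminj : Function.Injective (algebraMap (Polynomial F) (RatFunc F)) :=
    IsFractionRing.injective _ _
  set u : Fin (N + 1) → RatFunc F := fun i => algebraMap _ (RatFunc F) (p i) with hu_def
  set x : Fin 3 → RatFunc F := fun i => algebraMap _ (RatFunc F) (e i) with hx_def
  have hu : ∀ i, u i ≠ 0 := fun i => by simpa [hu_def] using hp i
  have hx : x ≠ 0 := by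
    intro h
    refine he ?_
    funext i
    have := congrFun h i
    simpa [hx_def] using this
  have hGu : MvPolynomial.aeval (Sum.elim u x) (Gpoly F N d l) = 0 := by
    have h1 := congrArg am hG
    rw [map_zero, ← AlgHom.comp_apply, MvPolynomial.comp_aeval] at h1
    rw [← h1]
    congr 2
    funext s; cases s <;> rfl
  have hDD : ∀ a t, D' a (algebraMap F (RatFunc F) t) = algebraMap F (RatFunc F) (D a t) := by
    intro a t
    rw [amC, amC, hD']
    congr 1
    ext i
    rw [hq, Polynomial.coeff_C, Polynomial.coeff_C]
    split_ifs <;> simp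
  have hx' : x 0 ≠ 0 ∨ x 1 ≠ 0 ∨ x 2 ≠ 0 := by
    by_contra hcon
    push Not at hcon
    refine hx ?_
    funext i; fin_cases i
    · exact hcon.1
    · exact hcon.2.1
    · exact hcon.2.2
  have hw0 : ∀ i, wv u i ≠ 0 := fun i => div_ne_zero (hu _) (hu _)
  have heq := Eq_of_Gpoly N d hd hN l u x hu hGu
  -- discrete valuations
  have hdisc : ∀ (P : HeightOneSpectrum (Polynomial F)) (ϖ : Polynomial F),
      P.asIdeal = Ideal.span {ϖ} → ∀ a : Polynomial F, a ≠ 0 → ∃ (k : ℕ) (s : Polynomial F),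
        a = ϖ ^ k * s ∧ P.valuation (RatFunc F) (algebraMap _ (RatFunc F) s) = 1 := by
    intro P ϖ hP a ha
    have hprime : Prime ϖ := by
      have h1 := P.isPrime
      have h2 := P.ne_bot
      rw [hP] at h1 h2
      exact (Ideal.span_singleton_prime (by simpa using h2)).1 h1
    obtain ⟨s, hs, hns⟩ := (FiniteMultiplicity.of_prime_left hprime ha).exists_eq_pow_mul_and_not_dvd
    refine ⟨_, s, hs, le_antisymm (P.valuation_le_one s) ?_⟩
    by_contra hcon
    have := (P.valuation_lt_one_iff_mem (K := RatFunc F) s).1 (not_le.1 hcon)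
    rw [hP, Ideal.mem_span_singleton] at this
    exact hns this
  obtain ⟨R, hR⟩ : lgdet D' (wv u) ∈ (algebraMap (Polynomial F) (RatFunc F)).range := by
    refine HeightOneSpectrum.mem_integers_of_valuation_le_one (RatFunc F) _ fun P => ?_
    obtain ⟨ϖ, hϖ⟩ := (IsPrincipalIdealRing.principal P.asIdeal).principal
    have hϖ' : P.asIdeal = Ideal.span {ϖ} := hϖ
    refine regular_lemma (P.valuation (RatFunc F)) ϖ (fun a => P.valuation_le_one a) (hdisc P ϖ hϖ')
      ?_ ?_ D' (fun i a => ⟨_, hD' i a⟩) l i1 hl (wv u) hw0 _ _ _ hx' heq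
    · refine (P.valuation_lt_one_iff_mem (K := RatFunc F) ϖ).2 ?_
      rw [hϖ']; exact Ideal.mem_span_singleton_self _
    · rintro rfl
      refine P.ne_bot ?_
      rw [hϖ']; simp
  -- infinity
  set vi := RatFunc.inftyValuation F with hvi
  have hvip : ∀ t : Polynomial F, t ≠ 0 → vi (algebraMap _ (RatFunc F) t)
      = WithZero.exp (t.natDegree : ℤ) := fun t ht => RatFunc.inftyValuation.polynomial F ht
  have hlogi : ∀ a t, vi (D' a t) ≤ vi t := by
    intro a t
    refine log_of_frac (A := Polynomial F) vi (D' a) (fun s => ?_) t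
    rw [hD']
    by_cases hs : s = 0
    · have : q a s = 0 := by ext i; rw [hq, hs]; simp
      rw [this, map_zero, map_zero]; exact zero_le
    by_cases hqs : q a s = 0
    · rw [hqs, map_zero, map_zero]; exact zero_le
    rw [hvip _ hs, hvip _ hqs, WithZero.exp_le_exp]
    have : (q a s).natDegree ≤ s.natDegree := by
      refine Polynomial.natDegree_le_iff_coeff_eq_zero.2 fun i hi => ?_
      rw [hq, Polynomial.coeff_eq_zero_of_natDegree_lt hi, map_zero]
    exact_mod_cast this
  have hri : vi (lgdet D' (wv u)) ≤ 1 := by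
    by_cases hall : ∀ i, vi (wv u i) = 1
    · refine det_le_one vi _ fun a i => ?_
      simp only [Matrix.of_apply, map_div₀, hall, div_one]
      exact (hlogi _ _).trans (hall i).le
    · push Not at hall
      exact (key_lemma vi D' hlogi l i1 hl (wv u) hw0 _ _ _ hx' heq hall).le
  obtain ⟨c, hc⟩ : ∃ c : F, lgdet D' (wv u) = algebraMap F (RatFunc F) c := by
    rw [← hR] at hri
    by_cases hR0 : R = 0
    · exact ⟨0, by rw [← hR, hR0]; simp⟩
    rw [hvip _ hR0, ← WithZero.exp_zero, WithZero.exp_le_exp] at hri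
    have hRd : R.natDegree = 0 := by
      have : R.natDegree ≤ 0 := by exact_mod_cast hri
      omega
    refine ⟨R.coeff 0, ?_⟩
    rw [← hR, amC, ← Polynomial.eq_C_of_natDegree_eq_zero hRd]
  have hX0 : (algebraMap (Polynomial F) (RatFunc F) Polynomial.X) ≠ 0 := by
    exact fun h => Polynomial.X_ne_zero (aminj (h.trans (map_zero _).symm))
  have hXJ : algebraMap _ (RatFunc F) (Polynomial.X ^ J : Polynomial F) ≠ 0 := by
    rw [map_pow]; exact pow_ne_zero _ hX0
  have r1 : c = rho D (fun i => (p i).coeff 0) := by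
    set P := Polynomial.idealX F
    have hP : P.asIdeal = Ideal.span {Polynomial.X} := rfl
    refine place_lemma (P.valuation (RatFunc F)) ?_ N d hd hN l i1 hl D D' hDD ?_ u x hx hu hGu
      _ h0 1 one_ne_zero ?_ c hc
    · intro c hc
      rw [amC]
      refine le_antisymm (P.valuation_le_one _) ?_
      by_contra hcon
      have := (P.valuation_lt_one_iff_mem (K := RatFunc F) (.C c)).1 (not_le.1 hcon)
      rw [hP, Ideal.mem_span_singleton, Polynomial.X_dvd_iff] at this
      simp [hc] at this
    · intro a t
      refine log_of_unif (A := Polynomial F) (P.valuation (RatFunc F)) Polynomial.X ?_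
        (hdisc P _ hP) (D' a) ?_ ?_ t
      · intro n
        simpa using P.valuation_le_one (K := RatFunc F) (n : Polynomial F)
      · intro s; rw [hD']; exact P.valuation_le_one _
      · rw [hD']
        have : q a Polynomial.X = 0 := by
          ext i; rw [hq, Polynomial.coeff_X]; split_ifs <;> simp
        rw [this, map_zero, map_zero]; exact zero_le
    · intro i
      rw [div_one, amC, hu_def, ← map_sub]
      refine (P.valuation_lt_one_iff_mem (K := RatFunc F) _).2 ?_
      rw [hP, Ideal.mem_span_singleton, Polynomial.X_dvd_iff]
      simp
  have r2 : c = rho D (fun i => (p i).coeff J) := by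
    refine place_lemma vi ?_ N d hd hN l i1 hl D D' hDD hlogi u x hx hu hGu
      _ hJ0 (algebraMap _ (RatFunc F) (Polynomial.X ^ J : Polynomial F)) hXJ ?_ c hc
    · intro c hc
      rw [amC, hvip _ (by simpa using hc)]; simp
    · intro i
      have e1 : u i / algebraMap _ (RatFunc F) (Polynomial.X ^ J : Polynomial F) - algebraMap F (RatFunc F) ((p i).coeff J)
          = algebraMap _ (RatFunc F) (p i - .C ((p i).coeff J) * Polynomial.X ^ J)
            / algebraMap _ (RatFunc F) (Polynomial.X ^ J : Polynomial F) := by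
        rw [map_sub, map_mul, ← amC]; field_simp; rfl
      rw [e1, map_div₀, hvip (Polynomial.X ^ J) (by simp)]
      set t := p i - .C ((p i).coeff J) * Polynomial.X ^ J with ht
      by_cases ht0 : t = 0
      · rw [ht0, map_zero, map_zero, zero_div]; exact zero_lt_one
      rw [hvip _ ht0, div_lt_one₀ (by simp), WithZero.exp_lt_exp, Polynomial.natDegree_X_pow]
      have htd : t.natDegree ≤ J := by
        refine (Polynomial.natDegree_sub_le _ _).trans (max_le (hJ i) ?_)
        exact Polynomial.natDegree_C_mul_X_pow_le _ _
      have htJ : t.coeff J = 0 := by simp [ht]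
      have : t.natDegree < J := by
        refine lt_of_le_of_ne htd fun hh => ht0 ?_
        rw [← Polynomial.leadingCoeff_eq_zero, Polynomial.leadingCoeff, hh, htJ]
      exact_mod_cast this
  rw [← r1, ← r2]

end
end ConicBundleFormalization

namespace ConicBundleFormalization
noncomputable section

theorem Gexp_smul {A : Type*} [CommRing A] (N d : ℕ) (hd : N + 1 ≤ d) (hN : 2 ≤ N) (l : Fin N)
    (σ : A) (u : Fin (N + 1) → A) (x : Fin 3 → A) :
    Gexp N d l (fun i => σ * u i) x = σ ^ d * Gexp N d l u x := by
  obtain ⟨k, rfl⟩ := Nat.exists_eq_add_of_le hd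
  obtain ⟨m, rfl⟩ := Nat.exists_eq_add_of_le hN
  have e1 : 2 + m + 1 + k - 2 = m + 1 + k := by omega
  have e2 : 2 + m + 1 + k - (2 + m + 1) = k := by omega
  have e3 : 2 + m + 1 + k - (2 + m) = k + 1 := by omega
  have e4 : ∏ j : Fin (2 + m), σ * u j.succ = σ ^ (2 + m) * ∏ j : Fin (2 + m), u j.succ := by
    rw [Finset.prod_mul_distrib]; simp
  have e5 : ∏ j ∈ Finset.univ.erase l, σ * u (Fin.succ j)
      = σ ^ (1 + m) * ∏ j ∈ Finset.univ.erase l, u (Fin.succ j) := by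
    rw [Finset.prod_mul_distrib]; simp [Finset.card_erase_of_mem]
  simp only [Gexp, e1, e2, e3, e4, e5, ← Finset.sum_mul, ← Finset.mul_sum]
  ring

theorem aeval_Gpoly {F A : Type*} [CommRing F] [CommRing A] [Algebra F A] (N d : ℕ) (l : Fin N)
    (u : Fin (N + 1) → A) (x : Fin 3 → A) :
    MvPolynomial.aeval (Sum.elim u x) (Gpoly F N d l) = Gexp N d l u x := by
  rw [← AlgHom.coe_toRingHom, Gpoly, Gexp_map]
  simp only [AlgHom.coe_toRingHom, MvPolynomial.aeval_X, Sum.elim_inl, Sum.elim_inr]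

theorem curve_lemma' {F : Type*} [Field F] [CharP F 2] (N d : ℕ) (hd : N + 1 ≤ d) (hN : 2 ≤ N)
    (l i1 : Fin N) (hl : i1 ≠ l) (D : Fin N → Derivation ℤ F F)
    (p : Fin (N + 1) → Polynomial F) (e : Fin 3 → Polynomial F) (he : e ≠ 0)
    (hG : MvPolynomial.aeval (Sum.elim p e) (Gpoly F N d l) = 0) (j J : ℕ) (hjJ : j ≤ J)
    (hj : ∀ i m, m < j → (p i).coeff m = 0)
    (hJ : ∀ i m, J < m → (p i).coeff m = 0) (h0 : (fun i => (p i).coeff j) ≠ 0)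
    (hJ0 : (fun i => (p i).coeff J) ≠ 0) :
    rho D (fun i => (p i).coeff j) = rho D (fun i => (p i).coeff J) := by
  have hdvd : ∀ i, ∃ q, p i = Polynomial.X ^ j * q := fun i =>
    Polynomial.X_pow_dvd_iff.2 (hj i)
  choose q hq using hdvd
  obtain ⟨k, rfl⟩ := Nat.exists_eq_add_of_le hjJ
  have hc : ∀ i m, (p i).coeff (j + m) = (q i).coeff m := fun i m => by
    rw [hq, add_comm, Polynomial.coeff_X_pow_mul]
  have hc0 : ∀ i, (p i).coeff j = (q i).coeff 0 := fun i => by simpa using hc i 0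
  simp only [hc, hc0] at h0 hJ0 ⊢
  refine curve_lemma N d hd hN l i1 hl D q e he ?_ k ?_ h0 hJ0
  · rw [aeval_Gpoly] at hG ⊢
    rw [funext hq, Gexp_smul N d hd hN] at hG
    exact (mul_eq_zero.1 hG).resolve_left (pow_ne_zero _ (pow_ne_zero _ Polynomial.X_ne_zero))
  · intro i
    refine Polynomial.natDegree_le_iff_coeff_eq_zero.2 fun m hm => ?_
    rw [← hc]; exact hJ i _ (by omega)

theorem map_aeval_poly {R S σ : Type*} [CommRing R] [CommRing S] (f : R →+* S)
    (g : MvPolynomial σ R) (s : σ → Polynomial R) :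
    (MvPolynomial.aeval s g).map f
      = MvPolynomial.aeval (fun i => (s i).map f) (MvPolynomial.map f g) := by
  induction g using MvPolynomial.induction_on with
  | C a => simp
  | add p q hp hq => simp [hp, hq]
  | mul_X p i hp => simp [hp]

section chain
variable {K : Type*} [Field K] (W : ValuationSubring K)

open Classical in
/-- total residue map -/
def rs (t : K) : IsLocalRing.ResidueField W :=
  if h : t ∈ W then IsLocalRing.residue W ⟨t, h⟩ else 0

theorem rs_coe (t : W) : rs W (t : K) = IsLocalRing.residue W t := by
  simp [rs]

theorem rs_of_mem {t : K} (h : t ∈ W) : rs W t = IsLocalRing.residue W ⟨t, h⟩ := by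
  simp [rs, h]

theorem rs_eq_zero {t : K} (h : W.valuation t ≤ 1) : rs W t = 0 ↔ W.valuation t < 1 := by
  have h' := (W.valuation_le_one_iff t).1 h
  rw [rs_of_mem W h', IsLocalRing.residue_eq_zero_iff]
  exact W.valuation_lt_one_iff ⟨t, h'⟩

theorem rs_mul {s t : K} (hs : W.valuation s ≤ 1) (ht : W.valuation t ≤ 1) :
    rs W (s * t) = rs W s * rs W t := by
  have hs' := (W.valuation_le_one_iff s).1 hs
  have ht' := (W.valuation_le_one_iff t).1 ht
  rw [rs_of_mem W hs', rs_of_mem W ht', rs_of_mem W (mul_mem hs' ht'), ← map_mul]; rfl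

/-- value of rho on the reduction of a vector -/
def HR {N : ℕ} (D : Fin N → Der (IsLocalRing.ResidueField W)) (x : Fin (N + 1) → K)
    (c : IsLocalRing.ResidueField W) : Prop :=
  ∃ μ : K, μ ≠ 0 ∧ (∀ i, W.valuation (x i) ≤ W.valuation μ) ∧
    (∃ i, W.valuation (x i) = W.valuation μ) ∧ rho D (fun i => rs W (x i / μ)) = c

theorem HR_unique {N : ℕ} (D : Fin N → Der (IsLocalRing.ResidueField W)) (x : Fin (N + 1) → K)
    (c c' : IsLocalRing.ResidueField W) (h : HR W D x c) (h' : HR W D x c') : c = c' := by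
  obtain ⟨μ, hμ, h1, ⟨i, hi⟩, rfl⟩ := h
  obtain ⟨μ', hμ', h1', ⟨i', hi'⟩, rfl⟩ := h'
  have hv : W.valuation μ = W.valuation μ' :=
    le_antisymm (hi ▸ h1' i) (hi' ▸ h1 i')
  have hv0 : W.valuation μ ≠ 0 := by simpa using hμ
  have hu : W.valuation (μ / μ') = 1 := by rw [map_div₀, ← hv, div_self hv0]
  have hr : rs W (μ / μ') ≠ 0 := by
    intro h0
    rw [rs_eq_zero W hu.le, hu] at h0; exact lt_irrefl _ h0
  rw [← rho_smul D (fun i => rs W (x i / μ)) _ hr]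
  congr 1
  funext k
  rw [← rs_mul W hu.le]
  · congr 1; field_simp
  · rw [map_div₀]; exact div_le_one_of_le₀ (h1 k) zero_le

theorem HR_smul {N : ℕ} (D : Fin N → Der (IsLocalRing.ResidueField W)) (x : Fin (N + 1) → K)
    (c : IsLocalRing.ResidueField W) (a : K) (ha : a ≠ 0) (h : HR W D x c) :
    HR W D (fun i => a * x i) c := by
  obtain ⟨μ, hμ, h1, ⟨i, hi⟩, rfl⟩ := h
  refine ⟨a * μ, mul_ne_zero ha hμ, fun i => ?_, ⟨i, ?_⟩, ?_⟩
  · rw [map_mul, map_mul]; gcongr; exact h1 i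
  · rw [map_mul, map_mul, hi]
  · congr 1; funext k; rw [mul_div_mul_left _ _ ha]

theorem lift_poly (p : Polynomial K) (hp : ∀ m, W.valuation (p.coeff m) ≤ 1) :
    ∃ p' : Polynomial W, p'.map (algebraMap W K) = p := by
  have : p ∈ Polynomial.lifts (algebraMap W K) := by
    rw [Polynomial.lifts_iff_coeff_lifts]
    intro n
    exact ⟨⟨_, (W.valuation_le_one_iff _).1 (hp n)⟩, rfl⟩
  exact (Polynomial.mem_lifts _).1 this

theorem red_lemma [CharP (IsLocalRing.ResidueField W) 2] (N d : ℕ) (hd : N + 1 ≤ d) (hN : 2 ≤ N)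
    (l i1 : Fin N) (hl : i1 ≠ l) (D : Fin N → Der (IsLocalRing.ResidueField W))
    (gW : MvPolynomial (Fin (N + 1) ⊕ Fin 3) W)
    (hgW : MvPolynomial.map (IsLocalRing.residue W) gW = Gpoly _ N d l)
    (hs : ∀ (σ τ : Polynomial K) (u : Fin (N + 1) → Polynomial K) (x : Fin 3 → Polynomial K),
      MvPolynomial.aeval (Sum.elim u x) (MvPolynomial.map (algebraMap W K) gW) = 0 →
      MvPolynomial.aeval (Sum.elim (fun i => σ * u i) (fun i => τ * x i))
        (MvPolynomial.map (algebraMap W K) gW) = 0)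
    (p : Fin (N + 1) → Polynomial K) (e : Fin 3 → Polynomial K) (he : e ≠ 0)
    (hg : MvPolynomial.aeval (Sum.elim p e) (MvPolynomial.map (algebraMap W K) gW) = 0)
    (hp : ∀ i m, W.valuation ((p i).coeff m) ≤ 1) (j J : ℕ) (hjJ : j ≤ J)
    (hj : ∀ i m, m < j → W.valuation ((p i).coeff m) < 1)
    (hJ : ∀ i m, J < m → W.valuation ((p i).coeff m) < 1)
    (h0 : ∃ i, W.valuation ((p i).coeff j) = 1)
    (hJ0 : ∃ i, W.valuation ((p i).coeff J) = 1) :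
    rho D (fun i => rs W ((p i).coeff j)) = rho D (fun i => rs W ((p i).coeff J)) := by
  -- normalise e
  obtain ⟨i0, hi0⟩ := Function.ne_iff.1 he
  obtain ⟨m0, hm0⟩ : ∃ m, (e i0).coeff m ≠ 0 := by
    by_contra hcon
    push Not at hcon
    exact hi0 (Polynomial.ext hcon)
  set B := (e 0).natDegree + (e 1).natDegree + (e 2).natDegree with hB
  have hBi : ∀ i m, B < m → (e i).coeff m = 0 := by
    intro i m hm
    refine Polynomial.coeff_eq_zero_of_natDegree_lt ?_
    fin_cases i <;> simp <;> omega
  obtain ⟨⟨i2, m2⟩, hmax⟩ := Finite.exists_max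
    (fun s : Fin 3 × Fin (B + 1) => W.valuation ((e s.1).coeff s.2))
  set ν := (e i2).coeff m2 with hν
  have hle : ∀ i m, W.valuation ((e i).coeff m) ≤ W.valuation ν := by
    intro i m
    by_cases hm : m < B + 1
    · exact hmax (i, ⟨m, hm⟩)
    · rw [hBi i m (by omega), map_zero]; exact zero_le
  have hν0 : ν ≠ 0 := by
    intro h
    have := hle i0 m0
    rw [h, map_zero] at this
    exact hm0 (by simpa using this)
  have hvν : W.valuation ν ≠ 0 := by simpa using hν0
  have hg' := hs 1 (.C ν⁻¹) p e hg
  simp only [one_mul] at hg'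
  choose p' hp' using fun i => lift_poly W (p i) (hp i)
  choose e' he' using fun i => lift_poly W (.C ν⁻¹ * e i) (fun m => by
    rw [Polynomial.coeff_C_mul, map_mul, map_inv₀]
    rw [inv_mul_le_iff₀ (zero_lt_iff.2 hvν), mul_one]
    exact hle i m)
  have hgl : MvPolynomial.aeval (Sum.elim p' e') gW = 0 := by
    refine Polynomial.map_injective (algebraMap W K) (IsFractionRing.injective _ _) ?_
    rw [map_aeval_poly, Polynomial.map_zero, ← hg']
    congr 2
    funext s; cases s with
    | inl i => exact hp' i
    | inr i => exact he' i
  have hgk := congrArg (Polynomial.map (IsLocalRing.residue W)) hgl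
  rw [map_aeval_poly, hgW, Polynomial.map_zero] at hgk
  set pk : Fin (N + 1) → Polynomial (IsLocalRing.ResidueField W) :=
    fun i => (p' i).map (IsLocalRing.residue W) with hpk
  set ek : Fin 3 → Polynomial (IsLocalRing.ResidueField W) :=
    fun i => (e' i).map (IsLocalRing.residue W) with hek
  have hgk' : MvPolynomial.aeval (Sum.elim pk ek) (Gpoly (IsLocalRing.ResidueField W) N d l) = 0 := by
    rw [← hgk]; congr 2; funext s; cases s <;> rfl
  have hcoef : ∀ i m, (pk i).coeff m = rs W ((p i).coeff m) := by
    intro i m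
    rw [hpk, ← hp' i, Polynomial.coeff_map, Polynomial.coeff_map]
    exact (rs_coe W _).symm
  have hek0 : ek ≠ 0 := by
    intro h
    have h2 : (ek i2).coeff m2 = 0 := by rw [h]; simp
    have h3 : (ek i2).coeff m2 = rs W ((Polynomial.C ν⁻¹ * e i2).coeff m2) := by
      rw [hek, ← he' i2, Polynomial.coeff_map, Polynomial.coeff_map]
      exact (rs_coe W _).symm
    rw [h3, Polynomial.coeff_C_mul, ← hν, inv_mul_cancel₀ hν0, rs_eq_zero W (by simp)] at h2
    simp at h2
  have := curve_lemma' N d hd hN l i1 hl D pk ek hek0 hgk' j J hjJ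
    (fun i m hm => by rw [hcoef, rs_eq_zero W (hp i m)]; exact hj i m hm)
    (fun i m hm => by rw [hcoef, rs_eq_zero W (hp i m)]; exact hJ i m hm)
    (by
      obtain ⟨i, hi⟩ := h0
      intro h
      have := congrFun h i
      simp only [hcoef, Pi.zero_apply] at this
      rw [rs_eq_zero W (hp i j), hi] at this; exact lt_irrefl _ this)
    (by
      obtain ⟨i, hi⟩ := hJ0
      intro h
      have := congrFun h i
      simp only [hcoef, Pi.zero_apply] at this
      rw [rs_eq_zero W (hp i J), hi] at this; exact lt_irrefl _ this)
  simpa only [hcoef] using this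

end chain

theorem chain_comb {C Γ₀ : Type*} [Field C] [IsAlgClosed C] [LinearOrderedCommGroupWithZero Γ₀]
    (v : Valuation C Γ₀) (m : ℕ → C) (J : ℕ) (hmJ : m J ≠ 0) (hm0 : ∀ k, J < k → m k = 0) (j : ℕ)
    (hjJ : j < J) (hmj : m j ≠ 0)
    (H : ∀ t : C, t ≠ 0 → (∃ j', j < j' ∧ m j' ≠ 0 ∧ v (m j' * t ^ j') = v (m j * t ^ j)) →
      ∀ k, k < j → v (m k * t ^ k) < v (m j * t ^ j)) :
    ∃ (t : C) (J' : ℕ), t ≠ 0 ∧ j < J' ∧ J' ≤ J ∧ m J' ≠ 0 ∧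
      (∀ k, v (m k * t ^ k) ≤ v (m j * t ^ j)) ∧ v (m J' * t ^ J') = v (m j * t ^ j) ∧
      (∀ k, k < j → v (m k * t ^ k) < v (m j * t ^ j)) ∧
      (∀ k, J' < k → v (m k * t ^ k) < v (m j * t ^ j)) ∧
      (∀ t : C, t ≠ 0 → (∃ j', J' < j' ∧ m j' ≠ 0 ∧ v (m j' * t ^ j') = v (m J' * t ^ J')) →
      ∀ k, k < J' → v (m k * t ^ k) < v (m J' * t ^ J')) := by
  classical
  have hex : ∀ j' : ℕ, ∃ t : C, j < j' → m j' ≠ 0 → t ^ (j' - j) = m j / m j' := by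
    intro j'
    by_cases h : j < j'
    · obtain ⟨t, ht⟩ := IsAlgClosed.exists_pow_nat_eq (m j / m j') (n := j' - j) (by omega)
      exact ⟨t, fun _ _ => ht⟩
    · exact ⟨0, fun h' => absurd h' h⟩
  choose L hL using hex
  set S := (Finset.Ioc j J).filter (fun k => m k ≠ 0) with hS
  have hSne : S.Nonempty := ⟨J, by simp [hS, hjJ, hmJ]⟩
  obtain ⟨js, hjs, hmin⟩ := S.exists_min_image (fun k => v (L k)) hSne
  simp only [hS, Finset.mem_filter, Finset.mem_Ioc] at hjs hmin
  set t := L js with ht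
  have hts := hL js hjs.1.1 hjs.2
  have ht0 : t ≠ 0 := by
    intro h
    rw [← ht, h, zero_pow (by omega)] at hts
    exact div_ne_zero hmj hjs.2 hts.symm
  have split : ∀ k, j < k → m k * t ^ k = m k * t ^ (k - j) * t ^ j := by
    intro k hk
    rw [mul_assoc, ← pow_add]; congr 2; omega
  have heqs : v (m js * t ^ js) = v (m j * t ^ j) := by
    rw [split js hjs.1.1, hts, mul_div_cancel₀ _ hjs.2]
  have hlow : ∀ k, k < j → v (m k * t ^ k) < v (m j * t ^ j) :=
    H t ht0 ⟨js, hjs.1.1, hjs.2, heqs⟩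
  have hall : ∀ k, v (m k * t ^ k) ≤ v (m j * t ^ j) := by
    intro k
    rcases lt_trichotomy k j with hk | hk | hk
    · exact (hlow k hk).le
    · rw [hk]
    · by_cases hmk : m k = 0
      · rw [hmk, zero_mul, map_zero]; exact zero_le
      have hkJ : k ≤ J := by
        by_contra hcon
        exact hmk (hm0 k (by omega))
      have h1 := hmin k ⟨⟨hk, hkJ⟩, hmk⟩
      have h2 := hL k hk hmk
      have h3 : v (m k * L k ^ (k - j)) = v (m j) := by rw [h2, mul_div_cancel₀ _ hmk]
      rw [split k hk, map_mul, map_mul v (m j)]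
      gcongr
      rw [← h3, map_mul, map_mul, map_pow, map_pow]
      gcongr
  set S' := (Finset.Ioc j J).filter (fun k => m k ≠ 0 ∧ v (m k * t ^ k) = v (m j * t ^ j)) with hS'
  have hSne' : S'.Nonempty := ⟨js, by simp only [hS', Finset.mem_filter, Finset.mem_Ioc]; exact ⟨hjs.1, hjs.2, heqs⟩⟩
  set J' := S'.max' hSne' with hJ'
  have hJmem := S'.max'_mem hSne'
  rw [← hJ'] at hJmem
  simp only [hS', Finset.mem_filter, Finset.mem_Ioc] at hJmem
  have hhigh : ∀ k, J' < k → v (m k * t ^ k) < v (m j * t ^ j) := by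
    intro k hk
    refine lt_of_le_of_ne (hall k) fun heq => ?_
    by_cases hmk : m k = 0
    · rw [hmk, zero_mul, map_zero] at heq
      have : m j * t ^ j = 0 := by
        rw [← v.zero_iff]; exact heq.symm
      exact mul_ne_zero hmj (pow_ne_zero _ ht0) this
    have hkJ : k ≤ J := by
      by_contra hcon
      exact hmk (hm0 k (by omega))
    have : k ≤ J' := S'.le_max' k (by
      simp only [hS', Finset.mem_filter, Finset.mem_Ioc]
      exact ⟨⟨by omega, hkJ⟩, hmk, heq⟩)
    omega
  refine ⟨t, J', ht0, hJmem.1.1, hJmem.1.2, hJmem.2.1, hall, hJmem.2.2, hlow, hhigh, ?_⟩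
  rintro t' ht0' ⟨j', hj', hmj', hv⟩ k hk
  have hvt : v t ≠ 0 := by simpa using ht0
  have hvt' : v t' ≠ 0 := by simpa using ht0'
  have hlt : v t < v t' := by
    by_contra hcon
    rw [not_lt] at hcon
    have h1 := hhigh j' hj'
    rw [← hJmem.2.2] at h1
    have e1 : ∀ s : C, m j' * s ^ j' = m j' * s ^ (j' - J') * s ^ J' := fun s => by
      rw [mul_assoc, ← pow_add]; congr 2; omega
    rw [e1, map_mul, map_mul v (m J'), map_pow v t J'] at h1
    rw [e1, map_mul, map_mul v (m J'), map_pow v t' J'] at hv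
    have h1' := lt_of_mul_lt_mul_right h1 zero_le
    have hv' := mul_right_cancel₀ (pow_ne_zero _ hvt') hv
    rw [← hv', map_mul, map_mul, map_pow, map_pow] at h1'
    refine absurd h1' (not_lt.2 ?_)
    gcongr
  have h2 : v (m k * t ^ k) ≤ v (m J' * t ^ J') := by rw [hJmem.2.2]; exact hall k
  rw [map_mul, map_mul, map_pow, map_pow] at h2 ⊢
  have hr : 1 < v t' / v t := (one_lt_div₀ (zero_lt_iff.2 hvt)).2 hlt
  have e2 : ∀ a, v t' ^ a = v t ^ a * (v t' / v t) ^ a := fun a => by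
    rw [← mul_pow, mul_div_cancel₀ _ hvt]
  rw [e2 k, e2 J', ← mul_assoc, ← mul_assoc]
  calc _ ≤ v (m J') * v t ^ J' * (v t' / v t) ^ k := by gcongr
    _ < _ := by
      have h5 : 0 < v (m J') * v t ^ J' := zero_lt_iff.2
        (mul_ne_zero (by simpa using hJmem.2.1) (pow_ne_zero _ hvt))
      gcongr

theorem chain_lemma {C K : Type*} [Field C] [IsAlgClosed C] [Field K] [Algebra C K]
    (W : ValuationSubring K) [CharP (IsLocalRing.ResidueField W) 2] (N d : ℕ) (hd : N + 1 ≤ d)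
    (hN : 2 ≤ N)
    (l i1 : Fin N) (hl : i1 ≠ l) (D : Fin N → Der (IsLocalRing.ResidueField W))
    (gW : MvPolynomial (Fin (N + 1) ⊕ Fin 3) W)
    (hgW : MvPolynomial.map (IsLocalRing.residue W) gW = Gpoly _ N d l)
    (hs : ∀ (σ τ : Polynomial K) (u : Fin (N + 1) → Polynomial K) (x : Fin 3 → Polynomial K),
      MvPolynomial.aeval (Sum.elim u x) (MvPolynomial.map (algebraMap W K) gW) = 0 →
      MvPolynomial.aeval (Sum.elim (fun i => σ * u i) (fun i => τ * x i))
        (MvPolynomial.map (algebraMap W K) gW) = 0)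
    (R1 : ∀ h : K, h ≠ 0 → ∃ a : C, a ≠ 0 ∧ W.valuation h = W.valuation (algebraMap C K a))
    (p : Fin (N + 1) → Polynomial K) (e : Fin 3 → Polynomial K) (he : e ≠ 0)
    (hg : MvPolynomial.aeval (Sum.elim p e) (MvPolynomial.map (algebraMap W K) gW) = 0)
    (J : ℕ) (hJ : ∀ i, (p i).natDegree ≤ J)
    (h0 : (fun i => (p i).coeff 0) ≠ 0) (hJ0 : (fun i => (p i).coeff J) ≠ 0)
    (c : IsLocalRing.ResidueField W) (hc : HR W D (fun i => (p i).coeff 0) c) :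
    HR W D (fun i => (p i).coeff J) c := by
  set v : Valuation C _ := W.valuation.comap (algebraMap C K) with hv
  have hm : ∀ k, ∃ m : C, (∀ i, W.valuation ((p i).coeff k) ≤ v m) ∧
      ∃ i, W.valuation ((p i).coeff k) = v m := by
    intro k
    obtain ⟨i, hi⟩ := Finite.exists_max (fun i => W.valuation ((p i).coeff k))
    by_cases h : (p i).coeff k = 0
    · exact ⟨0, fun i' => by simpa [h] using hi i', i, by simp [h]⟩
    · obtain ⟨a, _, ha⟩ := R1 _ h
      exact ⟨a, fun i' => (hi i').trans ha.le, i, ha⟩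
  choose m hm1 hm2 using hm
  have hmne : ∀ k, (fun i => (p i).coeff k) ≠ 0 → m k ≠ 0 := by
    intro k hk h
    refine hk (funext fun i => ?_)
    have := hm1 k i
    rw [h, map_zero] at this
    simpa using this
  have hm0 : ∀ k, J < k → m k = 0 := by
    intro k hk
    obtain ⟨i, hi⟩ := hm2 k
    rw [Polynomial.coeff_eq_zero_of_natDegree_lt ((hJ i).trans_lt hk), map_zero] at hi
    exact v.zero_iff.1 hi.symm
  have main : ∀ b j : ℕ, j + b = J → m j ≠ 0 → HR W D (fun i => (p i).coeff j) c →
      (∀ t : C, t ≠ 0 → (∃ j', j < j' ∧ m j' ≠ 0 ∧ v (m j' * t ^ j') = v (m j * t ^ j)) →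
      ∀ k, k < j → v (m k * t ^ k) < v (m j * t ^ j)) → HR W D (fun i => (p i).coeff J) c := by
    intro b
    induction b using Nat.strong_induction_on with
    | _ b ih =>
    intro j hjb hmj hcj Hj
    by_cases hb : b = 0
    · have : j = J := by omega
      rw [← this]; exact hcj
    obtain ⟨t, J', ht0, hjJ', hJJ', hmJ', hall, heq, hlow, hhigh, HJ'⟩ :=
      chain_comb v m J (hmne J hJ0) hm0 j (by omega) hmj Hj
    refine ih (J - J') (by omega) J' (by omega) hmJ' ?_ HJ'
    -- rescaled polynomials
    set tK := algebraMap C K t with htK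
    set a := algebraMap C K (m j * t ^ j) with ha
    have htK0 : tK ≠ 0 := by rw [htK]; simpa using ht0
    have ha0 : a ≠ 0 := by rw [ha]; simp [hmj, ht0]
    have hva0 : W.valuation a ≠ 0 := by simpa using ha0
    have hva : W.valuation a = v (m j * t ^ j) := rfl
    let P : Fin (N + 1) → Polynomial K := fun i => .C a⁻¹ * (p i).comp (.C tK * .X)
    let e2 : Fin 3 → Polynomial K := fun i => (e i).comp (.C tK * .X)
    have hPc : ∀ i k, (P i).coeff k = (p i).coeff k * tK ^ k / a := by
      intro i k
      simp only [P, Polynomial.coeff_C_mul, Polynomial.comp_C_mul_X_coeff]; field_simp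
    have he2 : e2 ≠ 0 := by
      intro h
      refine he (funext fun i => Polynomial.ext fun k => ?_)
      have := congrArg (fun q => Polynomial.coeff q k) (congrFun h i)
      simp only [e2, Polynomial.comp_C_mul_X_coeff, Pi.zero_apply, Polynomial.coeff_zero] at this
      simpa using (mul_eq_zero.1 this).resolve_right (pow_ne_zero _ htK0)
    have hg2 : MvPolynomial.aeval (Sum.elim P e2) (MvPolynomial.map (algebraMap W K) gW) = 0 := by
      have h1 := congrArg (Polynomial.aeval (R := K) (Polynomial.C tK * Polynomial.X)) hg
      rw [map_zero, ← AlgHom.comp_apply, MvPolynomial.comp_aeval] at h1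
      have h2 := hs (.C a⁻¹) 1 (fun i => (p i).comp (.C tK * .X)) e2 (by
        rw [← h1]; congr 2
        funext s; cases s <;> simp [e2, Polynomial.comp, Polynomial.aeval_def])
      simpa only [one_mul] using h2
    have hvP : ∀ i k, W.valuation ((P i).coeff k) ≤ v (m k * t ^ k) / W.valuation a := by
      intro i k
      rw [hPc, map_div₀, map_mul, map_pow, map_mul, map_pow]
      gcongr
      · exact zero_le
      · exact hm1 k i
      · exact le_of_eq rfl
    have hvP2 : ∀ k, ∃ i, W.valuation ((P i).coeff k) = v (m k * t ^ k) / W.valuation a := by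
      intro k
      obtain ⟨i, hi⟩ := hm2 k
      refine ⟨i, ?_⟩
      rw [hPc, map_div₀, map_mul, map_pow, map_mul, map_pow, hi]; rfl
    have hred := red_lemma W N d hd hN l i1 hl D gW hgW hs P e2 he2 hg2
      (fun i k => (hvP i k).trans (div_le_one_of_le₀ (hall k) zero_le)) j J' hjJ'.le
      (fun i k hk => (hvP i k).trans_lt ((div_lt_one₀ (zero_lt_iff.2 hva0)).2 (hlow k hk)))
      (fun i k hk => (hvP i k).trans_lt ((div_lt_one₀ (zero_lt_iff.2 hva0)).2 (hhigh k hk)))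
      (by obtain ⟨i, hi⟩ := hvP2 j; exact ⟨i, by rw [hi, ← hva, div_self hva0]⟩)
      (by obtain ⟨i, hi⟩ := hvP2 J'; exact ⟨i, by rw [hi, heq, ← hva, div_self hva0]⟩)
    have hmjK : algebraMap C K (m j) ≠ 0 := by simpa using hmj
    have hj2 : HR W D (fun i => (p i).coeff j) (rho D (fun i => rs W ((P i).coeff j))) := by
      refine ⟨algebraMap C K (m j), hmjK, hm1 j, hm2 j, ?_⟩
      congr 1; funext i; rw [hPc]; congr 1
      rw [ha, map_mul, map_pow, ← htK]; field_simp
    have hcc := HR_unique W D _ _ _ hcj hj2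
    refine ⟨a / tK ^ J', div_ne_zero ha0 (pow_ne_zero _ htK0), ?_, ?_, ?_⟩
    · have hvt : W.valuation (a / tK ^ J') = v (m J') := by
        rw [map_div₀, hva, ← heq, map_mul, map_pow, map_pow]
        exact mul_div_cancel_right₀ _ (pow_ne_zero _ (by simpa using ht0))
      intro i; rw [hvt]; exact hm1 J' i
    · have hvt : W.valuation (a / tK ^ J') = v (m J') := by
        rw [map_div₀, hva, ← heq, map_mul, map_pow, map_pow]
        exact mul_div_cancel_right₀ _ (pow_ne_zero _ (by simpa using ht0))
      rw [hvt]; exact hm2 J'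
    · rw [hcc, hred]
      congr 1; funext i; rw [hPc]; congr 1; field_simp
  exact main J 0 (by omega) (hmne 0 h0) hc (fun t _ _ k hk => absurd hk (by omega))

end
end ConicBundleFormalization

namespace ConicBundleFormalization
noncomputable section

theorem no_root_poly {R : Type*} [CommRing R] [IsDomain R] (N d : ℕ) (l : Fin N) (w : Fin N → R)
    (hw : ∀ i, w i ≠ 0) (z : R) (hz : z ≠ 0) (a b : Polynomial R) (hb : b ≠ 0)
    (h : Gexp N d l (Fin.cons 1 (fun i => Polynomial.C (w i) * if i = l then Polynomial.X else 1))
      ![b, a, Polynomial.C z * Polynomial.X ^ 2 * b] = 0) : False := by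
  have hp : (∏ j : Fin N, (Polynomial.C (w j) * if j = l then (Polynomial.X : Polynomial R) else 1))
      = Polynomial.C (∏ j, w j) * Polynomial.X := by
    rw [Finset.prod_mul_distrib, map_prod]; simp
  have hp2 : (∏ j ∈ Finset.univ.erase l,
      (Polynomial.C (w j) * if j = l then (Polynomial.X : Polynomial R) else 1))
      = Polynomial.C (∏ j ∈ Finset.univ.erase l, w j) := by
    rw [map_prod]
    refine Finset.prod_congr rfl fun j hj => ?_
    simp [Finset.ne_of_mem_erase hj]
  have hs : (∑ j ∈ Finset.univ.erase l,
      (Polynomial.C (w j) * if j = l then (Polynomial.X : Polynomial R) else 1))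
      = Polynomial.C (∑ j ∈ Finset.univ.erase l, w j) := by
    rw [map_sum]
    refine Finset.sum_congr rfl fun j hj => ?_
    simp [Finset.ne_of_mem_erase hj]
  set f0 := ∏ j, w j with hf0
  have hf0n : f0 ≠ 0 := Finset.prod_ne_zero_iff.2 fun i _ => hw i
  set q0 := ∏ j ∈ Finset.univ.erase l, w j
  have hq0n : q0 ≠ 0 := Finset.prod_ne_zero_iff.2 fun i _ => hw i
  set s0 := ∑ j ∈ Finset.univ.erase l, w j
  set P : Polynomial R := Polynomial.C (q0 * z ^ 2) * Polynomial.X ^ 4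
    + Polynomial.C (w l ^ 2) * Polynomial.X ^ 2 + Polynomial.C (s0 * f0) * Polynomial.X
    + Polynomial.C 1 with hP
  have hPd : P.natDegree = 4 := by
    have := mul_ne_zero hq0n (pow_ne_zero 2 hz)
    rw [hP]; compute_degree!
  have hP0 : P ≠ 0 := by intro h0; rw [h0] at hPd; simp at hPd
  have e : P * b ^ 2 = - (Polynomial.C f0 * Polynomial.X * (a * (a + b))) := by
    simp only [Gexp, Fin.cons_zero, Fin.cons_succ, one_pow, one_mul, hp, hp2, ← Finset.sum_mul, hs]
      at h
    simp at h
    rw [hP]; simp only [map_mul, map_pow, map_one]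
    linear_combination h
  have hd1 : (P * b ^ 2).natDegree = 4 + 2 * b.natDegree := by
    rw [Polynomial.natDegree_mul hP0 (pow_ne_zero 2 hb), hPd, Polynomial.natDegree_pow]
  have hab : a * (a + b) ≠ 0 := by
    intro h0; rw [h0, mul_zero, neg_zero] at e
    exact mul_ne_zero hP0 (pow_ne_zero 2 hb) e
  have hd2 : (P * b ^ 2).natDegree = 1 + (a.natDegree + (a + b).natDegree) := by
    rw [e, Polynomial.natDegree_neg, Polynomial.natDegree_mul _ hab,
      Polynomial.natDegree_mul (left_ne_zero_of_mul hab) (right_ne_zero_of_mul hab),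
      Polynomial.natDegree_C_mul_X _ hf0n]
    exact mul_ne_zero (by simpa using hf0n) Polynomial.X_ne_zero
  rcases lt_or_ge b.natDegree a.natDegree with hlt | hge
  · rw [Polynomial.natDegree_add_eq_left_of_natDegree_lt hlt] at hd2; omega
  · have := Polynomial.natDegree_add_le a b
    rw [max_eq_right hge] at this; omega

theorem no_root {k F ρ : Type*} [Field k] [Field F] [Algebra k F] (N d : ℕ) (l : Fin N)
    (T : Fin N ⊕ Option ρ → F) (hT : AlgebraicIndependent k T) (Y : F)
    (hY : Gexp N d l (Fin.cons 1 (fun i => T (.inl i))) ![1, Y, T (.inr none)] = 0) :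
    Y ∉ IntermediateField.adjoin k (Set.range T) := by
  classical
  intro hmem
  rw [IntermediateField.mem_adjoin_range_iff] at hmem
  obtain ⟨a, b, hb, hab⟩ : ∃ a b : MvPolynomial (Fin N ⊕ Option ρ) k, MvPolynomial.aeval T b ≠ 0 ∧
      Y = MvPolynomial.aeval T a / MvPolynomial.aeval T b := by
    obtain ⟨a, b, hab⟩ := hmem
    by_cases hb : MvPolynomial.aeval T b = 0
    · exact ⟨0, 1, by simp, by simp [hab, hb]⟩
    · exact ⟨a, b, hb, hab⟩
  have := no_root_poly (R := MvPolynomial (Fin N ⊕ Option ρ) k) N d l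
      (fun i => MvPolynomial.X (.inl i)) (fun i => MvPolynomial.X_ne_zero _)
      (MvPolynomial.X (.inr none)) (MvPolynomial.X_ne_zero _)
  let S : MvPolynomial (Fin N ⊕ Option ρ) k →ₐ[k] Polynomial (MvPolynomial (Fin N ⊕ Option ρ) k) :=
      MvPolynomial.aeval (Sum.elim (fun i => Polynomial.C (MvPolynomial.X (.inl i)) *
        if i = l then Polynomial.X else 1) (fun o => Polynomial.C (MvPolynomial.X (.inr o)) *
          if o = none then Polynomial.X ^ 2 else 1))
  have hSinj : Function.Injective S := by
    have : ((Polynomial.aeval (R := MvPolynomial (Fin N ⊕ Option ρ) k) (1 : MvPolynomial (Fin N ⊕ Option ρ) k)).restrictScalars k).comp S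
        = AlgHom.id k _ := by
      apply MvPolynomial.algHom_ext
      rintro (i | o)
      · by_cases hi : i = l <;> simp [S, hi]
      · by_cases hi : o = none <;> simp [S, hi]
    intro x y hxy
    have h2 := congrArg ((Polynomial.aeval (R := MvPolynomial (Fin N ⊕ Option ρ) k) (1 : MvPolynomial (Fin N ⊕ Option ρ) k)).restrictScalars k) hxy
    rw [← AlgHom.comp_apply, ← AlgHom.comp_apply, this] at h2
    simpa using h2
  have h1 : Gexp N d l (Fin.cons 1 (fun i => MvPolynomial.X (.inl i)))
      ![b, a, MvPolynomial.X (.inr none) * b] = 0 := by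
    apply hT
    rw [map_zero]
    have h3 : MvPolynomial.aeval T a = MvPolynomial.aeval T b * Y := by
      rw [hab]; field_simp
    have h4 : (MvPolynomial.aeval T b) ^ 2 * Gexp N d l (Fin.cons 1 (fun i => T (.inl i)))
        ![1, Y, T (.inr none)] = Gexp N d l (Fin.cons 1 (fun i => T (.inl i)))
        ![MvPolynomial.aeval T b, MvPolynomial.aeval T b * Y,
          T (.inr none) * MvPolynomial.aeval T b] := by
      simp only [Gexp, ← Finset.sum_mul, Fin.cons_zero, Fin.cons_succ]
      simp
      ring
    rw [hY, mul_zero] at h4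
    rw [h4]
    refine (Gexp_map (MvPolynomial.aeval (R := k) T).toRingHom N d l _ _).trans ?_
    congr 1
    · funext i; refine Fin.cases ?_ (fun i => ?_) i <;> simp
    · funext i; fin_cases i <;> simp [h3]
  refine this (S a) (S b) ?_ ?_
  · intro h0
    rw [← map_zero S] at h0
    apply hb; rw [hSinj h0, map_zero]
  rw [← map_zero S, ← h1]
  refine ((Gexp_map S.toRingHom N d l _ _).trans ?_).symm
  congr 1
  · funext i; refine Fin.cases ?_ (fun i => ?_) i <;> simp [S]
  · funext i; fin_cases i <;> simp [S]

theorem res_deriv {k F ι : Type*} [Field k] [Field F] [Algebra k F] [CharP F 2]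
    (T : ι → F) (hT : AlgebraicIndependent k T) (Y : F)
    (hgen : ∀ h : F, ∃ α ∈ IntermediateField.adjoin k (Set.range T),
      ∃ β ∈ IntermediateField.adjoin k (Set.range T), h = α + β * Y)
    (c0 c1 c2 : F) (h0 : c0 ∈ IntermediateField.adjoin k (Set.range T))
    (h1 : c1 ∈ IntermediateField.adjoin k (Set.range T))
    (h2 : c2 ∈ IntermediateField.adjoin k (Set.range T)) (hc1 : c1 ≠ 0)
    (hY : c0 + c1 * Y + c2 * Y ^ 2 = 0) (a : ι) [DecidableEq ι] :
    ∃ D : Der F, (∀ c, D (algebraMap k F c) = 0) ∧ ∀ b, D (T b) = if a = b then 1 else 0 := by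
  let P := MvPolynomial ι k
  let L := FractionRing P
  have hinj : Function.Injective (MvPolynomial.aeval (R := k) T).toRingHom := hT
  let φ : L →+* F := IsFractionRing.lift (K := L) hinj
  let _ : Algebra L F := φ.toAlgebra
  have hφ : ∀ p : P, algebraMap L F (algebraMap P L p) = MvPolynomial.aeval T p := fun p =>
    IsFractionRing.lift_algebraMap hinj p
  have hmem : ∀ x ∈ IntermediateField.adjoin k (Set.range T), ∃ t : L, algebraMap L F t = x := by
    intro x hx
    rw [IntermediateField.mem_adjoin_range_iff] at hx
    obtain ⟨p, q, rfl⟩ := hx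
    exact ⟨algebraMap P L p / algebraMap P L q, by rw [map_div₀, hφ, hφ]⟩
  have hsep : IsSeparable L Y := by
    obtain ⟨t0, rfl⟩ := hmem _ h0
    obtain ⟨t1, rfl⟩ := hmem _ h1
    obtain ⟨t2, rfl⟩ := hmem _ h2
    have ht1 : t1 ≠ 0 := by rintro rfl; simp at hc1
    have : CharP L 2 := ((algebraMap L F).charP_iff (algebraMap L F).injective 2).2 inferInstance
    let q : Polynomial L := .C t0 + .C t1 * .X + .C t2 * .X ^ 2
    have hq : q.Separable := by
      have : q.derivative = .C t1 := by
        simp only [q, Polynomial.derivative_add, Polynomial.derivative_C, zero_add,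
          Polynomial.derivative_C_mul, Polynomial.derivative_X, Polynomial.derivative_X_pow]
        have h2 : ((2 : ℕ) : L) = 0 := CharP.cast_eq_zero L 2
        rw [h2]; simp
      refine Polynomial.separable_def _ |>.2 ?_
      rw [this]
      exact isCoprime_one_right.of_isCoprime_of_dvd_right
        ((Polynomial.isUnit_C.2 (isUnit_iff_ne_zero.2 ht1)).dvd)
    refine hq.of_dvd (minpoly.dvd L Y ?_)
    simp only [q, map_add, map_mul, map_pow, Polynomial.aeval_C, Polynomial.aeval_X]
    exact hY
  have htop : IntermediateField.adjoin L {Y} = ⊤ := by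
    rw [eq_top_iff]
    intro h _
    obtain ⟨α, hα, β, hβ, rfl⟩ := hgen h
    obtain ⟨s, rfl⟩ := hmem _ hα
    obtain ⟨t, rfl⟩ := hmem _ hβ
    exact add_mem (algebraMap_mem _ _) (mul_mem (algebraMap_mem _ _)
      (IntermediateField.mem_adjoin_simple_self L Y))
  have : Algebra.IsSeparable L F := by
    have := (IntermediateField.isSeparable_adjoin_simple_iff_isSeparable L F).2 hsep
    rw [htop] at this
    exact Algebra.IsSeparable.of_algHom L (⊤ : IntermediateField L F) IntermediateField.topEquiv.symm.toAlgHom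
  have : Algebra.FormallyEtale L F := Algebra.FormallyEtale.of_isSeparable L F
  have : Algebra.FormallyEtale P L := Algebra.FormallyEtale.of_isLocalization (nonZeroDivisors P)
  obtain ⟨d1, hd1⟩ : ∃ d1 : Der L, ∀ p : P, d1 (algebraMap P L p)
      = algebraMap P L (MvPolynomial.pderiv a p) := by
    obtain ⟨d1, hd1⟩ := ext_deriv (B := L) ((MvPolynomial.pderiv (R := k) a).restrictScalars ℤ)
    exact ⟨d1, fun p => hd1 p⟩
  obtain ⟨d2, hd2⟩ := ext_deriv (B := F) d1
  refine ⟨d2, fun c => ?_, fun b => ?_⟩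
  · have : algebraMap k F c = algebraMap L F (algebraMap P L (MvPolynomial.C c)) := by
      rw [hφ]; simp
    rw [this, hd2, hd1, MvPolynomial.pderiv_C, map_zero, map_zero]
  · have : T b = algebraMap L F (algebraMap P L (MvPolynomial.X b)) := by
      rw [hφ]; simp
    rw [this, hd2, hd1]
    by_cases hab : a = b
    · subst hab; rw [MvPolynomial.pderiv_X_self, map_one, map_one, if_pos rfl]
    · rw [MvPolynomial.pderiv_X_of_ne (Ne.symm hab), map_zero, map_zero, if_neg hab]

end
end ConicBundleFormalization

namespace ConicBundleFormalization
noncomputable section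

open IsLocalRing in
theorem gauss_exists {C K ι : Type*} [Field C] [Field K] [Algebra C K] (O : ValuationSubring C)
    (T : ι → K) (hT : AlgebraicIndependent C T) :
    ∃ (W : ValuationSubring K) (j : O →+* W), (∀ c, (j c : K) = algebraMap C K c) ∧ IsLocalHom j ∧
      (∀ b, T b ∈ W) ∧ (∀ p : MvPolynomial ι O, MvPolynomial.map (residue O) p ≠ 0 →
        W.valuation (MvPolynomial.aeval T (MvPolynomial.map (algebraMap O C) p)) = 1) := by
  let φ : MvPolynomial ι O →+* K :=
    (MvPolynomial.aeval (R := C) T).toRingHom.comp (MvPolynomial.map (algebraMap O C))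
  have hφ : Function.Injective φ :=
    Function.Injective.comp (g := MvPolynomial.aeval (R := C) T) hT
      (MvPolynomial.map_injective (algebraMap O C) Subtype.val_injective)
  let P : Ideal (MvPolynomial ι O) := RingHom.ker (MvPolynomial.map (σ := ι) (residue O))
  have hP : P.IsPrime := RingHom.ker_isPrime _
  let f : Localization.AtPrime P →+* K := IsLocalization.lift (M := P.primeCompl) (g := φ) (by
    intro y
    rw [isUnit_iff_ne_zero]
    intro h
    rw [← map_zero φ] at h
    exact y.2 (by rw [hφ h]; exact zero_mem _))
  have hf : ∀ p, f (algebraMap _ _ p) = φ p := fun p => IsLocalization.lift_eq _ p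
  obtain ⟨W, h, hl⟩ := exists_factor_valuationRing (R := Localization.AtPrime P) (K := K) f
  let F : Localization.AtPrime P →+* W := f.codRestrict W.toSubring h
  have hl : IsLocalHom F := hl
  have hFv : ∀ x, (F x : K) = f x := fun x => rfl
  let j : O →+* W := (F.comp (algebraMap (MvPolynomial ι O) (Localization.AtPrime P))).comp
    MvPolynomial.C
  refine ⟨W, j, fun c => ?_, ?_, fun b => ?_, fun p hp => ?_⟩
  · simp only [j, RingHom.comp_apply, hFv, hf, φ]
    simp
  · refine ⟨fun c hc => ?_⟩
    have h1 := hl.map_nonunit _ hc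
    rw [IsLocalization.AtPrime.isUnit_to_map_iff (Localization.AtPrime P) P] at h1
    by_contra hu
    apply h1
    change MvPolynomial.map _ _ = 0
    rw [MvPolynomial.map_C]
    rw [(residue_eq_zero_iff c).2 ((mem_maximalIdeal c).2 hu), MvPolynomial.C_0]
  · have : T b = F (algebraMap (MvPolynomial ι O) (Localization.AtPrime P) (MvPolynomial.X b)) := by
      rw [hFv, hf]; simp [φ]
    rw [this]; exact (F _).2
  · have : MvPolynomial.aeval T (MvPolynomial.map (algebraMap O C) p) = F (algebraMap (MvPolynomial ι O) (Localization.AtPrime P) p) := by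
      rw [hFv, hf]; rfl
    rw [this]
    rw [← W.valuation_eq_one_iff]
    exact ((IsLocalization.AtPrime.isUnit_to_map_iff (Localization.AtPrime P) P p).2 hp).map F

open IsLocalRing in
theorem norm_poly {C ι : Type*} [Field C] (O : ValuationSubring C) (p : MvPolynomial ι C)
    (hp : p ≠ 0) : ∃ c : C, c ≠ 0 ∧ ∃ q : MvPolynomial ι O, MvPolynomial.map (residue O) q ≠ 0 ∧
      p = MvPolynomial.C c * MvPolynomial.map (algebraMap O C) q := by
  obtain ⟨e, he, hmax⟩ := Finset.exists_max_image p.support (fun e => O.valuation (p.coeff e))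
    (MvPolynomial.support_nonempty.2 hp)
  have hc : p.coeff e ≠ 0 := MvPolynomial.mem_support_iff.1 he
  have hv : O.valuation (p.coeff e) ≠ 0 := by simpa using hc
  obtain ⟨q, hq⟩ : MvPolynomial.C (p.coeff e)⁻¹ * p ∈ (MvPolynomial.map (algebraMap O C)).range := by
    rw [RingHom.mem_range]
    have hmem : ∀ m, (p.coeff e)⁻¹ * p.coeff m ∈ O := by
      intro m
      rw [← O.valuation_le_one_iff, map_mul, map_inv₀]
      by_cases hm : m ∈ p.support
      · rw [inv_mul_le_one₀ (zero_lt_iff.2 hv)]; exact hmax m hm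
      · rw [MvPolynomial.notMem_support_iff.1 hm]; simp
    refine ⟨∑ m ∈ p.support, MvPolynomial.monomial m ⟨_, hmem m⟩, ?_⟩
    rw [map_sum]
    refine Eq.trans ?_ (congrArg (MvPolynomial.C (p.coeff e)⁻¹ * ·) p.as_sum.symm)
    simp only [Finset.mul_sum]
    refine Finset.sum_congr rfl fun m _ => ?_
    rw [MvPolynomial.map_monomial, MvPolynomial.C_mul_monomial]; rfl
  refine ⟨p.coeff e, hc, q, ?_, ?_⟩
  · intro h0
    have h1 := congrArg (MvPolynomial.coeff e) h0
    rw [MvPolynomial.coeff_map, MvPolynomial.coeff_zero] at h1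
    have h2 : q.coeff e = 1 := by
      apply Subtype.val_injective
      have := congrArg (MvPolynomial.coeff e) hq
      rw [MvPolynomial.coeff_map, MvPolynomial.coeff_C_mul, inv_mul_cancel₀ hc] at this
      exact this
    rw [h2, map_one] at h1
    exact one_ne_zero h1
  · change MvPolynomial.map _ q = _ at hq
    rw [hq, ← mul_assoc, ← MvPolynomial.C_mul, mul_inv_cancel₀ hc, MvPolynomial.C_1, one_mul]

theorem natDegree_eval₂_le {R σ A : Type*} [CommRing R] [CommRing A] (f : R →+* A)
    (s : σ → Polynomial A) (i0 : σ) (hs : ∀ i, i ≠ i0 → (s i).natDegree = 0)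
    (hs0 : (s i0).natDegree ≤ 1) (m : ℕ) (p : MvPolynomial σ R) (hp : ∀ e ∈ p.support, e i0 ≤ m) :
    (MvPolynomial.eval₂ (Polynomial.C.comp f) s p).natDegree ≤ m := by
  classical
  rw [MvPolynomial.eval₂_eq]
  refine Polynomial.natDegree_sum_le_of_forall_le _ _ fun e he => ?_
  refine (Polynomial.natDegree_mul_le).trans ?_
  rw [RingHom.comp_apply, Polynomial.natDegree_C, zero_add]
  refine (Polynomial.natDegree_prod_le _ _).trans ?_
  refine le_trans (Finset.sum_le_sum (g := fun i => if i = i0 then e i0 else 0) fun i _ => ?_) ?_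
  · by_cases h : i = i0
    · subst h
      simp only [if_true]
      exact (Polynomial.natDegree_pow_le).trans (by nlinarith)
    · rw [if_neg h]
      exact (Polynomial.natDegree_pow_le).trans (by rw [hs i h, mul_zero])
  · rw [Finset.sum_ite_eq']
    split_ifs
    · exact hp e he
    · exact Nat.zero_le _

end
end ConicBundleFormalization

namespace ConicBundleFormalization
noncomputable section

section gs
open IsLocalRing

variable {C K ι : Type*} [Field C] [Field K] [Algebra C K] (O : ValuationSubring C)
  (W : ValuationSubring K) (j : O →+* W) [IsLocalHom j]
  (T : ι → K)

theorem rs_psi (hj : ∀ c, (j c : K) = algebraMap C K c) (hTW : ∀ b, T b ∈ W)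
    (p : MvPolynomial ι O) :
    MvPolynomial.aeval T (MvPolynomial.map (algebraMap O C) p) ∈ W ∧
    rs W (MvPolynomial.aeval T (MvPolynomial.map (algebraMap O C) p)) =
      MvPolynomial.eval₂ (ResidueField.map j) (fun b => rs W (T b))
        (MvPolynomial.map (residue O) p) := by
  have h1 : MvPolynomial.aeval T (MvPolynomial.map (algebraMap O C) p)
      = ((MvPolynomial.eval₂ j (fun b => (⟨T b, hTW b⟩ : W)) p : W) : K) := by
    change _ = algebraMap W K _
    rw [MvPolynomial.aeval_def, MvPolynomial.eval₂_map]
    rw [MvPolynomial.eval₂_comp_left (algebraMap W K)]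
    congr 1
    ext c; exact (hj c).symm
  rw [h1]
  refine ⟨Subtype.property _, ?_⟩
  rw [rs_coe, MvPolynomial.eval₂_map]
  have := MvPolynomial.eval₂_comp_left (residue W) j (fun b => (⟨T b, hTW b⟩ : W)) p
  rw [this]
  congr 1
  funext b; rw [rs_of_mem W (hTW b)]; rfl

theorem val_alg (hj : ∀ c, (j c : K) = algebraMap C K c) (c : C) :
    W.valuation (algebraMap C K c) ≤ 1 → c ∈ O := by
  intro h
  rcases O.mem_or_inv_mem c with h1 | h1
  · exact h1
  by_cases hc : c = 0
  · rw [hc]; exact O.zero_mem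
  have hm : algebraMap C K c ∈ W := (W.valuation_le_one_iff _).1 h
  have hu : IsUnit (j ⟨c⁻¹, h1⟩) := by
    refine IsUnit.of_mul_eq_one (⟨_, hm⟩ : W) (Subtype.val_injective ?_)
    change (j _ : K) * algebraMap C K c = 1
    rw [hj]
    change algebraMap C K c⁻¹ * algebraMap C K c = 1
    rw [← map_mul, inv_mul_cancel₀ hc, map_one]
  have hu2 := (isUnit_map_iff j _).1 hu
  obtain ⟨⟨b, hb⟩, hb1⟩ := hu2.exists_right_inv
  have : c⁻¹ * b = 1 := congrArg Subtype.val hb1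
  have hbc : b = c := by field_simp at this; exact this
  rw [← hbc]; exact hb

theorem adj_form (hT : AlgebraicIndependent C T)
    (x : K) (hx : x ∈ IntermediateField.adjoin C (Set.range T)) (hx0 : x ≠ 0) :
    ∃ c : C, c ≠ 0 ∧ ∃ p q : MvPolynomial ι O, MvPolynomial.map (residue O) p ≠ 0 ∧
      MvPolynomial.map (residue O) q ≠ 0 ∧
      x = algebraMap C K c * MvPolynomial.aeval T (MvPolynomial.map (algebraMap O C) p)
        / MvPolynomial.aeval T (MvPolynomial.map (algebraMap O C) q) := by
  rw [IntermediateField.mem_adjoin_range_iff] at hx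
  obtain ⟨a, b, rfl⟩ := hx
  have ha : a ≠ 0 := by rintro rfl; simp at hx0
  have hb : b ≠ 0 := by rintro rfl; simp at hx0
  obtain ⟨c, hc, p, hp, rfl⟩ := norm_poly O a ha
  obtain ⟨c', hc', q, hq, rfl⟩ := norm_poly O b hb
  refine ⟨c / c', div_ne_zero hc hc', p, q, hp, hq, ?_⟩
  rw [map_mul, map_mul, MvPolynomial.aeval_C, MvPolynomial.aeval_C, map_div₀]
  have : algebraMap C K c' ≠ 0 := by simpa using hc'
  rw [mul_div_mul_comm, div_mul_eq_mul_div, div_mul_eq_mul_div, mul_div_assoc, mul_div_assoc]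
  rw [mul_div_assoc, div_right_comm]

theorem adj_val (hT : AlgebraicIndependent C T)
    (hv : ∀ p : MvPolynomial ι O, MvPolynomial.map (residue O) p ≠ 0 →
        W.valuation (MvPolynomial.aeval T (MvPolynomial.map (algebraMap O C) p)) = 1)
    (x : K) (hx : x ∈ IntermediateField.adjoin C (Set.range T)) (hx0 : x ≠ 0) :
    ∃ c : C, c ≠ 0 ∧ W.valuation x = W.valuation (algebraMap C K c) := by
  obtain ⟨c, hc, p, q, hp, hq, rfl⟩ := adj_form O T hT x hx hx0
  refine ⟨c, hc, ?_⟩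
  rw [map_div₀, map_mul, hv p hp, hv q hq, div_one, mul_one]

theorem adj_res (hT : AlgebraicIndependent C T) [Algebra (ResidueField O) (ResidueField W)]
    (halg : algebraMap (ResidueField O) (ResidueField W) = ResidueField.map j)
    (hj : ∀ c, (j c : K) = algebraMap C K c) (hTW : ∀ b, T b ∈ W)
    (hv : ∀ p : MvPolynomial ι O, MvPolynomial.map (residue O) p ≠ 0 →
        W.valuation (MvPolynomial.aeval T (MvPolynomial.map (algebraMap O C) p)) = 1)
    (x : K) (hx : x ∈ IntermediateField.adjoin C (Set.range T)) (hx1 : W.valuation x ≤ 1) :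
    rs W x ∈ IntermediateField.adjoin (ResidueField O) (Set.range fun b => rs W (T b)) := by
  by_cases hx0 : x = 0
  · rw [hx0, (rs_eq_zero W (by simp)).2 (by simp)]; exact zero_mem _
  obtain ⟨c, hc, p, q, hp, hq, rfl⟩ := adj_form O T hT x hx hx0
  have hvc : W.valuation (algebraMap C K c) ≤ 1 := by
    rwa [map_div₀, map_mul, hv p hp, hv q hq, div_one, mul_one] at hx1
  have hcO := val_alg O W j hj c hvc
  set P := MvPolynomial.aeval T (MvPolynomial.map (algebraMap O C) p) with hP
  set Q := MvPolynomial.aeval T (MvPolynomial.map (algebraMap O C) q) with hQ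
  have hQ0 : Q ≠ 0 := by intro h; have := hv q hq; rw [← hQ, h] at this; simp at this
  have hrP := (rs_psi O W j T hj hTW p).2
  have hrQ := (rs_psi O W j T hj hTW q).2
  have hrQ0 : rs W Q ≠ 0 := by
    rw [Ne, rs_eq_zero W (hv q hq).le, hv q hq]; exact lt_irrefl _
  have h1 : rs W (algebraMap C K c * P / Q) * rs W Q = rs W (algebraMap C K c) * rs W P := by
    rw [← rs_mul W hx1 (hv q hq).le, ← rs_mul W hvc (hv p hp).le]
    congr 1; exact div_mul_cancel₀ _ hQ0
  have h2 : rs W (algebraMap C K c * P / Q) = rs W (algebraMap C K c) * rs W P / rs W Q := by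
    exact (div_eq_iff hrQ0).2 h1.symm |>.symm
  have h3 : rs W (algebraMap C K c) = algebraMap (ResidueField O) (ResidueField W)
      (residue O ⟨c, hcO⟩) := by
    have := hj ⟨c, hcO⟩
    rw [halg, ResidueField.map_residue, ← rs_coe, this]
  rw [h2]
  have key : ∀ r : MvPolynomial ι (ResidueField O),
      MvPolynomial.eval₂ (ResidueField.map j) (fun b => rs W (T b)) r ∈
      IntermediateField.adjoin (ResidueField O) (Set.range fun b => rs W (T b)) := by
    intro r
    rw [← halg, ← MvPolynomial.aeval_def]
    rw [IntermediateField.mem_adjoin_range_iff]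
    exact ⟨r, 1, by simp⟩
  refine div_mem (mul_mem ?_ ?_) ?_
  · rw [h3]; exact IntermediateField.algebraMap_mem _ _
  · rw [hrP]; exact key _
  · rw [hrQ]; exact key _

theorem res_indep [Algebra (ResidueField O) (ResidueField W)]
    (halg : algebraMap (ResidueField O) (ResidueField W) = ResidueField.map j)
    (hj : ∀ c, (j c : K) = algebraMap C K c) (hTW : ∀ b, T b ∈ W)
    (hv : ∀ p : MvPolynomial ι O, MvPolynomial.map (residue O) p ≠ 0 →
        W.valuation (MvPolynomial.aeval T (MvPolynomial.map (algebraMap O C) p)) = 1) :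
    AlgebraicIndependent (ResidueField O) (fun b => rs W (T b)) := by
  rw [algebraicIndependent_iff]
  intro r hr
  obtain ⟨p, rfl⟩ := MvPolynomial.map_surjective (residue O) residue_surjective r
  rw [MvPolynomial.aeval_def, halg, ← (rs_psi O W j T hj hTW p).2] at hr
  by_contra hne
  have := hv p hne
  rw [rs_eq_zero W this.le, this] at hr
  exact lt_irrefl _ hr

end gs

end
end ConicBundleFormalization

namespace ConicBundleFormalization
noncomputable section

section gs
open IsLocalRing

variable {C K : Type*} [Field C] [Field K] [Algebra C K] (O : ValuationSubring C)
  (W : ValuationSubring K) (j : O →+* W) [IsLocalHom j]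

/-- reduction of a point of `g = 0` with coordinates in `W` -/
theorem red_pt (hj : ∀ c, (j c : K) = algebraMap C K c) (N d : ℕ) (l : Fin N)
    (gO : MvPolynomial (Fin (N + 1) ⊕ Fin 3) O)
    (hgO : MvPolynomial.map (residue O) gO = Gpoly _ N d l)
    (u : Fin (N + 1) → K) (x : Fin 3 → K) (hu : ∀ i, u i ∈ W) (hx : ∀ i, x i ∈ W)
    (h : MvPolynomial.aeval (Sum.elim u x) (MvPolynomial.map (algebraMap O C) gO) = 0) :
    Gexp N d l (fun i => rs W (u i)) (fun i => rs W (x i)) = 0 := by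
  have h1 := (rs_psi O W j (Sum.elim u x) hj (by rintro (i | i); exacts [hu i, hx i]) gO).2
  rw [h, (rs_eq_zero W (by simp)).2 (by simp), hgO] at h1
  let _ : Algebra (ResidueField O) (ResidueField W) := (ResidueField.map j).toAlgebra
  rw [← aeval_Gpoly (F := ResidueField O), h1, MvPolynomial.aeval_def]
  congr 1
  funext b; rcases b with b | b <;> rfl

theorem quad_exists (hj : ∀ c, (j c : K) = algebraMap C K c) (N d : ℕ) (l : Fin N)
    (gO : MvPolynomial (Fin (N + 1) ⊕ Fin 3) O)
    (hgO : MvPolynomial.map (residue O) gO = Gpoly _ N d l)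
    (hdeg : ∀ e ∈ gO.support, e (.inr 1) ≤ 2)
    (L : IntermediateField C K)
    (u : Fin (N + 1) → K) (Y z : K) (hu : ∀ i, u i ∈ W) (hz : z ∈ W)
    (huL : ∀ i, u i ∈ L) (hzL : z ∈ L)
    (hu0 : ∀ i, rs W (u i) ≠ 0)
    (h : MvPolynomial.aeval (Sum.elim u ![1, Y, z]) (MvPolynomial.map (algebraMap O C) gO) = 0) :
    ∃ Q : Polynomial L, Q.natDegree = 2 ∧ Polynomial.aeval Y Q = 0 := by
  let sW : Fin (N + 1) ⊕ Fin 3 → Polynomial W := Sum.elim (fun i => .C ⟨u i, hu i⟩)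
    ![1, .X, .C ⟨z, hz⟩]
  let sL : Fin (N + 1) ⊕ Fin 3 → Polynomial L := Sum.elim (fun i => .C ⟨u i, huL i⟩)
    ![1, .X, .C ⟨z, hzL⟩]
  let jL : O →+* L := (algebraMap C L).comp (algebraMap O C)
  let QW := MvPolynomial.eval₂ (Polynomial.C.comp j) sW gO
  let QL := MvPolynomial.eval₂ (Polynomial.C.comp jL) sL gO
  have hmap : QW.map (algebraMap W K) = QL.map (algebraMap L K) := by
    simp only [QW, QL]
    rw [← Polynomial.coe_mapRingHom, ← Polynomial.coe_mapRingHom,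
      MvPolynomial.eval₂_comp_left (Polynomial.mapRingHom (algebraMap W K)),
      MvPolynomial.eval₂_comp_left (Polynomial.mapRingHom (algebraMap L K))]
    congr 1
    · ext c : 1
      simp only [RingHom.comp_apply, Polynomial.coe_mapRingHom, Polynomial.map_C]
      congr 1
      exact hj c
    · funext b
      rcases b with b | b
      · simp only [Function.comp, sW, sL, Sum.elim_inl, Polynomial.coe_mapRingHom, Polynomial.map_C]
        rfl
      · fin_cases b <;> simp [sW, sL] <;> rfl
  have hres : QW.map (residue W) = Gexp N d l (fun i => Polynomial.C (rs W (u i)))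
      ![1, .X, .C (rs W z)] := by
    let _ : Algebra (ResidueField O) (ResidueField W) := (ResidueField.map j).toAlgebra
    rw [← aeval_Gpoly (F := ResidueField O), ← hgO, MvPolynomial.aeval_def, MvPolynomial.eval₂_map]
    simp only [QW]
    rw [← Polynomial.coe_mapRingHom,
      MvPolynomial.eval₂_comp_left (Polynomial.mapRingHom (residue W))]
    congr 1
    · ext c : 1
      simp only [RingHom.comp_apply, Polynomial.coe_mapRingHom, Polynomial.map_C]
      rfl
    · funext b
      rcases b with b | b
      · simp only [Function.comp, sW, Sum.elim_inl, Polynomial.coe_mapRingHom, Polynomial.map_C]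
        rw [rs_of_mem W (hu b)]
      · fin_cases b <;> simp [sW, rs_of_mem W hz]
  have hdegL : QL.natDegree ≤ 2 := by
    refine natDegree_eval₂_le jL sL (.inr 1) ?_ ?_ 2 gO hdeg
    · rintro (b | b) hb
      · simp [sL]
      · fin_cases b
        · simp [sL]
        · simp at hb
        · simp [sL]
    · simp only [sL, Sum.elim_inr]
      exact Polynomial.natDegree_X_le
  have hc2 : (QW.map (residue W)).coeff 2 ≠ 0 := by
    rw [hres]
    have : Gexp N d l (fun i => Polynomial.C (rs W (u i))) ![1, .X, .C (rs W z)]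
      = Polynomial.C (rs W (u 0) ^ (d - N) * ∏ j : Fin N, rs W (u j.succ))
          * (Polynomial.X ^ 2 + Polynomial.X)
        + Polynomial.C (Gexp N d l (fun i => rs W (u i)) ![1, 0, rs W z]) := by
      simp only [Gexp, map_add, map_mul, map_pow, map_prod, map_sum]
      simp
      ring
    rw [this]
    rw [Polynomial.coeff_add, Polynomial.coeff_C_mul, Polynomial.coeff_C]
    simp [Polynomial.coeff_X, hu0, Finset.prod_eq_zero_iff]
  refine ⟨QL, le_antisymm hdegL (Polynomial.le_natDegree_of_ne_zero ?_), ?_⟩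
  · intro h0
    apply hc2
    have h1 := congrArg (fun q => Polynomial.coeff q 2) hmap
    simp only [Polynomial.coeff_map, h0, map_zero] at h1
    have h2 : QW.coeff 2 = 0 := Subtype.val_injective h1
    rw [Polynomial.coeff_map, h2, map_zero]
  · rw [← h]
    simp only [QL]
    rw [Polynomial.aeval_def, ← Polynomial.coe_eval₂RingHom,
      MvPolynomial.eval₂_comp_left (Polynomial.eval₂RingHom (algebraMap L K) Y),
      MvPolynomial.aeval_def, MvPolynomial.eval₂_map]
    congr 1
    · ext c : 1
      simp only [RingHom.comp_apply, Polynomial.coe_eval₂RingHom, Polynomial.eval₂_C]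
      rfl
    · funext b
      rcases b with b | b
      · simp [sL]
      · fin_cases b <;> simp [sL]

theorem lin_form {L : Type*} [Field L] [Algebra L K] (Y : K) (Q : Polynomial L)
    (hQ : Q.natDegree = 2) (hY : Polynomial.aeval Y Q = 0)
    (htop : IntermediateField.adjoin L {Y} = ⊤) (h : K) :
    ∃ α β : L, h = algebraMap L K α + algebraMap L K β * Y := by
  have hQ0 : Q ≠ 0 := by rintro rfl; simp at hQ
  have hint : IsAlgebraic L Y := ⟨Q, hQ0, hY⟩
  have hmem : h ∈ IntermediateField.adjoin L {Y} := by rw [htop]; trivial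
  rw [← IntermediateField.mem_toSubalgebra,
    IntermediateField.adjoin_simple_toSubalgebra_of_isAlgebraic hint,
    Algebra.adjoin_singleton_eq_range_aeval] at hmem
  obtain ⟨q, hq⟩ := hmem
  change Polynomial.aeval Y q = h at hq
  have hr : (q % Q).natDegree ≤ 1 := by
    have := Polynomial.natDegree_mod_lt q (q := Q) (by omega)
    omega
  refine ⟨(q % Q).coeff 0, (q % Q).coeff 1, ?_⟩
  have h2 := EuclideanDomain.div_add_mod q Q
  have h3 := congrArg (Polynomial.aeval Y) h2
  rw [map_add, map_mul, hY, zero_mul, zero_add, hq] at h3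
  rw [← h3]
  conv_lhs => rw [Polynomial.eq_X_add_C_of_natDegree_le_one hr]
  simp [add_comm]

end gs

end
end ConicBundleFormalization

namespace ConicBundleFormalization
noncomputable section

open IsLocalRing in
theorem P4_main {C K ρ : Type*} [Field C] [Field K] [Algebra C K] (O : ValuationSubring C)
    (h2 : O.valuation 2 < 1) (N d : ℕ) (l : Fin N)
    (gO : MvPolynomial (Fin (N + 1) ⊕ Fin 3) O)
    (hgO : MvPolynomial.map (residue O) gO = Gpoly _ N d l)
    (hdeg : ∀ e ∈ gO.support, e (.inr 1) ≤ 2)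
    (T : Fin N ⊕ Option ρ → K) (hT : AlgebraicIndependent C T) (Y : K)
    (hgen : IntermediateField.adjoin C (Set.range T ∪ {Y}) = ⊤)
    (hscale : ∀ (τ : K) (u : Fin (N + 1) → K) (x : Fin 3 → K),
      MvPolynomial.aeval (Sum.elim u x) (MvPolynomial.map (algebraMap O C) gO) = 0 →
      MvPolynomial.aeval (Sum.elim u (fun i => τ * x i)) (MvPolynomial.map (algebraMap O C) gO) = 0)
    (hY : MvPolynomial.aeval (Sum.elim (Fin.cons 1 (fun i => T (.inl i))) ![1, Y, T (.inr none)])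
      (MvPolynomial.map (algebraMap O C) gO) = 0) :
    ∃ (W : ValuationSubring K) (j : O →+* W), (∀ c, (j c : K) = algebraMap C K c) ∧ IsLocalHom j ∧
      CharP (ResidueField W) 2 ∧ (∀ b, T b ∈ W) ∧
      MvPolynomial.map (residue W) (MvPolynomial.map j gO) = Gpoly _ N d l ∧
      (∀ h : K, h ≠ 0 → ∃ a : C, a ≠ 0 ∧ W.valuation h = W.valuation (algebraMap C K a)) ∧
      ∃ D : Fin N → Der (ResidueField W), (∀ a (c : O), D a (rs W (algebraMap C K c)) = 0) ∧
        (∀ a b, D a (rs W (T (.inl b))) = if a = b then 1 else 0) ∧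
        ∀ b, rs W (T (.inl b)) ≠ 0 := by
  classical
  obtain ⟨W, j, hj, hloc, hTW, hv⟩ := gauss_exists O T hT
  let _ : Algebra (ResidueField O) (ResidueField W) := (ResidueField.map j).toAlgebra
  have halg : algebraMap (ResidueField O) (ResidueField W) = ResidueField.map j := rfl
  have hind := res_indep O W j T halg hj hTW hv
  have hTne : ∀ b, rs W (T b) ≠ 0 := fun b => hind.ne_zero b
  have hT1 : ∀ b, W.valuation (T b) ≤ 1 := fun b => (W.valuation_le_one_iff _).2 (hTW b)
  have hchar : CharP (ResidueField W) 2 := by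
    rw [CharP.charP_iff_prime_eq_zero Nat.prime_two]
    have h2O : (2 : C) ∈ O := (O.valuation_le_one_iff _).1 h2.le
    have h3 : residue O (2 : O) = 0 := by
      rw [residue_eq_zero_iff]
      exact (O.valuation_lt_one_iff (2 : O)).2 h2
    have h4 := congrArg (ResidueField.map j) h3
    rw [map_zero, map_ofNat, map_ofNat] at h4
    exact_mod_cast h4
  have hgW : MvPolynomial.map (residue W) (MvPolynomial.map j gO) = Gpoly _ N d l := by
    rw [MvPolynomial.map_map, ← Gpoly_map (ResidueField.map j), ← hgO, MvPolynomial.map_map]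
    rfl
  have hUW : ∀ i, (Fin.cons 1 (fun i => T (.inl i)) : Fin (N + 1) → K) i ∈ W := by
    intro i; refine Fin.cases ?_ (fun i => ?_) i
    · exact W.one_mem
    · exact hTW _
  have hrs1 : rs W (1 : K) = 1 := by rw [rs_of_mem W W.one_mem]; exact map_one (residue W)
  have hrs0 : rs W (0 : K) = 0 := (rs_eq_zero W (by simp)).2 (by simp)
  have hUr : (fun i => rs W ((Fin.cons 1 (fun i => T (.inl i)) : Fin (N + 1) → K) i))
      = Fin.cons 1 (fun i => rs W (T (.inl i))) := by
    funext i; refine Fin.cases ?_ (fun i => ?_) i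
    · simpa using hrs1
    · simp
  have hYW : Y ∈ W := by
    by_contra hYn
    have hY0 : Y ≠ 0 := by rintro rfl; exact hYn W.zero_mem
    have hYi : Y⁻¹ ∈ W := (W.mem_or_inv_mem Y).resolve_left hYn
    have hlt : W.valuation Y⁻¹ < 1 := by
      rw [map_inv₀]
      have : 1 < W.valuation Y := not_le.1 fun h => hYn ((W.valuation_le_one_iff _).1 h)
      exact inv_lt_one_of_one_lt₀ this
    have hr : rs W Y⁻¹ = 0 := (rs_eq_zero W hlt.le).2 hlt
    have h1 := hscale Y⁻¹ _ _ hY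
    have h3 := red_pt O W j hj N d l gO hgO _ _ hUW (by
      intro i; fin_cases i
      · simpa using hYi
      · simpa [hY0] using W.one_mem
      · exact mul_mem hYi (hTW _)) h1
    rw [hUr] at h3
    have h4 : (fun i => rs W (Y⁻¹ * (![1, Y, T (.inr none)] : Fin 3 → K) i)) = ![0, 1, 0] := by
      funext i; fin_cases i
      · simpa using hr
      · simpa [hY0] using hrs1
      · change rs W (Y⁻¹ * T (.inr none)) = 0
        rw [rs_mul W hlt.le (hT1 _), hr, zero_mul]
    rw [h4] at h3
    simp [Gexp, Finset.prod_eq_zero_iff, hTne] at h3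
  have hYv : W.valuation Y ≤ 1 := (W.valuation_le_one_iff _).2 hYW
  have hYr : Gexp N d l (Fin.cons 1 (fun i => rs W (T (.inl i))))
      ![1, rs W Y, rs W (T (.inr none))] = 0 := by
    have h3 := red_pt O W j hj N d l gO hgO _ _ hUW (by
      intro i; fin_cases i
      · exact W.one_mem
      · exact hYW
      · exact hTW _) hY
    rw [hUr] at h3
    rw [← h3]
    congr 1
    funext i; fin_cases i
    · exact hrs1.symm
    · rfl
    · rfl
  have hYnot := no_root N d l (fun b => rs W (T b)) hind (rs W Y) hYr
  set L := IntermediateField.adjoin C (Set.range T) with hL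
  have hTL : ∀ b, T b ∈ L := fun b => IntermediateField.subset_adjoin _ _ ⟨b, rfl⟩
  obtain ⟨Q, hQ, hQY⟩ := quad_exists O W j hj N d l gO hgO hdeg L _ Y _ hUW (hTW (.inr none))
    (by
      intro i; refine Fin.cases ?_ (fun i => ?_) i
      · exact one_mem _
      · exact hTL _) (hTL _)
    (by
      intro i; refine Fin.cases ?_ (fun i => ?_) i
      · simp [hrs1]
      · simpa using hTne _) hY
  have htop : IntermediateField.adjoin L {Y} = ⊤ := by
    have h1 := IntermediateField.adjoin_adjoin_left C (Set.range T) {Y}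
    rw [hgen] at h1
    apply IntermediateField.restrictScalars_injective C
    rw [h1]; rfl
  have hlin := lin_form Y Q hQ hQY htop
  have hYv1 : W.valuation Y = 1 := by
    refine le_antisymm hYv (not_lt.1 fun h => hYnot ?_)
    rw [(rs_eq_zero W hYv).2 h]; exact zero_mem _
  have hmax : ∀ α ∈ L, ∀ β ∈ L, W.valuation (α + β * Y) = max (W.valuation α) (W.valuation β) := by
    intro α hα β hβ
    have hb : W.valuation (β * Y) = W.valuation β := by rw [map_mul, hYv1, mul_one]
    rcases lt_trichotomy (W.valuation α) (W.valuation β) with h | h | h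
    · rw [Valuation.map_add_eq_of_lt_right _ (by rwa [hb]), hb, max_eq_right h.le]
    · by_cases hβ0 : β = 0
      · subst hβ0; simp
      have hvβ : W.valuation β ≠ 0 := by simpa using hβ0
      have e : α + β * Y = β * (α / β + Y) := by field_simp
      have hq : W.valuation (α / β) = 1 := by rw [map_div₀, h, div_self hvβ]
      have hs : W.valuation (α / β + Y) ≤ 1 := by
        refine (Valuation.map_add _ _ _).trans ?_
        rw [hq, hYv1, max_self]
      have h1 : W.valuation (α / β + Y) = 1 := by
        refine le_antisymm hs (not_lt.1 fun hlt => hYnot ?_)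
        have h0 := (rs_eq_zero W hs).2 hlt
        have hqm := (W.valuation_le_one_iff _).1 hq.le
        have hadd : rs W (α / β + Y) = rs W (α / β) + rs W Y := by
          rw [rs_of_mem W hqm, rs_of_mem W hYW, rs_of_mem W (add_mem hqm hYW), ← map_add]; rfl
        rw [hadd] at h0
        rw [← neg_eq_of_add_eq_zero_right h0]
        exact neg_mem (adj_res O W j T hT halg hj hTW hv _ (div_mem hα hβ) hq.le)
      rw [e, map_mul, h1, mul_one, h, max_self]
    · rw [Valuation.map_add_eq_of_lt_left _ (by rwa [hb]), max_eq_left h.le]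
  have hres : ∀ h : ResidueField W,
      ∃ α ∈ IntermediateField.adjoin (ResidueField O) (Set.range fun b => rs W (T b)),
      ∃ β ∈ IntermediateField.adjoin (ResidueField O) (Set.range fun b => rs W (T b)),
        h = α + β * rs W Y := by
    intro h
    obtain ⟨⟨h, hhW⟩, rfl⟩ := residue_surjective h
    obtain ⟨⟨α, hα⟩, ⟨β, hβ⟩, hh⟩ := hlin h
    change h = α + β * Y at hh
    have h1 := (W.valuation_le_one_iff _).2 hhW
    rw [hh, hmax α hα β hβ, max_le_iff] at h1
    refine ⟨_, adj_res O W j T hT halg hj hTW hv α hα h1.1, _,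
      adj_res O W j T hT halg hj hTW hv β hβ h1.2, ?_⟩
    have hαW := (W.valuation_le_one_iff _).1 h1.1
    have hβW := (W.valuation_le_one_iff _).1 h1.2
    rw [rs_of_mem W hαW, rs_of_mem W hβW, rs_of_mem W hYW, ← map_mul, ← map_add]
    congr 1
    exact Subtype.ext hh
  refine ⟨W, j, hj, hloc, hchar, hTW, hgW, ?_, ?_⟩
  · intro h hne
    obtain ⟨⟨α, hα⟩, ⟨β, hβ⟩, hh⟩ := hlin h
    change h = α + β * Y at hh
    have h1 := hmax α hα β hβ
    rw [← hh] at h1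
    have h0 : W.valuation h ≠ 0 := by simpa using hne
    rcases max_choice (W.valuation α) (W.valuation β) with h3 | h3
    · rw [h3] at h1
      rw [h1] at h0 ⊢
      exact adj_val O W T hT hv α hα (by simpa using h0)
    · rw [h3] at h1
      rw [h1] at h0 ⊢
      exact adj_val O W T hT hv β hβ (by simpa using h0)
  · set κ := IntermediateField.adjoin (ResidueField O) (Set.range fun b => rs W (T b)) with hκ
    have hTκ : ∀ b, rs W (T b) ∈ κ := fun b => IntermediateField.subset_adjoin _ _ ⟨b, rfl⟩
    have hfκ : ∏ i : Fin N, rs W (T (.inl i)) ∈ κ := prod_mem fun i _ => hTκ _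
    have hc0 : Gexp N d l (Fin.cons 1 (fun i => rs W (T (.inl i))))
      ![1, 0, rs W (T (.inr none))] ∈ κ := by
      have h1 := Gexp_map (algebraMap κ (ResidueField W)) N d l
        (Fin.cons 1 (fun i => (⟨rs W (T (.inl i)), hTκ _⟩ : κ))) ![1, 0, ⟨_, hTκ (.inr none)⟩]
      have h3 : Gexp N d l (Fin.cons 1 (fun i => rs W (T (.inl i)))) ![1, 0, rs W (T (.inr none))]
        = algebraMap κ (ResidueField W) (Gexp N d l
        (Fin.cons 1 (fun i => (⟨rs W (T (.inl i)), hTκ _⟩ : κ))) ![1, 0, ⟨_, hTκ (.inr none)⟩]) := by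
        rw [h1]
        congr 1
        · funext i; refine Fin.cases ?_ (fun i => ?_) i
          · simp
          · simp
        · funext i; fin_cases i
          · simp
          · simp
          · rfl
      rw [h3]; exact Subtype.property _
    have hex := fun a => res_deriv (fun b => rs W (T b)) hind (rs W Y) hres _ _ _ hc0 hfκ hfκ
      (Finset.prod_ne_zero_iff.2 fun i _ => hTne _) (by
        refine Eq.trans ?_ hYr
        simp only [Gexp]
        simp
        ring) a
    choose D hD1 hD2 using hex
    refine ⟨fun a => D (.inl a), fun a c => ?_, fun a b => ?_, fun b => hTne _⟩
    · have := hD1 (.inl a) (residue O c)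
      rwa [halg, ResidueField.map_residue, ← rs_coe, hj] at this
    · have := hD2 (.inl a) (.inl b)
      simpa using this

end
end ConicBundleFormalization

namespace ConicBundleFormalization
noncomputable section

theorem aeval_scale {C B : Type*} [CommRing C] [CommRing B] [Algebra C B] (n d m : ℕ)
    (g : MvPolynomial (Fin n ⊕ Fin 3) C)
    (hbi : ∀ e ∈ g.support, ∑ i, e (.inl i) = d ∧ ∑ j, e (.inr j) = m)
    (σ τ : B) (u : Fin n → B) (x : Fin 3 → B) :
    MvPolynomial.aeval (Sum.elim (fun i => σ * u i) (fun i => τ * x i)) g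
      = σ ^ d * τ ^ m * MvPolynomial.aeval (Sum.elim u x) g := by
  rw [MvPolynomial.aeval_def, MvPolynomial.aeval_def, MvPolynomial.eval₂_eq',
    MvPolynomial.eval₂_eq', Finset.mul_sum]
  refine Finset.sum_congr rfl fun e he => ?_
  obtain ⟨h1, h2⟩ := hbi e he
  simp only [Fintype.prod_sum_type, Sum.elim_inl, Sum.elim_inr, mul_pow, Finset.prod_mul_distrib,
    Finset.prod_pow_eq_pow_sum, h1, h2]
  ring

open IsLocalRing in
theorem HR_const {C K : Type*} [Field C] [Field K] [Algebra C K] (O : ValuationSubring C)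
    (W : ValuationSubring K) (j : O →+* W) [IsLocalHom j] (hj : ∀ c, (j c : K) = algebraMap C K c)
    {N : ℕ} (hN : 2 ≤ N) (D : Fin N → Der (ResidueField W))
    (hD : ∀ a (c : O), D a (rs W (algebraMap C K c)) = 0) (a : Fin (N + 1) → C) (ha : a ≠ 0) :
    HR W D (fun i => algebraMap C K (a i)) 0 := by
  obtain ⟨k, hk⟩ := Finite.exists_max (fun i => W.valuation (algebraMap C K (a i)))
  have hak : a k ≠ 0 := by
    intro h
    apply ha
    funext i
    have := hk i
    simpa [h] using this
  have hakK : algebraMap C K (a k) ≠ 0 := by simpa using hak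
  have hv0 : W.valuation (algebraMap C K (a k)) ≠ 0 := by simpa using hakK
  refine ⟨_, hakK, hk, ⟨k, rfl⟩, ?_⟩
  have hz : ∀ b i, D b (rs W (algebraMap C K (a i) / algebraMap C K (a k))) = 0 := by
    intro b i
    have h1 : W.valuation (algebraMap C K (a i / a k)) ≤ 1 := by
      rw [map_div₀, map_div₀]
      exact div_le_one_of_le₀ (hk i) zero_le
    have := hD b ⟨_, val_alg O W j hj _ h1⟩
    rw [← map_div₀]
    exact this
  rw [rho]
  split_ifs with h
  · rw [lgdet]
    have : Nonempty (Fin N) := ⟨⟨0, by omega⟩⟩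
    refine Eq.trans (congrArg _ ?_) Matrix.det_zero
    ext b i
    simp only [Matrix.of_apply, wv, Matrix.zero_apply]
    rw [Derivation.leibniz_div, hz, hz]
    simp
  · rfl

open IsLocalRing in
theorem HR_gen {K : Type*} [Field K]
    (W : ValuationSubring K)
    {N : ℕ} (D : Fin N → Der (ResidueField W)) (t : Fin N → K) (ht : ∀ b, t b ∈ W)
    (hD : ∀ a b, D a (rs W (t b)) = if a = b then 1 else 0) (h0 : ∀ b, rs W (t b) ≠ 0) :
    ∃ c, c ≠ 0 ∧ HR W D (Fin.cons 1 t) c := by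
  refine ⟨_, ?_, 1, one_ne_zero, ?_, ⟨0, by simp⟩, rfl⟩
  swap
  · intro i
    refine Fin.cases ?_ (fun i => ?_) i
    · simp
    · simpa using (W.valuation_le_one_iff _).2 (ht i)
  have h1 : rs W (1 : K) = 1 := by
    have := rs_coe W 1
    simpa using this
  have hw : wv (fun i => rs W ((Fin.cons 1 t : Fin (N + 1) → K) i / 1)) = fun i => rs W (t i) := by
    funext i
    simp [wv, h1]
  rw [rho, if_pos, hw, lgdet]
  · have : (Matrix.of fun a i => D a (rs W (t i)) / rs W (t i))
        = Matrix.diagonal (fun i => (rs W (t i))⁻¹) := by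
      ext a i
      rw [Matrix.of_apply, hD, Matrix.diagonal_apply]
      split_ifs with h
      · subst h; simp
      · simp
    rw [this, Matrix.det_diagonal]
    exact Finset.prod_ne_zero_iff.2 fun i _ => inv_ne_zero (h0 i)
  · intro i
    refine Fin.cases ?_ (fun i => ?_) i
    · simp [h1]
    · simpa using h0 i

theorem aeval_taylor {K σ : Type*} [Field K] (g : MvPolynomial σ K) (a : K)
    (q : σ → Polynomial K) :
    MvPolynomial.aeval (fun i => Polynomial.taylor a (q i)) g
      = Polynomial.taylor a (MvPolynomial.aeval q g) := by
  have := MvPolynomial.comp_aeval_apply (R := K) q (Polynomial.taylorAlgHom a) g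
  simpa using this.symm

theorem two_point {C K : Type*} [Field C] [IsAlgClosed C] [Field K] [Algebra C K]
    (W : ValuationSubring K) [CharP (IsLocalRing.ResidueField W) 2] (N d : ℕ) (hd : N + 1 ≤ d)
    (hN : 2 ≤ N)
    (l i1 : Fin N) (hl : i1 ≠ l) (D : Fin N → Der (IsLocalRing.ResidueField W))
    (gW : MvPolynomial (Fin (N + 1) ⊕ Fin 3) W)
    (hgW : MvPolynomial.map (IsLocalRing.residue W) gW = Gpoly _ N d l)
    (hs : ∀ (σ τ : Polynomial K) (u : Fin (N + 1) → Polynomial K) (x : Fin 3 → Polynomial K),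
      MvPolynomial.aeval (Sum.elim u x) (MvPolynomial.map (algebraMap W K) gW) = 0 →
      MvPolynomial.aeval (Sum.elim (fun i => σ * u i) (fun i => τ * x i))
        (MvPolynomial.map (algebraMap W K) gW) = 0)
    (R1 : ∀ h : K, h ≠ 0 → ∃ a : C, a ≠ 0 ∧ W.valuation h = W.valuation (algebraMap C K a))
    (p : Fin (N + 1) → Polynomial K) (e : Fin 3 → Polynomial K) (he : e ≠ 0)
    (hg : MvPolynomial.aeval (Sum.elim p e) (MvPolynomial.map (algebraMap W K) gW) = 0)
    (h0 : (fun i => (p i).eval 0) ≠ 0) (h1 : (fun i => (p i).eval 1) ≠ 0)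
    (c c' : IsLocalRing.ResidueField W) (hc : HR W D (fun i => (p i).eval 0) c)
    (hc' : HR W D (fun i => (p i).eval 1) c') : c = c' := by
  obtain ⟨k, hk⟩ := Finite.exists_max (fun i => (p i).natDegree)
  have hp0 : ∃ i, (p i).coeff (p k).natDegree ≠ 0 := by
    by_cases hk0 : (p k).natDegree = 0
    · obtain ⟨i, hi⟩ := Function.ne_iff.1 h0
      refine ⟨i, ?_⟩
      rw [hk0, Polynomial.coeff_zero_eq_eval_zero]
      exact hi
    · refine ⟨k, ?_⟩
      rw [Polynomial.coeff_natDegree, Ne, Polynomial.leadingCoeff_eq_zero]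
      intro h; rw [h] at hk0; simp at hk0
  have hJ0 : (fun i => (p i).coeff (p k).natDegree) ≠ 0 := by
    obtain ⟨i, hi⟩ := hp0
    exact Function.ne_iff.2 ⟨i, hi⟩
  have key1 := chain_lemma W N d hd hN l i1 hl D gW hgW hs R1 p e he hg _ hk
    (by simpa only [Polynomial.coeff_zero_eq_eval_zero] using h0) hJ0 c
    (by simpa only [Polynomial.coeff_zero_eq_eval_zero] using hc)
  have hct : ∀ i, (Polynomial.taylor 1 (p i)).coeff (p k).natDegree
      = (p i).coeff (p k).natDegree := by
    intro i
    rcases (hk i).lt_or_eq with h | h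
    · rw [Polynomial.coeff_eq_zero_of_natDegree_lt h, Polynomial.coeff_eq_zero_of_natDegree_lt]
      rwa [Polynomial.natDegree_taylor]
    · rw [← h, Polynomial.coeff_taylor_natDegree, Polynomial.coeff_natDegree]
  have key2 := chain_lemma W N d hd hN l i1 hl D gW hgW hs R1
    (fun i => Polynomial.taylor 1 (p i)) (fun i => Polynomial.taylor 1 (e i))
    (by
      intro h
      apply he
      funext i
      have := congrFun h i
      exact Polynomial.taylor_injective (1 : K) (by simpa using this))
    (by
      have := aeval_taylor (MvPolynomial.map (algebraMap W K) gW) 1 (Sum.elim p e)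
      rw [hg, map_zero] at this
      rw [← this]
      congr 2
      funext i
      cases i <;> rfl) (p k).natDegree
    (by intro i; rw [Polynomial.natDegree_taylor]; exact hk i)
    (by simpa only [Polynomial.taylor_coeff_zero] using h1)
    (by simpa only [hct] using hJ0) c'
    (by simpa only [Polynomial.taylor_coeff_zero] using hc')
  simp only [hct] at key2
  exact HR_unique W D _ c c' key1 key2

open IsLocalRing in
theorem final_contra {C K ρ : Type*} [Field C] [IsAlgClosed C] [Field K] (s : ℕ)
    [Algebra C K] [Algebra (MvPolynomial (Fin s) C) K] [IsScalarTower C (MvPolynomial (Fin s) C) K]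
    [IsFractionRing (MvPolynomial (Fin s) C) K]
    (O : ValuationSubring C)
    (h2 : O.valuation 2 < 1) (N d : ℕ) (hd : N + 1 ≤ d) (hN : 2 ≤ N) (l i1 : Fin N) (hl : i1 ≠ l)
    (gO : MvPolynomial (Fin (N + 1) ⊕ Fin 3) O)
    (hgO : MvPolynomial.map (residue O) gO = Gpoly _ N d l)
    (hbi : ∀ e ∈ gO.support, ∑ i, e (.inl i) = d ∧ ∑ j, e (.inr j) = 2)
    (T : Fin N ⊕ Option ρ → K) (hT : AlgebraicIndependent C T) (Y : K)
    (hgen : IntermediateField.adjoin C (Set.range T ∪ {Y}) = ⊤)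
    (hY : MvPolynomial.aeval (Sum.elim (Fin.cons 1 (fun i => T (.inl i))) ![1, Y, T (.inr none)])
      (MvPolynomial.map (algebraMap O C) gO) = 0) : False := by
  classical
  set g := MvPolynomial.map (algebraMap O C) gO with hgdef
  have hbig : ∀ e ∈ g.support, ∑ i, e (.inl i) = d ∧ ∑ j, e (.inr j) = 2 :=
    fun e he => hbi e (MvPolynomial.support_map_subset _ _ he)
  obtain ⟨W, j, hj, hloc, hchar, hTW, hgW, R1, D, hD0, hD1, hD2⟩ := P4_main O h2 N d l gO hgO
    (fun e he => by
      have := (hbi e he).2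
      rw [Fin.sum_univ_three] at this
      omega) T hT Y hgen
    (fun τ u x h => by
      have := aeval_scale _ _ _ g hbig 1 τ u x
      simp only [one_mul] at this
      rw [this, h, mul_zero]) hY
  have hmap : MvPolynomial.map (algebraMap W K) (MvPolynomial.map j gO)
      = MvPolynomial.map (algebraMap C K) g := by
    rw [hgdef, MvPolynomial.map_map, MvPolynomial.map_map]
    exact congrArg (fun f => MvPolynomial.map f gO) (RingHom.ext fun c => hj c)
  have hae : ∀ (q : Fin (N + 1) ⊕ Fin 3 → Polynomial K),
      MvPolynomial.aeval q (MvPolynomial.map (algebraMap W K) (MvPolynomial.map j gO))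
        = MvPolynomial.aeval q g := by
    intro q
    rw [hmap, MvPolynomial.aeval_map_algebraMap]
  obtain ⟨b, hb⟩ := IsLocalization.exist_integer_multiples_of_finite
    (nonZeroDivisors (MvPolynomial (Fin s) C))
    (Sum.elim (Fin.cons 1 (fun i => T (.inl i))) ![1, Y, T (.inr none)] : Fin (N + 1) ⊕ Fin 3 → K)
  choose f hf using hb
  have hinj : Function.Injective (algebraMap (MvPolynomial (Fin s) C) K) := IsFractionRing.injective _ _
  have hb0 : (b : MvPolynomial (Fin s) C) ≠ 0 := nonZeroDivisors.ne_zero b.2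
  have hbK : algebraMap (MvPolynomial (Fin s) C) K b ≠ 0 := by
    intro h; exact hb0 (hinj (by simpa using h))
  have hfe : (fun i => algebraMap (MvPolynomial (Fin s) C) K (f i)) = Sum.elim
      (fun i => algebraMap (MvPolynomial (Fin s) C) K b * (Fin.cons 1 (fun i => T (.inl i)) : Fin (N + 1) → K) i)
      (fun i => algebraMap (MvPolynomial (Fin s) C) K b * (![1, Y, T (.inr none)] : Fin 3 → K) i) := by
    funext i
    rw [hf]
    cases i <;> simp [Algebra.smul_def]
  have hgf : MvPolynomial.aeval f g = 0 := by
    apply hinj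
    rw [map_zero, ← MvPolynomial.aeval_algebraMap_apply]
    change MvPolynomial.aeval (fun i => algebraMap (MvPolynomial (Fin s) C) K (f i)) g = 0
    rw [hfe, aeval_scale _ _ _ g hbig, hY, mul_zero]
  obtain ⟨y0, hy0⟩ : ∃ y0 : Fin s → C, MvPolynomial.eval y0 (b : MvPolynomial (Fin s) C) ≠ 0 := by
    by_contra hcon
    push Not at hcon
    apply hb0
    exact MvPolynomial.funext fun y => by simp [hcon y]
  let lam : MvPolynomial (Fin s) C →ₐ[C] Polynomial K := MvPolynomial.aeval (fun i =>
    Polynomial.C (algebraMap C K (y0 i)) + Polynomial.X *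
      Polynomial.C (algebraMap (MvPolynomial (Fin s) C) K (MvPolynomial.X i) - algebraMap C K (y0 i)))
  have hl0 : ∀ a : MvPolynomial (Fin s) C, (lam a).eval 0 = algebraMap C K (MvPolynomial.eval y0 a) := by
    intro a
    have : ((Polynomial.evalRingHom (0 : K)).comp (lam : MvPolynomial (Fin s) C →+* Polynomial K))
        = (algebraMap C K).comp (MvPolynomial.eval y0) := by
      refine MvPolynomial.ringHom_ext (fun c => ?_) (fun i => ?_)
      · simp [lam, Polynomial.algebraMap_apply]
      · simp [lam]
    exact RingHom.congr_fun this a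
  have hl1 : ∀ a : MvPolynomial (Fin s) C, (lam a).eval 1 = algebraMap (MvPolynomial (Fin s) C) K a := by
    intro a
    have : ((Polynomial.evalRingHom (1 : K)).comp (lam : MvPolynomial (Fin s) C →+* Polynomial K))
        = algebraMap (MvPolynomial (Fin s) C) K := by
      refine MvPolynomial.ringHom_ext (fun c => ?_) (fun i => ?_)
      · simp [lam, Polynomial.algebraMap_apply]
        exact IsScalarTower.algebraMap_apply C (MvPolynomial (Fin s) C) K c
      · simp [lam]
    exact RingHom.congr_fun this a
  have hf00 : f (.inl 0) = b := by
    apply hinj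
    have := congrFun hfe (.inl 0)
    simpa using this
  have hf10 : f (.inr 0) = b := by
    apply hinj
    have := congrFun hfe (.inr 0)
    simpa using this
  have hlb : lam b ≠ 0 := by
    intro h
    have := hl1 b
    rw [h] at this
    simp at this
    exact hbK this.symm
  obtain ⟨c, hc0, hc⟩ := HR_gen W D (fun i => T (.inl i)) (fun i => hTW _) hD1 hD2
  refine hc0 (two_point W N d hd hN l i1 hl D (MvPolynomial.map j gO) hgW ?_ R1
    (fun i => lam (f (.inl i))) (fun i => lam (f (.inr i))) ?_ ?_ ?_ ?_ 0 c ?_ ?_).symm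
  · intro σ τ u x h
    rw [hae] at h ⊢
    rw [aeval_scale _ _ _ g hbig, h, mul_zero]
  · exact Function.ne_iff.2 ⟨0, by simpa [hf10] using hlb⟩
  · rw [hae]
    have := MvPolynomial.comp_aeval_apply (R := C) f lam g
    rw [hgf, map_zero] at this
    rw [this]
    congr 2
    funext i
    cases i <;> rfl
  · refine Function.ne_iff.2 ⟨0, ?_⟩
    simp only [hl0, hf00]
    simpa using hy0
  · refine Function.ne_iff.2 ⟨0, ?_⟩
    simp only [hl1, hf00]
    exact hbK
  · simp only [hl0]
    refine HR_const O W j hj hN D hD0 _ (Function.ne_iff.2 ⟨0, ?_⟩)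
    simp only [hf00]
    exact hy0
  · have := HR_smul W D _ c _ hbK hc
    convert this using 2
    rw [hl1]
    exact congrFun hfe (.inl _)

end
end ConicBundleFormalization

namespace ConicBundleFormalization
noncomputable section

theorem Gpoly_bihom (R : Type*) [CommRing R] (N d : ℕ) (hd : N + 1 ≤ d) (hN : 2 ≤ N) (l : Fin N)
    (wu wx D : ℕ) (hD : D = d * wu + 2 * wx) :
    MvPolynomial.IsWeightedHomogeneous (Sum.elim (fun _ => wu) (fun _ => wx) : Fin (N + 1) ⊕ Fin 3 → ℕ)
      (Gpoly R N d l) D := by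
  subst hD
  generalize hw : (Sum.elim (fun _ => wu) (fun _ => wx) : Fin (N + 1) ⊕ Fin 3 → ℕ) = w
  have hu : ∀ i, MvPolynomial.IsWeightedHomogeneous w
    (MvPolynomial.X (.inl i) : MvPolynomial (Fin (N + 1) ⊕ Fin 3) R) wu :=
    fun i => by
      have := MvPolynomial.isWeightedHomogeneous_X R w (.inl i)
      rwa [show w (.inl i) = wu by rw [← hw]; rfl] at this
  have hx : ∀ i, MvPolynomial.IsWeightedHomogeneous w
    (MvPolynomial.X (.inr i) : MvPolynomial (Fin (N + 1) ⊕ Fin 3) R) wx :=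
    fun i => by
      have := MvPolynomial.isWeightedHomogeneous_X R w (.inr i)
      rwa [show w (.inr i) = wx by rw [← hw]; rfl] at this
  have hp : MvPolynomial.IsWeightedHomogeneous w
    (∏ j : Fin N, MvPolynomial.X (.inl j.succ) : MvPolynomial (Fin (N + 1) ⊕ Fin 3) R)
      (N * wu) := by
    have := MvPolynomial.IsWeightedHomogeneous.prod Finset.univ
      (fun j : Fin N => (MvPolynomial.X (.inl j.succ) : MvPolynomial (Fin (N + 1) ⊕ Fin 3) R))
      (fun _ => wu) (w := w) (fun j _ => hu _)
    simpa using this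
  have hp' : MvPolynomial.IsWeightedHomogeneous w
    (∏ j ∈ Finset.univ.erase l, MvPolynomial.X (.inl (Fin.succ j)) :
      MvPolynomial (Fin (N + 1) ⊕ Fin 3) R) ((N - 1) * wu) := by
    have := MvPolynomial.IsWeightedHomogeneous.prod (Finset.univ.erase l)
      (fun j : Fin N => (MvPolynomial.X (.inl j.succ) : MvPolynomial (Fin (N + 1) ⊕ Fin 3) R))
      (fun _ => wu) (w := w) (fun j _ => hu _)
    simpa using this
  obtain ⟨k, rfl⟩ := Nat.exists_eq_add_of_le hd
  obtain ⟨M, rfl⟩ := Nat.exists_eq_add_of_le hN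
  rw [Gpoly, Gexp]
  refine ((((?_ : MvPolynomial.IsWeightedHomogeneous _ _ _).add ?_).add
    (MvPolynomial.IsWeightedHomogeneous.sum _ _ _ fun i _ => ?_)).add ?_).add ?_
  · have := ((hu 0).pow (2 + M + 1 + k)).mul ((hx 0).pow 2)
    simpa using this
  · have := (((hu 0).pow (2 + M + 1 + k - 2)).mul ((hu l.succ).pow 2)).mul ((hx 0).pow 2)
    convert this using 1
    rw [show 2 + M + 1 + k - 2 = M + 1 + k by omega]
    simp only [smul_eq_mul]; ring
  · have := ((((hu 0).pow (2 + M + 1 + k - (2 + M + 1))).mul (hu i.succ)).mul hp).mul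
      ((hx 0).pow 2)
    convert this using 1
    rw [show 2 + M + 1 + k - (2 + M + 1) = k by omega]
    simp only [smul_eq_mul]; ring
  · have h1 := (((hx 1).pow 2).add (n := 2 • wx) (ψ := MvPolynomial.X (.inr 0) * MvPolynomial.X (.inr 1))
      (by rw [two_smul]; exact (hx 0).mul (hx 1)))
    have := (((hu 0).pow (2 + M + 1 + k - (2 + M))).mul hp).mul h1
    convert this using 1
    rw [show 2 + M + 1 + k - (2 + M) = k + 1 by omega]
    simp only [smul_eq_mul]; ring
  · have := (((hu 0).pow (2 + M + 1 + k - (2 + M) + 1)).mul hp').mul ((hx 2).pow 2)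
    convert this using 1
    rw [show 2 + M + 1 + k - (2 + M) + 1 = k + 2 by omega, show 2 + M - 1 = M + 1 by omega]
    simp only [smul_eq_mul]; ring

theorem Gpoly_supp (R : Type*) [CommRing R] (N d : ℕ) (hd : N + 1 ≤ d) (hN : 2 ≤ N) (l : Fin N)
    (e : Fin (N + 1) ⊕ Fin 3 →₀ ℕ) (he : e ∈ (Gpoly R N d l).support) :
    ∑ i, e (.inl i) = d ∧ ∑ j, e (.inr j) = 2 := by
  rw [MvPolynomial.mem_support_iff] at he
  have h1 := Gpoly_bihom R N d hd hN l 1 0 d (by omega) he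
  have h2 := Gpoly_bihom R N d hd hN l 0 1 2 (by omega) he
  rw [Finsupp.weight_apply, Finsupp.sum_fintype _ _ (by simp)] at h1 h2
  simp at h1 h2
  exact ⟨h1, h2⟩

open IsLocalRing in
theorem exists_O {C : Type*} [Field C] {σ : Type*} (g : MvPolynomial σ C)
    (g0 : MvPolynomial σ ℤ)
    (H : ∀ P : MvPolynomial (σ →₀ ℕ) ℤ, Odd (MvPolynomial.eval (fun e => g0.coeff e) P) →
      MvPolynomial.aeval (fun e => g.coeff e) P ≠ 0) :
    ∃ (O : ValuationSubring C) (gO : MvPolynomial σ O), O.valuation 2 < 1 ∧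
      MvPolynomial.map (algebraMap O C) gO = g ∧
      MvPolynomial.map (residue O) gO = MvPolynomial.map (Int.castRingHom _) g0 := by
  classical
  let φ : MvPolynomial (σ →₀ ℕ) ℤ →+* C := (MvPolynomial.aeval (fun e => g.coeff e)).toRingHom
  let ψ : MvPolynomial (σ →₀ ℕ) ℤ →+* ℤ := MvPolynomial.eval (fun e => g0.coeff e)
  let ψ2 : MvPolynomial (σ →₀ ℕ) ℤ →+* ZMod 2 := (Int.castRingHom (ZMod 2)).comp ψ
  let I : Ideal φ.range := (RingHom.ker ψ2).map φ.rangeRestrict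
  have hI : I ≠ ⊤ := by
    intro h
    have h1 : (1 : φ.range) ∈ I := by rw [h]; trivial
    obtain ⟨k, hk, hk1⟩ := (Ideal.mem_map_iff_of_surjective φ.rangeRestrict
      φ.rangeRestrict_surjective).1 h1
    refine H (1 - k) ?_ ?_
    · have h2 : ψ2 (1 - k) = 1 := by
        rw [map_sub, map_one, (RingHom.mem_ker).1 hk, sub_zero]
      have h3 : ((ψ (1 - k) : ℤ) : ZMod 2) = 1 := h2
      exact (ZMod.intCast_eq_one_iff_odd).1 h3
    · have h2 : φ k = 1 := congrArg Subtype.val hk1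
      change φ (1 - k) = 0
      rw [map_sub, map_one, h2, sub_self]
  obtain ⟨B, hB, hIB⟩ := Ideal.image_subset_nonunits_valuationSubring I hI
  have hφB : ∀ P, φ P ∈ B := fun P => hB ⟨P, rfl⟩
  have hker : ∀ P, ψ2 P = 0 → B.valuation (φ P) < 1 := by
    intro P hP
    have : φ P ∈ B.nonunits := hIB ⟨φ.rangeRestrict P, Ideal.mem_map_of_mem _ hP, rfl⟩
    exact (B.mem_nonunits_iff).1 this
  have hX : ∀ e, φ (MvPolynomial.X e) = g.coeff e := fun e => by simp [φ]
  have hc : ∀ e, g.coeff e ∈ B := fun e => hX e ▸ hφB _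
  have hcoeff : ∀ e, MvPolynomial.coeff e (∑ e ∈ g.support,
      MvPolynomial.monomial e (⟨g.coeff e, hc e⟩ : B)) = ⟨g.coeff e, hc e⟩ := by
    intro e
    rw [MvPolynomial.coeff_sum]
    simp only [MvPolynomial.coeff_monomial]
    rw [Finset.sum_ite_eq' g.support e]
    split_ifs with h
    · rfl
    · refine Subtype.ext ?_
      simpa [eq_comm] using h
  refine ⟨B, ∑ e ∈ g.support, MvPolynomial.monomial e (⟨g.coeff e, hc e⟩ : B), ?_, ?_, ?_⟩
  · have := hker (MvPolynomial.C 2) (by simp [ψ2, ψ]; rfl)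
    simpa [φ] using this
  · ext e
    rw [MvPolynomial.coeff_map, hcoeff]
    rfl
  · ext e
    rw [MvPolynomial.coeff_map, MvPolynomial.coeff_map, hcoeff]
    have h1 := hker (MvPolynomial.X e - MvPolynomial.C (g0.coeff e)) (by simp [ψ2, ψ])
    have h2 : φ (MvPolynomial.X e - MvPolynomial.C (g0.coeff e))
      = ((⟨g.coeff e, hc e⟩ - ((g0.coeff e : ℤ) : B) : B) : C) := by
      rw [map_sub, hX]
      simp [φ]
    rw [h2, ← ValuationSubring.valuation_lt_one_iff, ← IsLocalRing.residue_eq_zero_iff, map_sub,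
      sub_eq_zero] at h1
    rw [h1]
    simp

end
end ConicBundleFormalization

namespace ConicBundleFormalization
noncomputable section

theorem toFrac_dvd {k : Type} [Field k] {n m : ℕ} (g p : Cox k n m) (h : toFrac k g p = 0) : g ∣ p := by
  have hinj : Function.Injective (algebraMap (coneRing k g) (FracCone k g)) :=
    IsFractionRing.injective (coneRing k g) (FractionRing (coneRing k g))
  have h1 : algebraMap (coneRing k g) (FracCone k g) (Ideal.Quotient.mk _ p) = 0 := h
  rw [map_eq_zero_iff _ hinj, Ideal.Quotient.eq_zero_iff_mem, Ideal.mem_span_singleton] at h1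
  exact h1

theorem toFrac_C {k : Type} [Field k] {n m : ℕ} (g : Cox k n m) (c : k) :
    toFrac k g (MvPolynomial.C c) = algebraMap k (FracCone k g) c :=
  (IsScalarTower.algebraMap_apply k (coneRing k g) (FractionRing (coneRing k g)) c).symm

theorem toFrac_self {k : Type} [Field k] {n m : ℕ} (g : Cox k n m) : toFrac k g g = 0 := by
  have h1 : (Ideal.Quotient.mk (Ideal.span {g})) g = 0 :=
    Ideal.Quotient.eq_zero_iff_mem.2 (Ideal.mem_span_singleton_self g)
  change algebraMap (coneRing k g) (FracCone k g) (Ideal.Quotient.mk _ g) = 0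
  rw [h1, map_zero]

theorem toFrac_eq {k : Type} [Field k] {n m : ℕ} (g p : Cox k n m) :
    toFrac k g p = MvPolynomial.aeval (fun v => toFrac k g (MvPolynomial.X v)) p := by
  have : toFrac k g = (MvPolynomial.aeval (R := k) (fun v => toFrac k g (MvPolynomial.X v)) :
      Cox k n m →ₐ[k] FracCone k g).toRingHom := by
    refine MvPolynomial.ringHom_ext (fun c => ?_) (fun i => ?_)
    · rw [toFrac_C]
      exact (MvPolynomial.aeval_C (R := k) (fun v => toFrac k g (MvPolynomial.X v)) c).symm
    · exact (MvPolynomial.aeval_X (R := k) (fun v => toFrac k g (MvPolynomial.X v)) i).symm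
  exact RingHom.congr_fun this p

theorem toFrac_unit {k : Type} [Field k] {n m : ℕ} (g : Cox k n m) (v : Fin n ⊕ Fin m)
    (e : Fin n ⊕ Fin m →₀ ℕ) (he : g.coeff e ≠ 0) (hev : e v = 0) :
    IsUnit (toFrac k g (MvPolynomial.X v)) := by
  classical
  have hnd : ¬ (MvPolynomial.X v : Cox k n m) ∣ g := by
    rintro ⟨q, hq⟩
    apply he
    rw [hq, MvPolynomial.coeff_X_mul', if_neg]
    simpa using hev
  have hmem : (Ideal.Quotient.mk (Ideal.span {g}) (MvPolynomial.X v) : coneRing k g)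
      ∈ nonZeroDivisors (coneRing k g) := by
    rw [mem_nonZeroDivisors_iff_right]
    intro z hz
    obtain ⟨q, rfl⟩ := Ideal.Quotient.mk_surjective z
    rw [← map_mul, Ideal.Quotient.eq_zero_iff_mem, Ideal.mem_span_singleton] at hz
    rw [Ideal.Quotient.eq_zero_iff_mem, Ideal.mem_span_singleton]
    obtain ⟨r, hr⟩ := hz
    have hp : Prime (MvPolynomial.X v : Cox k n m) := MvPolynomial.X_prime
    rcases hp.dvd_or_dvd (⟨q, by rw [← hr, mul_comm]⟩ : MvPolynomial.X v ∣ g * r) with h | ⟨r', hr'⟩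
    · exact absurd h hnd
    · refine ⟨r', mul_right_cancel₀ hp.ne_zero ?_⟩
      rw [hr, hr']; ring
  exact IsLocalization.map_units (FractionRing (coneRing k g)) ⟨_, hmem⟩

theorem bihom_nat {k : Type} [Field k] {n : ℕ} (α : ℤ) (β : ℕ) (p : Cox k n 3)
    (h : IsBihom k n 3 (fun _ => 0) (fun _ => 1) α β p) :
    ∀ e ∈ p.support, ∑ i, e (.inl i) = α.toNat ∧ ∑ j, e (.inr j) = β := by
  intro e he
  obtain ⟨h1, h2⟩ := h e he
  simp only [mul_zero, Finset.sum_const_zero, add_zero, mul_one] at h1 h2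
  refine ⟨?_, h2⟩
  rw [← h1, ← Nat.cast_sum, Int.toNat_natCast]

theorem isBihom_of_nat {k : Type} [Field k] {n : ℕ} (α : ℕ) (β : ℕ) (p : Cox k n 3)
    (h : ∀ e ∈ p.support, ∑ i, e (.inl i) = α ∧ ∑ j, e (.inr j) = β) :
    IsBihom k n 3 (fun _ => 0) (fun _ => 1) α β p := by
  intro e he
  obtain ⟨h1, h2⟩ := h e he
  simp only [mul_zero, Finset.sum_const_zero, add_zero, mul_one]
  exact ⟨by rw [← h1]; simp, h2⟩

theorem homog_lemma {k : Type} [Field k] {N : ℕ} {F : Type*} [CommRing F] [Algebra k F]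
    (π : Cox k (N + 1) 3 →ₐ[k] F) (ai bi : F) (ha : π (MvPolynomial.X (.inl 0)) * ai = 1)
    (hb : π (MvPolynomial.X (.inr 0)) * bi = 1)
    (h : MvPolynomial (Fin N ⊕ Unit) k) :
    ∃ (M : ℕ) (H : Cox k (N + 1) 3), MvPolynomial.degreeOf (.inr 1) H ≤ 0 ∧
      π H = π (MvPolynomial.X (.inl 0) * MvPolynomial.X (.inr 0)) ^ M *
        MvPolynomial.aeval (Sum.elim (fun i => π (MvPolynomial.X (.inl (Fin.succ i))) * ai)
          (fun _ => π (MvPolynomial.X (.inr 2)) * bi)) h ∧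
      MvPolynomial.aeval (Sum.elim (Fin.cons 1 (fun i => MvPolynomial.X (.inl i)))
        ![1, 0, MvPolynomial.X (.inr ())]) H = h := by
  classical
  have hdX : ∀ v : Fin (N + 1) ⊕ Fin 3, v ≠ .inr 1 →
    MvPolynomial.degreeOf (.inr 1) (MvPolynomial.X v : Cox k (N + 1) 3) ≤ 0 := fun v hv => by
      rw [MvPolynomial.degreeOf_X_of_ne hv.symm]
  have hdm : ∀ p q : Cox k (N + 1) 3, MvPolynomial.degreeOf (.inr 1) p ≤ 0 →
      MvPolynomial.degreeOf (.inr 1) q ≤ 0 → MvPolynomial.degreeOf (.inr 1) (p * q) ≤ 0 :=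
    fun p q hp hq => (MvPolynomial.degreeOf_mul_le _ _ _).trans (add_le_add hp hq)
  have hdp : ∀ (p : Cox k (N + 1) 3) M, MvPolynomial.degreeOf (.inr 1) p ≤ 0 →
      MvPolynomial.degreeOf (.inr 1) (p ^ M) ≤ 0 := by
    intro p M hp
    refine (MvPolynomial.degreeOf_pow_le _ _ _).trans ?_
    rw [Nat.le_zero.1 hp, mul_zero]
  have hux := hdm _ _ (hdX (.inl 0) (by simp)) (hdX (.inr 0) (by simp))
  induction h using MvPolynomial.induction_on with
  | C a =>
    refine ⟨0, MvPolynomial.C a, by simp, ?_, by simp [MvPolynomial.algebraMap_eq]⟩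
    rw [pow_zero, one_mul, MvPolynomial.aeval_C]
    exact π.commutes a
  | add p q hp hq =>
    obtain ⟨M1, H1, h1, h2, h3⟩ := hp
    obtain ⟨M2, H2, h4, h5, h6⟩ := hq
    refine ⟨M1 + M2, (MvPolynomial.X (.inl 0) * MvPolynomial.X (.inr 0)) ^ M2 * H1 +
      (MvPolynomial.X (.inl 0) * MvPolynomial.X (.inr 0)) ^ M1 * H2, ?_, ?_, ?_⟩
    · exact (MvPolynomial.degreeOf_add_le _ _ _).trans
        (max_le (hdm _ _ (hdp _ _ hux) h1) (hdm _ _ (hdp _ _ hux) h4))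
    · rw [map_add, map_mul, map_mul, map_pow, map_pow, h2, h5, map_add]; ring
    · rw [map_add, map_mul, map_mul, h3, h6]
      simp
  | mul_X p v hp =>
    obtain ⟨M1, H1, h1, h2, h3⟩ := hp
    rcases v with i | u
    · refine ⟨M1 + 1, H1 * (MvPolynomial.X (.inl i.succ) * MvPolynomial.X (.inr 0)), ?_, ?_, ?_⟩
      · exact hdm _ _ h1 (hdm _ _ (hdX _ (by simp)) (hdX _ (by simp)))
      · rw [map_mul, h2, map_mul (MvPolynomial.aeval _), MvPolynomial.aeval_X, pow_succ, map_mul,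
          map_mul, Sum.elim_inl]
        linear_combination (-(π (MvPolynomial.X (Sum.inl 0)) * π (MvPolynomial.X (Sum.inr 0))) ^ M1
          * (MvPolynomial.aeval (Sum.elim (fun i => π (MvPolynomial.X (.inl (Fin.succ i))) * ai)
          (fun _ => π (MvPolynomial.X (.inr 2)) * bi)) p) * π (MvPolynomial.X (Sum.inl i.succ))
          * π (MvPolynomial.X (Sum.inr 0))) * ha
      · rw [map_mul, h3]; simp
    · refine ⟨M1 + 1, H1 * (MvPolynomial.X (.inr 2) * MvPolynomial.X (.inl 0)), ?_, ?_, ?_⟩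
      · exact hdm _ _ h1 (hdm _ _ (hdX _ (by simp)) (hdX _ (by simp)))
      · rw [map_mul, h2, map_mul (MvPolynomial.aeval _), MvPolynomial.aeval_X, pow_succ, map_mul,
          map_mul, Sum.elim_inr]
        linear_combination (-(π (MvPolynomial.X (Sum.inl 0)) * π (MvPolynomial.X (Sum.inr 0))) ^ M1
          * (MvPolynomial.aeval (Sum.elim (fun i => π (MvPolynomial.X (.inl (Fin.succ i))) * ai)
          (fun _ => π (MvPolynomial.X (.inr 2)) * bi)) p) * π (MvPolynomial.X (Sum.inr 2))
          * π (MvPolynomial.X (Sum.inl 0))) * hb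
      · rw [map_mul, h3]; simp

theorem cone_facts {k : Type} [Field k] {N : ℕ} (g : Cox k (N + 1) 3)
    (e : Fin (N + 1) ⊕ Fin 3 →₀ ℕ) (he : g.coeff e ≠ 0) (he0 : e (.inl 0) = 0)
    (he1 : e (.inr 0) = 0) (he2 : e (.inr 1) ≠ 0) :
    ∃ val : Fin (N + 1) ⊕ Fin 3 → FracCone k g, val (.inl 0) = 1 ∧ val (.inr 0) = 1 ∧
      (Nontrivial (FracCone k g) →
        ∀ v, val v ∈ functionFieldModel k (fun _ => 0) (fun _ => 1) g) ∧
      (∀ α β : ℕ, ∃ ω, IsUnit ω ∧ ∀ p : Cox k (N + 1) 3,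
        (∀ e ∈ p.support, ∑ i, e (.inl i) = α ∧ ∑ j, e (.inr j) = β) →
        toFrac k g p = ω * MvPolynomial.aeval val p) ∧
      (∀ h : MvPolynomial (Fin N ⊕ Unit) k, MvPolynomial.aeval
        (Sum.elim (fun i => val (.inl (Fin.succ i))) (fun _ => val (.inr 2))) h = 0 → h = 0) := by
  classical
  have hua := toFrac_unit g (.inl 0) e he he0
  have hub := toFrac_unit g (.inr 0) e he he1
  obtain ⟨ai, ha⟩ := hua.exists_right_inv
  obtain ⟨bi, hb⟩ := hub.exists_right_inv
  let π : Cox k (N + 1) 3 →ₐ[k] FracCone k g :=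
    { toFrac k g with commutes' := fun c => toFrac_C g c }
  have hπ : ∀ p, π p = toFrac k g p := fun p => rfl
  refine ⟨Sum.elim (fun i => toFrac k g (MvPolynomial.X (.inl i)) * ai)
    (fun i => toFrac k g (MvPolynomial.X (.inr i)) * bi), ha, hb, ?_, ?_, ?_⟩
  · intro hnt v
    refine Algebra.subset_adjoin ?_
    rcases v with i | i
    · refine ⟨((1 : ℕ) : ℤ), 0, MvPolynomial.X (.inl i), MvPolynomial.X (.inl 0),
        isBihom_of_nat _ _ _ ?_, isBihom_of_nat _ _ _ ?_, hua.ne_zero, ?_⟩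
      · intro e he
        rw [MvPolynomial.support_X, Finset.mem_singleton] at he
        subst he
        simp [Finsupp.single_apply]
      · intro e he
        rw [MvPolynomial.support_X, Finset.mem_singleton] at he
        subst he
        simp [Finsupp.single_apply]
      · rw [Sum.elim_inl]
        linear_combination toFrac k g (MvPolynomial.X (.inl i)) * ha
    · refine ⟨((0 : ℕ) : ℤ), 1, MvPolynomial.X (.inr i), MvPolynomial.X (.inr 0),
        isBihom_of_nat _ _ _ ?_, isBihom_of_nat _ _ _ ?_, hub.ne_zero, ?_⟩
      · intro e he
        rw [MvPolynomial.support_X, Finset.mem_singleton] at he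
        subst he
        simp [Finsupp.single_apply]
      · intro e he
        rw [MvPolynomial.support_X, Finset.mem_singleton] at he
        subst he
        simp [Finsupp.single_apply]
      · rw [Sum.elim_inr]
        linear_combination toFrac k g (MvPolynomial.X (.inr i)) * hb
  · intro α β
    refine ⟨_, (hua.pow α).mul (hub.pow β), fun p hp => ?_⟩
    rw [← aeval_scale _ _ _ p hp, toFrac_eq]
    congr 2
    funext v
    rcases v with i | i
    · rw [Sum.elim_inl]
      linear_combination -toFrac k g (MvPolynomial.X (.inl i)) * ha
    · rw [Sum.elim_inr]
      linear_combination -toFrac k g (MvPolynomial.X (.inr i)) * hb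
  · intro h h0
    obtain ⟨M, H, hH1, hH2, hH3⟩ := homog_lemma π ai bi ha hb h
    have hz : toFrac k g H = 0 := by
      rw [← hπ, hH2]
      simp only [Sum.elim_inl, Sum.elim_inr] at h0
      simp only [hπ, h0, mul_zero]
    obtain ⟨q, hq⟩ := toFrac_dvd g H hz
    by_cases hH : H = 0
    · rw [← hH3, hH, map_zero]
    · exfalso
      have hg0 : g ≠ 0 := by rintro rfl; simp at he
      have hq0 : q ≠ 0 := by rintro rfl; simp at hq; exact hH hq
      rw [hq, MvPolynomial.degreeOf_mul_eq hg0 hq0] at hH1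
      have := MvPolynomial.monomial_le_degreeOf (.inr 1) (MvPolynomial.mem_support_iff.2 he)
      omega

end
end ConicBundleFormalization

namespace ConicBundleFormalization
noncomputable section

theorem ff_abs {k A E : Type*} [Field k] [CommRing A] [Algebra k A] [Field E] [Algebra k E]
    {N r : ℕ} (Φ : FractionRing (MvPolynomial (Fin r) A) ≃ₐ[k] E)
    (g : MvPolynomial (Fin (N + 1) ⊕ Fin 3) k)
    (val : Fin (N + 1) ⊕ Fin 3 → A) (h0 : val (.inl 0) = 1) (h1 : val (.inr 0) = 1)
    (hg : MvPolynomial.aeval val g = 0)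
    (hind : AlgebraicIndependent k
      (Sum.elim (fun i : Fin N => val (.inl (Fin.succ i))) (fun _ : Unit => val (.inr 2))))
    (hrat : Algebra.adjoin k {φ : A | ∃ p q : MvPolynomial (Fin (N + 1) ⊕ Fin 3) k,
      MvPolynomial.aeval val q ≠ 0 ∧ φ * MvPolynomial.aeval val q = MvPolynomial.aeval val p} = ⊤) :
    ∃ (T : Fin N ⊕ Option (Fin r) → E) (Y : E), AlgebraicIndependent k T ∧
      IntermediateField.adjoin k (Set.range T ∪ {Y}) = ⊤ ∧
      MvPolynomial.aeval (Sum.elim (Fin.cons 1 (fun i => T (.inl i))) ![1, Y, T (.inr none)]) g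
        = 0 := by
  classical
  let P := MvPolynomial (Fin r) A
  have hiP : Function.Injective (algebraMap (MvPolynomial (Fin r) A)
    (FractionRing (MvPolynomial (Fin r) A))) := IsFractionRing.injective _ _
  have hy : AlgebraicIndependent A (fun i : Fin r => algebraMap (MvPolynomial (Fin r) A)
      (FractionRing (MvPolynomial (Fin r) A)) (MvPolynomial.X i)) :=
    (MvPolynomial.algebraicIndependent_X (Fin r) A).map'
      (f := IsScalarTower.toAlgHom A (MvPolynomial (Fin r) A)
        (FractionRing (MvPolynomial (Fin r) A))) hiP
  have hs := AlgebraicIndependent.sumElim_comp hind hy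
  have hs2 := hs.map' (f := Φ.toAlgHom) Φ.injective
  let ιm : Fin N ⊕ Option (Fin r) → Fin r ⊕ (Fin N ⊕ Unit) :=
    Sum.elim (fun i => .inr (.inl i)) (fun o => o.elim (.inr (.inr ())) .inl)
  have hιm : Function.Injective ιm := by
    rintro (i | _ | i) (j | _ | j) h <;> simp_all [ιm]
  have hs3 := hs2.comp ιm hιm
  let ι : A →ₐ[k] E := Φ.toAlgHom.comp (IsScalarTower.toAlgHom k A
    (FractionRing (MvPolynomial (Fin r) A)))
  have hιinj : Function.Injective ι := Φ.injective.comp hy.algebraMap_injective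
  set T : Fin N ⊕ Option (Fin r) → E := _ ∘ ιm with hTdef
  have hTl : ∀ i, T (.inl i) = ι (val (.inl (Fin.succ i))) := fun i => rfl
  have hTn : T (.inr none) = ι (val (.inr 2)) := rfl
  have hTs : ∀ i, T (.inr (some i)) = Φ (algebraMap (MvPolynomial (Fin r) A)
      (FractionRing (MvPolynomial (Fin r) A)) (MvPolynomial.X i)) := fun i => rfl
  have hval : (Sum.elim (Fin.cons 1 (fun i => T (.inl i)))
      ![1, ι (val (.inr 1)), T (.inr none)] : Fin (N + 1) ⊕ Fin 3 → E) = fun v => ι (val v) := by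
    funext v
    rcases v with i | i
    · refine Fin.cases ?_ (fun i => ?_) i
      · simp [h0]
      · simp [hTl]
    · fin_cases i
      · simp [h1]
      · simp
      · simp [hTn]
  refine ⟨T, ι (val (.inr 1)), hs3, ?_, ?_⟩
  swap
  · rw [hval]
    have := MvPolynomial.comp_aeval_apply (R := k) val ι g
    rw [← this, hg, map_zero]
  set M := IntermediateField.adjoin k (Set.range T ∪ {ι (val (.inr 1))}) with hM
  have hTM : ∀ b, T b ∈ M := fun b => IntermediateField.subset_adjoin _ _ (.inl ⟨b, rfl⟩)
  have hvM : ∀ v, ι (val v) ∈ M := by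
    intro v
    rcases v with i | i
    · refine Fin.cases ?_ (fun i => ?_) i
      · rw [h0, map_one]; exact M.one_mem
      · exact hTM (.inl i)
    · fin_cases i
      · change ι (val (.inr 0)) ∈ M
        rw [h1, map_one]; exact M.one_mem
      · exact IntermediateField.subset_adjoin _ _ (.inr rfl)
      · exact hTM (.inr none)
  have hpM : ∀ p : MvPolynomial (Fin (N + 1) ⊕ Fin 3) k, ι (MvPolynomial.aeval val p) ∈ M := by
    intro p
    rw [MvPolynomial.comp_aeval_apply (R := k) val ι p]
    induction p using MvPolynomial.induction_on with
    | C a => rw [MvPolynomial.aeval_C]; exact M.algebraMap_mem a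
    | add p q hp hq => rw [map_add]; exact M.add_mem hp hq
    | mul_X p v hp => rw [map_mul, MvPolynomial.aeval_X]; exact M.mul_mem hp (hvM v)
  have hAM : ∀ a : A, ι a ∈ M := by
    have hle : Algebra.adjoin k {φ : A | ∃ p q : MvPolynomial (Fin (N + 1) ⊕ Fin 3) k,
      MvPolynomial.aeval val q ≠ 0 ∧ φ * MvPolynomial.aeval val q = MvPolynomial.aeval val p}
        ≤ M.toSubalgebra.comap ι := by
      refine Algebra.adjoin_le ?_
      rintro φ ⟨p, q, hq, hpq⟩
      change ι φ ∈ M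
      have hq' : ι (MvPolynomial.aeval val q) ≠ 0 := by
        rw [Ne, map_eq_zero_iff _ hιinj]; exact hq
      have : ι φ = ι (MvPolynomial.aeval val p) / ι (MvPolynomial.aeval val q) := by
        rw [eq_div_iff hq', ← map_mul, hpq]
      rw [this]
      exact M.div_mem (hpM p) (hpM q)
    rw [hrat] at hle
    exact fun a => hle trivial
  have hPM : ∀ p : MvPolynomial (Fin r) A, Φ (algebraMap (MvPolynomial (Fin r) A)
      (FractionRing (MvPolynomial (Fin r) A)) p) ∈ M := by
    intro p
    induction p using MvPolynomial.induction_on with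
    | C a =>
      have h := hAM a
      have h2 : ι a = Φ (algebraMap (MvPolynomial (Fin r) A)
        (FractionRing (MvPolynomial (Fin r) A)) (MvPolynomial.C a)) := by
        change Φ (algebraMap A (FractionRing (MvPolynomial (Fin r) A)) a) = _
        rw [IsScalarTower.algebraMap_apply A (MvPolynomial (Fin r) A)
          (FractionRing (MvPolynomial (Fin r) A)) a]
        rfl
      rwa [h2] at h
    | add p q hp hq => rw [map_add, map_add]; exact M.add_mem hp hq
    | mul_X p v hp => rw [map_mul, map_mul]; exact M.mul_mem hp (hTM (.inr (some v)))
  rw [eq_top_iff]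
  intro z _
  obtain ⟨x, rfl⟩ := Φ.surjective z
  obtain ⟨p, q, hpq⟩ := IsLocalization.exists_mk'_eq
    (nonZeroDivisors (MvPolynomial (Fin r) A)) x
  have hspec := IsLocalization.mk'_spec (FractionRing (MvPolynomial (Fin r) A)) p q
  rw [hpq] at hspec
  have hu : Φ (algebraMap (MvPolynomial (Fin r) A)
      (FractionRing (MvPolynomial (Fin r) A)) q) ≠ 0 :=
    ((IsLocalization.map_units (FractionRing (MvPolynomial (Fin r) A)) q).map Φ).ne_zero
  have : Φ x = Φ (algebraMap (MvPolynomial (Fin r) A)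
      (FractionRing (MvPolynomial (Fin r) A)) p) / Φ (algebraMap (MvPolynomial (Fin r) A)
      (FractionRing (MvPolynomial (Fin r) A)) q) := by
    rw [eq_div_iff hu, ← map_mul, hspec]
  rw [this]
  exact M.div_mem (hPM p) (hPM q)

theorem ff_facts {k : Type} {E : Type*} [Field k] [Field E] [Algebra k E]
    {N d r : ℕ} (g : Cox k (N + 1) 3)
    (hbi : ∀ e ∈ g.support, ∑ i, e (.inl i) = d ∧ ∑ j, e (.inr j) = 2)
    (e : Fin (N + 1) ⊕ Fin 3 →₀ ℕ) (he : g.coeff e ≠ 0) (he0 : e (.inl 0) = 0)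
    (he1 : e (.inr 0) = 0) (he2 : e (.inr 1) ≠ 0)
    (Φ : FractionRing (MvPolynomial (Fin r)
      (functionFieldModel k (fun _ => 0) (fun _ => 1) g)) ≃ₐ[k] E) :
    ∃ (T : Fin N ⊕ Option (Fin r) → E) (Y : E), AlgebraicIndependent k T ∧
      IntermediateField.adjoin k (Set.range T ∪ {Y}) = ⊤ ∧
      MvPolynomial.aeval (Sum.elim (Fin.cons 1 (fun i => T (.inl i))) ![1, Y, T (.inr none)]) g
        = 0 := by
  obtain ⟨val, h0, h1, hmem, hω, hind⟩ := cone_facts g e he he0 he1 he2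
  have hntA : Nontrivial (functionFieldModel k (fun _ => 0) (fun _ => 1) g) := by
    by_contra hcon
    rw [not_nontrivial_iff_subsingleton] at hcon
    have h2 : Subsingleton (FractionRing (MvPolynomial (Fin r)
      (functionFieldModel k (fun _ => 0) (fun _ => 1) g))) := by
      refine ⟨fun x y => ?_⟩
      have : (1 : FractionRing (MvPolynomial (Fin r)
        (functionFieldModel k (fun _ => 0) (fun _ => 1) g))) = 0 := by
        have h5 := congrArg (algebraMap (MvPolynomial (Fin r)
          (functionFieldModel k (fun _ => 0) (fun _ => 1) g)) (FractionRing (MvPolynomial (Fin r)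
          (functionFieldModel k (fun _ => 0) (fun _ => 1) g)))) (Subsingleton.elim (1 : MvPolynomial
          (Fin r) (functionFieldModel k (fun _ => 0) (fun _ => 1) g)) 0)
        rwa [map_one, map_zero] at h5
      rw [← mul_one x, ← mul_one y, this, mul_zero, mul_zero]
    have h3 : (1 : E) = 0 := by
      have h5 := congrArg Φ (Subsingleton.elim (1 : FractionRing (MvPolynomial (Fin r)
        (functionFieldModel k (fun _ => 0) (fun _ => 1) g))) 0)
      rwa [map_one, map_zero] at h5
    exact one_ne_zero h3
  have hntF : Nontrivial (FracCone k g) :=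
    (Subtype.val_injective : Function.Injective
      (Subtype.val : functionFieldModel k (fun _ => 0) (fun _ => 1) g → FracCone k g)).nontrivial
  let A := functionFieldModel k (fun _ => 0) (fun _ => 1) g
  let valA : Fin (N + 1) ⊕ Fin 3 → A := fun v => ⟨val v, hmem hntF v⟩
  have hcoe : ∀ p : MvPolynomial (Fin (N + 1) ⊕ Fin 3) k,
      ((MvPolynomial.aeval valA p : A) : FracCone k g) = MvPolynomial.aeval val p := by
    intro p
    exact MvPolynomial.comp_aeval_apply (R := k) valA A.val p
  refine ff_abs Φ g valA (Subtype.ext h0) (Subtype.ext h1) ?_ ?_ ?_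
  · refine Subtype.ext ?_
    rw [hcoe]
    obtain ⟨ω, hu, hω⟩ := hω d 2
    have := hω g hbi
    rw [toFrac_self] at this
    exact (hu.mul_right_eq_zero).1 this.symm
  · rw [algebraicIndependent_iff]
    intro p hp
    refine hind p ?_
    have := MvPolynomial.comp_aeval_apply (R := k)
      (Sum.elim (fun i : Fin N => valA (.inl (Fin.succ i))) (fun _ : Unit => valA (.inr 2))) A.val p
    rw [hp, map_zero] at this
    rw [this]
    congr 2
    funext v
    rcases v with i | i <;> rfl
  · refine eq_top_iff.2 ?_
    have h2 := Algebra.adjoin_adjoin_coe_preimage (R := k)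
      (s := ratioSet k (fun _ => 0) (fun _ => 1) g)
    refine h2.symm.le.trans (Algebra.adjoin_mono ?_)
    rintro φ ⟨α, β, p, q, hp, hq, hq0, hpq⟩
    obtain ⟨ω, hu, hω⟩ := hω α.toNat β
    rw [hω p (bihom_nat _ _ _ hp), hω q (bihom_nat _ _ _ hq)] at hpq
    rw [hω q (bihom_nat _ _ _ hq)] at hq0
    refine ⟨p, q, ?_, ?_⟩
    · intro h
      apply hq0
      rw [← hcoe, h]
      simp
    · refine Subtype.ext ?_
      refine Eq.trans ?_ (hcoe p).symm
      refine Eq.trans (congrArg (fun t => (φ : FracCone k g) * t) (hcoe q)) ?_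
      apply hu.mul_left_cancel
      rw [← hpq]
      ring

theorem final_thm
    (n d : ℕ) (hn : 3 ≤ n) (hd : n ≤ d) :
    VeryGenerallyHolds ℂ n 3 (fun _ => 0) (fun _ => 1) (d : ℤ) 2 (fun g =>
      ¬ IsStablyRationalModel ℂ (fun _ => 0) (fun _ => 1) g) := by
  classical
  obtain ⟨N, rfl⟩ : ∃ N, n = N + 1 := ⟨n - 1, by omega⟩
  have hN : 2 ≤ N := by omega
  let l : Fin N := ⟨0, by omega⟩
  let i1 : Fin N := ⟨1, by omega⟩
  have hl : i1 ≠ l := by simp [i1, l]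
  let e : Fin (N + 1) ⊕ Fin 3 →₀ ℕ := Finsupp.single (.inl l.succ) d + Finsupp.single (.inr 1) 2
  let g0 := Gpoly ℤ N d l
  let S := {P : MvPolynomial ((Fin (N + 1) ⊕ Fin 3) →₀ ℕ) ℤ //
    Odd (MvPolynomial.eval (fun e => g0.coeff e) P)}
  have : Countable (MvPolynomial ((Fin (N + 1) ⊕ Fin 3) →₀ ℕ) ℤ) := by
    have h2 : Countable (((Fin (N + 1) ⊕ Fin 3) →₀ ℕ) →₀ ℕ) := inferInstance
    exact (show Function.Injective (fun (p : MvPolynomial ((Fin (N + 1) ⊕ Fin 3) →₀ ℕ) ℤ) =>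
      (AddMonoidAlgebra.coeff p : _ →₀ ℤ)) from
        fun p q h => by ext m; exact DFunLike.congr_fun h m).countable
  have : Countable S := inferInstance
  obtain ⟨en, hen⟩ := exists_surjective_nat (Option S)
  let D : Option S → MvPolynomial ((Fin (N + 1) ⊕ Fin 3) →₀ ℕ) ℂ := fun o =>
    o.elim (MvPolynomial.X e) (fun P => MvPolynomial.map (Int.castRingHom ℂ) P.1)
  refine ⟨fun i => D (en i), ?_, ?_⟩
  · intro i
    beta_reduce
    generalize en i = o
    rcases o with _ | P
    · refine ⟨MvPolynomial.monomial e 1, isBihom_of_nat _ _ _ ?_, ?_⟩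
      · intro e' he'
        rw [MvPolynomial.support_monomial, if_neg one_ne_zero, Finset.mem_singleton] at he'
        subst he'
        simp [e, Finsupp.single_apply]
      · simp [evalCoeff, D]
    · refine ⟨Gpoly ℂ N d l, isBihom_of_nat _ _ _ (Gpoly_supp ℂ N d hd hN l), ?_⟩
      have h1 : ∀ e, (Gpoly ℂ N d l).coeff e = Int.castRingHom ℂ (g0.coeff e) := by
        intro e
        rw [← Gpoly_map (Int.castRingHom ℂ) N d l, MvPolynomial.coeff_map]
      have h2 : evalCoeff ℂ (Gpoly ℂ N d l) (MvPolynomial.map (Int.castRingHom ℂ) P.1)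
          = Int.castRingHom ℂ (MvPolynomial.eval (fun e => g0.coeff e) P.1) := by
        rw [evalCoeff, MvPolynomial.eval_map, MvPolynomial.eval₂_comp]
        exact congrArg (fun f => MvPolynomial.eval₂ (Int.castRingHom ℂ) f P.1) (funext h1)
      change evalCoeff ℂ (Gpoly ℂ N d l) (MvPolynomial.map (Int.castRingHom ℂ) P.1) ≠ 0
      rw [h2, eq_intCast, Int.cast_ne_zero]
      intro h
      have := P.2
      rw [h] at this
      simp at this
  · intro g hg hne
    have hne' : ∀ o, evalCoeff ℂ g (D o) ≠ 0 := fun o => by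
      obtain ⟨i, rfl⟩ := hen o
      exact hne i
    have hbi : ∀ e ∈ g.support, ∑ i, e (.inl i) = d ∧ ∑ j, e (.inr j) = 2 := by
      simpa using bihom_nat _ _ g hg
    have hce : g.coeff e ≠ 0 := by
      have := hne' none
      simpa [evalCoeff, D] using this
    rintro ⟨r, s, ⟨Φ⟩⟩
    obtain ⟨T, Y, hT, hgen, hY⟩ := ff_facts g hbi e hce (by simp [e])
      (by simp [e]) (by simp [e]) Φ
    obtain ⟨O, gO, hO2, hgO1, hgO2⟩ := exists_O g g0 (fun P hP => by
      have := hne' (some ⟨P, hP⟩)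
      intro h
      apply this
      change MvPolynomial.eval _ (MvPolynomial.map (Int.castRingHom ℂ) P) = 0
      rw [MvPolynomial.eval_map]
      exact h)
    rw [Gpoly_map] at hgO2
    refine final_contra (C := ℂ) s O hO2 N d hd hN l i1 hl gO hgO2 ?_ T hT Y hgen ?_
    · intro e he
      apply hbi
      rw [← hgO1, MvPolynomial.mem_support_iff, MvPolynomial.coeff_map]
      rw [MvPolynomial.mem_support_iff] at he
      intro h
      exact he (Subtype.ext h)
    · rw [hgO1]; exact hY

end
end ConicBundleFormalization

namespace ConicBundleFormalization

open MvPolynomial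

/-- **Corollary 1.2.**  A very general hypersurface of bidegree `(d,2)` in
`ℙ^{n-1} × ℙ²` with `d ≥ n ≥ 3` is not stably rational. -/
theorem cor_bidegree_d_2_hypersurface
    (n d : ℕ) (hn : 3 ≤ n) (hd : n ≤ d) :
    VeryGenerallyHolds ℂ n 3 (fun _ => 0) (fun _ => 1) (d : ℤ) 2 (fun g =>
      ¬ IsStablyRationalModel ℂ (fun _ => 0) (fun _ => 1) g) := by
  exact final_thm n d hn hd

end ConicBundleFormalization
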